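/- Let g be a root-reductive Lie algebra with splitting maximal toral subalgebra h and Dynkin Borel subalgebra b ⊇ h, and let λ, μ ∈ h*. If the simple module L(μ) is a composition factor of the Verma module M(λ), then μ ≼ λ and μ ∈ W[λ]·λ. -/

import Mathlib

noncomputable section
namespace Paper

variable (K : Type) [Field K] [IsAlgClosed K] [CharZero K]
variable (g : Type) [LieRing g] [LieAlgebra K g]

def adWeightSpace (h : LieSubalgebra K g) (α : Module.Dual K h) : Submodule K g where
  carrier := {x | ∀ H : h, ⁅(H : g), x⁆ = α H • x}
  add_mem' := by intro a b ha hb H; rw [lie_add, ha H, hb H, smul_add]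
  zero_mem' := by intro H; rw [lie_zero, smul_zero]
  smul_mem' := by intro c x hx H; rw [lie_smul, hx H, smul_comm]

def IsRootOf (h : LieSubalgebra K g) (α : Module.Dual K h) : Prop :=
  α ≠ 0 ∧ adWeightSpace K g h α ≠ ⊥

def IsToralIn (s t : LieSubalgebra K g) : Prop :=
  t ≤ s ∧ IsLieAbelian t ∧
    s.toSubmodule ≤ ⨆ α : Module.Dual K t, s.toSubmodule ⊓ adWeightSpace K g t α

def IsMaxToralIn (s t : LieSubalgebra K g) : Prop :=
  IsToralIn K g s t ∧ ∀ t' : LieSubalgebra K g, IsToralIn K g s t' → t ≤ t' → t' = t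

/-- A root-reductive Lie algebra `g` together with a splitting maximal toral subalgebra `h`
and a splitting Borel subalgebra `b ⊇ h` determined by a set `pos` of positive roots. -/
structure Setup where
  /-- the exhausting chain of finite-dimensional reductive subalgebras -/
  F : ℕ → LieSubalgebra K g
  F_mono : Monotone F
  F_exhaust : ∀ x : g, ∃ n, x ∈ F n
  F_findim : ∀ n, FiniteDimensional K (F n)
  /-- each `F n` is reductive: every abelian ideal is central -/
  F_reductive : ∀ n, ∀ I : LieIdeal K (F n), IsLieAbelian I → I ≤ LieAlgebra.center K (F n)
  /-- the nested chain of Cartan subalgebras witnessing the root inclusions -/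
  C : ℕ → LieSubalgebra K g
  C_mono : Monotone C
  C_le : ∀ n, C n ≤ F n
  C_cartan : ∀ n, (LieSubalgebra.comap (F n).incl (C n)).IsCartanSubalgebra
  /-- each inclusion `F n ↪ F (n+1)` is a root inclusion with respect to `C (n+1)`:
  every root space of `F n` relative to `C n` is a root space of `F (n+1)` -/
  C_rootIncl : ∀ n, ∀ α : Module.Dual K (C n), α ≠ 0 →
    (F n).toSubmodule ⊓ adWeightSpace K g (C n) α ≠ ⊥ →
    ∃ β : Module.Dual K (C (n + 1)),
      (F n).toSubmodule ⊓ adWeightSpace K g (C n) α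
        = (F (n + 1)).toSubmodule ⊓ adWeightSpace K g (C (n + 1)) β
  /-- the splitting maximal toral subalgebra -/
  h : LieSubalgebra K g
  h_maxToral : ∀ n, IsMaxToralIn K g (F n) (h ⊓ F n)
  /-- `g` is the direct sum of its `h`-weight spaces -/
  h_indep : iSupIndep fun α : Module.Dual K h => adWeightSpace K g h α
  h_span : (⨆ α : Module.Dual K h, adWeightSpace K g h α) = ⊤
  /-- the set `Δ⁺` of positive roots -/
  pos : Set (Module.Dual K h)
  pos_root : ∀ α ∈ pos, IsRootOf K g h α
  pos_add : ∀ α ∈ pos, ∀ β ∈ pos, IsRootOf K g h (α + β) → α + β ∈ pos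
  pos_polar : ∀ α : Module.Dual K h, IsRootOf K g h α → (α ∈ pos ↔ ¬(-α ∈ pos))
  neg_add : ∀ α β : Module.Dual K h, IsRootOf K g h α → IsRootOf K g h β →
    α ∉ pos → β ∉ pos → IsRootOf K g h (α + β) → α + β ∉ pos
  /-- the splitting Borel subalgebra -/
  b : LieSubalgebra K g
  b_eq : b.toSubmodule = h.toSubmodule ⊔ ⨆ α ∈ pos, adWeightSpace K g h α


variable {K g}

namespace Setup

variable (S : Setup K g)

/-- `h ∩ g_n`. -/
def hn (n : ℕ) : LieSubalgebra K g := S.h ⊓ S.F n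

/-- restriction of a functional on `h` to `h ∩ g_n`. -/
def resDual (n : ℕ) (lam : Module.Dual K S.h) : Module.Dual K (S.hn n) :=
  lam.comp (LieSubalgebra.inclusion (inf_le_left : S.hn n ≤ S.h)).toLinearMap

/-- the `α`-root space of `g_n` relative to `h ∩ g_n`. -/
def rootSpaceN (n : ℕ) (α : Module.Dual K (S.hn n)) : Submodule K g :=
  (S.F n).toSubmodule ⊓ adWeightSpace K g (S.hn n) α

/-- the set of `b`-positive roots of `g_n`. -/
def posRootsN (n : ℕ) : Set (Module.Dual K (S.hn n)) :=
  {α | α ≠ 0 ∧ S.rootSpaceN n α ≠ ⊥ ∧ S.rootSpaceN n α ≤ S.b.toSubmodule}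

/-- `ρ_n`, the half sum of the positive roots of `g_n` with respect to `b ∩ g_n`. -/
def rhoN (n : ℕ) : Module.Dual K (S.hn n) :=
  (2 : K)⁻¹ • ∑ᶠ α ∈ S.posRootsN n, α

/-- `α` is a simple `b`-positive root: it is positive and cannot be written as a sum of
two or more positive roots. -/
def IsSimpleRoot (α : Module.Dual K S.h) : Prop :=
  α ∈ S.pos ∧ ¬∃ s : Multiset (Module.Dual K S.h),
    2 ≤ Multiset.card s ∧ (∀ β ∈ s, β ∈ S.pos) ∧ s.sum = α

/-- `b` is a Dynkin Borel subalgebra: it is generated, as a Lie subalgebra, by `h` together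
with the simple root spaces. -/
def IsDynkin : Prop :=
  S.b = LieSubalgebra.lieSpan K g
    ((S.h : Set g) ∪ ⋃ α ∈ {α | S.IsSimpleRoot α}, (adWeightSpace K g S.h α : Set g))

/-- the partial order `≼` on `h^*`: `lam ≼ mu` iff `mu - lam` is a `ℤ≥0`-linear combination
of positive roots. -/
def wle (lam mu : Module.Dual K S.h) : Prop :=
  ∃ s : Multiset (Module.Dual K S.h), (∀ β ∈ s, β ∈ S.pos) ∧ mu - lam = s.sum

/-- `g` is locally semisimple: each `g_n` is a semisimple Lie algebra. -/
def IsLocallySemisimple : Prop := ∀ n, LieAlgebra.IsSemisimple K (S.F n)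

end Setup


/-- the universal enveloping algebra of `g`. -/
abbrev Env (K g : Type) [Field K] [LieRing g] [LieAlgebra K g] : Type :=
  UniversalEnvelopingAlgebra K g

namespace Setup

variable {K : Type} [Field K] [IsAlgClosed K] [CharZero K]
variable {g : Type} [LieRing g] [LieAlgebra K g]
variable (S : Setup K g)

/-- the nilpotent radical `n⁺ = ⨁_{α ∈ Δ⁺} g^α` of `b`, as a subspace of `g`. -/
def nplus : Submodule K g := ⨆ α ∈ S.pos, adWeightSpace K g S.h α

/-- the left ideal of `U(g)` generated by `n⁺` and the elements `H - lam(H)`, `H ∈ h`. -/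
def vermaIdeal (lam : Module.Dual K S.h) : Submodule (Env K g) (Env K g) :=
  Submodule.span (Env K g)
    ((UniversalEnvelopingAlgebra.ι K '' (S.nplus : Set g)) ∪
      Set.range fun H : S.h =>
        UniversalEnvelopingAlgebra.ι K (H : g) - algebraMap K (Env K g) (lam H))

/-- the Verma module `M(lam) = U(g)/I`. -/
abbrev Verma (lam : Module.Dual K S.h) : Type := Env K g ⧸ S.vermaIdeal lam

/-- the maximal proper submodule of the Verma module `M(lam)`,
i.e. the sum of all proper submodules. -/
def maxSub (lam : Module.Dual K S.h) : Submodule (Env K g) (S.Verma lam) :=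
  sSup {N : Submodule (Env K g) (S.Verma lam) | N ≠ ⊤}

/-- the simple module `L(lam)`, the unique simple quotient of `M(lam)`. -/
abbrev SimpleL (lam : Module.Dual K S.h) : Type := S.Verma lam ⧸ S.maxSub lam

/-- `H` is the coroot `h_α` of the root `α`:  `α(H) = 2` and `H ∈ [g^α, g^{-α}]`. -/
def IsCoroot (α : Module.Dual K S.h) (H : S.h) : Prop :=
  α H = 2 ∧ ∃ x ∈ adWeightSpace K g S.h α, ∃ y ∈ adWeightSpace K g S.h (-α),
    (H : g) = ⁅x, y⁆

/-- the dot-reflection `s_α · mu = mu - (mu + ρ)(h_α) α` associated to a root `α`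
with coroot `Hα`, relative to the half sum `ρ` of positive roots. -/
def dotReflect (ρ α : Module.Dual K S.h) (Hα : S.h) (mu : Module.Dual K S.h) :
    Module.Dual K S.h :=
  mu - ((mu + ρ) Hα) • α

/-- `ρ` is the global half sum of positive roots: its restriction to each `h ∩ g_n`
is the half sum `ρ_n` of positive roots of `g_n`. -/
def IsGlobalRho (ρ : Module.Dual K S.h) : Prop := ∀ n : ℕ, S.resDual n ρ = S.rhoN n

/-- `lam` is strongly linked to `mu` (relative to `ρ`). -/
inductive StronglyLinked (ρ : Module.Dual K S.h) :
    Module.Dual K S.h → Module.Dual K S.h → Prop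
  | refl (mu : Module.Dual K S.h) : StronglyLinked ρ mu mu
  | step {lam mu : Module.Dual K S.h} (α : Module.Dual K S.h) (Hα : S.h) :
      α ∈ S.pos → S.IsCoroot α Hα →
      S.wle (S.dotReflect ρ α Hα mu) mu →
      StronglyLinked ρ lam (S.dotReflect ρ α Hα mu) →
      StronglyLinked ρ lam mu

/-- `lam` is antidominant: `(lam + ρ)(h_α)` is not a positive integer
for any positive root `α`. -/
def IsAntidominant (ρ lam : Module.Dual K S.h) : Prop :=
  ∀ α ∈ S.pos, ∀ Hα : S.h, S.IsCoroot α Hα → ¬∃ k : ℕ, 0 < k ∧ (lam + ρ) Hα = (k : K)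

/-- `lam` is almost antidominant: `(lam + ρ)(h_α)` is a positive integer
for only finitely many positive roots `α`. -/
def IsAlmostAntidominant (ρ lam : Module.Dual K S.h) : Prop :=
  {α | α ∈ S.pos ∧ ∃ Hα : S.h, S.IsCoroot α Hα ∧
    ∃ k : ℕ, 0 < k ∧ (lam + ρ) Hα = (k : K)}.Finite

end Setup

namespace Setup

variable {K : Type} [Field K] [IsAlgClosed K] [CharZero K]
variable {g : Type} [LieRing g] [LieAlgebra K g]
variable (S : Setup K g)

/-- the reflection `s_α : mu ↦ mu - mu(h_α) α`, as a linear map on `h^*`. -/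
def reflectionMap (α : Module.Dual K S.h) (Hα : S.h) :
    Module.Dual K S.h →ₗ[K] Module.Dual K S.h where
  toFun mu := mu - mu Hα • α
  map_add' mu ν := by
    simp only [LinearMap.add_apply, add_smul]
    abel
  map_smul' c mu := by
    simp only [LinearMap.smul_apply, RingHom.id_apply, smul_sub, smul_smul, smul_eq_mul]

/-- the reflection `s_α` associated to a root `α` with coroot `Hα`,
as a linear automorphism of `h^*`. -/
def reflection (α : Module.Dual K S.h) (Hα : S.h) (h2 : α Hα = 2) :
    Module.Dual K S.h ≃ₗ[K] Module.Dual K S.h :=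
  LinearEquiv.ofInvolutive (S.reflectionMap α Hα) (by
    intro mu
    show S.reflectionMap α Hα (mu - mu Hα • α) = mu
    show (mu - mu Hα • α) - ((mu - mu Hα • α) Hα) • α = mu
    rw [LinearMap.sub_apply, LinearMap.smul_apply, h2, smul_eq_mul]
    module)

/-- the Weyl group of `g`, realized as the group of linear automorphisms of `h^*`
generated by the reflections in the roots. -/
def weylGroup : Subgroup (Module.Dual K S.h ≃ₗ[K] Module.Dual K S.h) :=
  Subgroup.closure
    {w | ∃ (α : Module.Dual K S.h) (Hα : S.h) (hc : S.IsCoroot α Hα),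
      IsRootOf K g S.h α ∧ w = S.reflection α Hα hc.1}

/-- the dot action `w · mu = w(mu + ρ) - ρ`. -/
def dotAct (ρ : Module.Dual K S.h) (w : Module.Dual K S.h ≃ₗ[K] Module.Dual K S.h)
    (mu : Module.Dual K S.h) : Module.Dual K S.h :=
  w (mu + ρ) - ρ

/-- the root lattice `Λ`, the `ℤ`-span of the roots in `h^*`. -/
def rootLattice : Submodule ℤ (Module.Dual K S.h) :=
  Submodule.span ℤ {α : Module.Dual K S.h | IsRootOf K g S.h α}

end Setup

variable {K : Type} [Field K] [IsAlgClosed K] [CharZero K]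
variable {g : Type} [LieRing g] [LieAlgebra K g]

lemma env_smul_comm {M : Type} [AddCommGroup M] [Module K M] [Module (Env K g) M]
    [IsScalarTower K (Env K g) M] (c : K) (r : Env K g) (m : M) :
    r • (c • m) = c • (r • m) := by
  rw [← algebraMap_smul (Env K g) c m, ← mul_smul, ← Algebra.commutes, mul_smul,
    algebraMap_smul]

namespace Setup

variable (S : Setup K g)

section Modules

variable (M : Type) [AddCommGroup M] [Module K M] [Module (Env K g) M]
  [IsScalarTower K (Env K g) M]

/-- the `lam`-weight space of a `U(g)`-module `M`. -/
def wtSpace (lam : Module.Dual K S.h) : Submodule K M where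
  carrier := {m | ∀ H : S.h, UniversalEnvelopingAlgebra.ι K (H : g) • m = lam H • m}
  add_mem' := by
    intro a b ha hb H
    rw [smul_add, ha H, hb H, smul_add]
  zero_mem' := by
    intro H
    rw [smul_zero, smul_zero]
  smul_mem' := by
    intro c x hx H
    rw [env_smul_comm, hx H, smul_comm]

/-- the support of `M`: the set of `h`-weights of `M`. -/
def support : Set (Module.Dual K S.h) := {lam | S.wtSpace M lam ≠ ⊥}

/-- `M` is an object of the extended category `O-bar`:  it is an `h`-weight module with
finite-dimensional weight spaces and `U(n⁺) ⬝ v` is finite dimensional for every `v ∈ M`. -/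
structure InO : Prop where
  indep : iSupIndep fun lam : Module.Dual K S.h => S.wtSpace M lam
  span : (⨆ lam : Module.Dual K S.h, S.wtSpace M lam) = ⊤
  finite : ∀ lam : Module.Dual K S.h, FiniteDimensional K (S.wtSpace M lam)
  locFin : ∀ v : M, ∃ N : Submodule K M, FiniteDimensional K N ∧ v ∈ N ∧
    ∀ x ∈ S.nplus, ∀ m ∈ N, UniversalEnvelopingAlgebra.ι K x • m ∈ N

end Modules

end Setup

/-- a `U(g)`-module is indecomposable if it is nonzero and is not the direct sum of two
nonzero submodules. -/
def Indecomposable (M : Type) [AddCommGroup M] [Module (Env K g) M] : Prop :=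
  (⊤ : Submodule (Env K g) M) ≠ ⊥ ∧
    ∀ N₁ N₂ : Submodule (Env K g) M, IsCompl N₁ N₂ → N₁ = ⊥ ∨ N₂ = ⊥

/-- the subquotient `N₂ / N₁` of a pair of submodules. -/
abbrev subQuot {M : Type} [AddCommGroup M] [Module (Env K g) M]
    (N₁ N₂ : Submodule (Env K g) M) : Type :=
  N₂ ⧸ (N₁.comap N₂.subtype)

namespace Setup

variable (S : Setup K g)

/-- A composition series of `M` with bounds `lam ≼ nu`: a finite filtration of `M` together
with a relevant index set `J` such that relevant subquotients are simple modules `L(ξ)` with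
`lam ≼ ξ ≼ nu`, and irrelevant subquotients either have no weights in the interval
`[lam, nu]` or are simple modules `L(ξ)` with `ξ ≻ lam` and `ξ ⋠ nu`. -/
structure CompSeries (lam nu : Module.Dual K S.h) (M : Type) [AddCommGroup M] [Module K M]
    [Module (Env K g) M] [IsScalarTower K (Env K g) M] where
  k : ℕ
  c : Fin (k + 1) → Submodule (Env K g) M
  mono : Monotone c
  bot : c 0 = ⊥
  top : c (Fin.last k) = ⊤
  J : Finset (Fin k)
  rel : ∀ j ∈ J, ∃ ξ : Module.Dual K S.h, S.wle lam ξ ∧ S.wle ξ nu ∧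
    Nonempty (subQuot (c j.castSucc) (c j.succ) ≃ₗ[Env K g] S.SimpleL ξ)
  irrel : ∀ j : Fin k, j ∉ J →
    (∀ mu : Module.Dual K S.h, S.wle lam mu → S.wle mu nu →
        S.wtSpace (subQuot (c j.castSucc) (c j.succ)) mu = ⊥) ∨
    (∃ ξ : Module.Dual K S.h, S.wle lam ξ ∧ ξ ≠ lam ∧ ¬S.wle ξ nu ∧
        Nonempty (subQuot (c j.castSucc) (c j.succ) ≃ₗ[Env K g] S.SimpleL ξ))

/-- the `j`-th subquotient of a composition series. -/
abbrev CompSeries.quot {S : Setup K g} {lam nu : Module.Dual K S.h} {M : Type}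
    [AddCommGroup M] [Module K M] [Module (Env K g) M] [IsScalarTower K (Env K g) M]
    (T : S.CompSeries lam nu M) (j : Fin T.k) : Type :=
  subQuot (T.c j.castSucc) (T.c j.succ)

/-- the number of times the simple module `L(mu)` occurs in the composition series `T`. -/
noncomputable def CompSeries.mult {S : Setup K g} {lam nu : Module.Dual K S.h} {M : Type}
    [AddCommGroup M] [Module K M] [Module (Env K g) M] [IsScalarTower K (Env K g) M]
    (T : S.CompSeries lam nu M) (mu : Module.Dual K S.h) : ℕ :=
  Nat.card {j : Fin T.k // j ∈ T.J ∧ Nonempty (T.quot j ≃ₗ[Env K g] S.SimpleL mu)}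

/-- `L(mu)` is a composition factor of `M`: it occurs in some composition series of `M`
with bounds `lam ≼ mu ≼ nu`. -/
def IsCompFactor (M : Type) [AddCommGroup M] [Module K M] [Module (Env K g) M]
    [IsScalarTower K (Env K g) M] (mu : Module.Dual K S.h) : Prop :=
  ∃ (lam nu : Module.Dual K S.h) (T : S.CompSeries lam nu M),
    S.wle lam mu ∧ S.wle mu nu ∧
    ∃ j ∈ T.J, Nonempty (T.quot j ≃ₗ[Env K g] S.SimpleL mu)

end Setup

/-- A generalized composition series of `M`: a family of submodules indexed by a totally
ordered set `(J, <)`, strictly increasing, with trivial intersection, union equal to `M`,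
and all subquotients `M_j / M_{<j}` simple. -/
structure GenCompSeries (M : Type) [AddCommGroup M] [Module (Env K g) M] where
  J : Type
  lt : J → J → Prop
  linear : IsLinearOrder J lt
  c : J → Submodule (Env K g) M
  strict : ∀ {i j : J}, lt i j → c i < c j
  iInf_bot : (⨅ j, c j) = ⊥
  iSup_top : (⨆ j, c j) = ⊤
  simple : ∀ j : J,
    IsSimpleModule (Env K g) (subQuot (⨆ i : {i : J // lt i j}, c i) (c j))

/-- the subquotient `M_j / M_{<j}` of a generalized composition series. -/
abbrev GenCompSeries.quot {M : Type} [AddCommGroup M] [Module (Env K g) M]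
    (T : GenCompSeries (K := K) (g := g) M) (j : T.J) : Type :=
  subQuot (⨆ i : {i : T.J // T.lt i j}, T.c i) (T.c j)

set_option linter.unusedSectionVars false

section

section Sl2

variable {K V : Type*} [Field K] [CharZero K] [AddCommGroup V] [Module K V]

/-- `E`, `F`, `H` are operators on `V` satisfying the commutation relations of `sl₂`. -/
structure Sl2Ops (E F H : Module.End K V) : Prop where
  ef : ∀ v, E (F v) = F (E v) + H v
  he : ∀ v, H (E v) = E (H v) + (2 : K) • E v
  hf : ∀ v, H (F v) = F (H v) - (2 : K) • F v

namespace Sl2Ops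

variable {E F H : Module.End K V} (t : Sl2Ops E F H)

omit [CharZero K] in
include t in
lemma symm : Sl2Ops F E (-H) where
  ef v := by simp [t.ef]
  he v := by simp [t.hf]; abel
  hf v := by simp [t.he]; abel

omit [CharZero K] in
include t in
lemma h_pow_e (n : ℕ) (v : V) : H ((E ^ n) v) = (E ^ n) (H v) + (2 * n : K) • (E ^ n) v := by
  induction n with
  | zero => simp
  | succ n ih =>
    rw [pow_succ', Module.End.mul_apply, Module.End.mul_apply, t.he, ih]
    simp only [map_add, map_smul]
    push_cast; module

omit [CharZero K] in
include t in
lemma h_pow_f (n : ℕ) (v : V) : H ((F ^ n) v) = (F ^ n) (H v) - (2 * n : K) • (F ^ n) v := by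
  have := t.symm.h_pow_e n v
  simp only [LinearMap.neg_apply, map_neg] at this
  rw [← neg_inj, this]; abel

omit [CharZero K] in
include t in
lemma pow_e_f (n : ℕ) (v : V) :
    (E ^ (n + 1)) (F v) = F ((E ^ (n + 1)) v) + ((n : K) + 1) • (E ^ n) (H v + (n : K) • v) := by
  induction n with
  | zero => simp [t.ef]
  | succ n ih =>
    have h2 : ∀ m u, (E ^ (m + 1)) u = E ((E ^ m) u) := fun m u => by
      rw [pow_succ', Module.End.mul_apply]
    rw [h2 (n + 1), ih, h2 (n + 1) v, map_add, t.ef, t.h_pow_e, map_smul, ← h2 n]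
    simp only [map_add, map_smul]
    push_cast; module

/-- the scalar by which `E ^ (n + j) F ^ j` compares with `E ^ n`. -/
def coef (κ : K) (n : ℕ) : ℕ → K
  | 0 => 1
  | j + 1 => ((n : K) + j + 1) * (κ + n - j) * coef κ n j

/-- the derivative of `coef` in the weight. -/
def coef' (κ : K) (n : ℕ) : ℕ → K
  | 0 => 0
  | j + 1 => ((n : K) + j + 1) * (κ + n - j) * coef' κ n j + ((n : K) + j + 1) * coef κ n j

lemma coef_ne_zero {κ : K} {n j : ℕ} (h : ∀ i < j, κ + n - i ≠ 0) : coef κ n j ≠ 0 := by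
  induction j with
  | zero => simp [coef]
  | succ j ih =>
    rw [coef]
    have h1 : (n : K) + j + 1 ≠ 0 := by
      have := Nat.cast_add_one_ne_zero (R := K) (n + j); push_cast at this; exact this
    refine mul_ne_zero (mul_ne_zero h1 (h j (by simp))) ?_
    exact ih fun i hi => h i (by omega)

lemma coef'_ne_zero {κ : K} {n j : ℕ} (h : coef κ n j = 0) : coef' κ n j ≠ 0 := by
  induction j with
  | zero => simp [coef] at h
  | succ j ih =>
    have h1 : (n : K) + j + 1 ≠ 0 := by
      have := Nat.cast_add_one_ne_zero (R := K) (n + j); push_cast at this; exact this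
    rw [coef'] 
    by_cases hj : coef κ n j = 0
    · rw [hj, mul_zero, add_zero]
      refine mul_ne_zero (mul_ne_zero h1 fun h0 => ?_) (ih hj)
      have : coef κ n j ≠ 0 := coef_ne_zero fun i hi h2 => by
        have : (i : K) = j := by linear_combination h0 - h2
        have := Nat.cast_injective (R := K) this
        omega
      exact this hj
    · rw [coef] at h
      have h0 : κ + n - j = 0 := by
        rcases mul_eq_zero.1 h with h | h
        · exact (mul_eq_zero.1 h).resolve_left h1
        · exact absurd h hj
      rw [h0, mul_zero, zero_mul, zero_add]
      exact mul_ne_zero h1 hj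

omit [CharZero K] in
include t in
lemma pow_e_pow_f {κ : K} {y : V} (hy : H y = κ • y) {n : ℕ} (hn : (E ^ (n + 1)) y = 0) (j : ℕ) :
    (E ^ (n + j)) ((F ^ j) y) = coef κ n j • (E ^ n) y ∧ (E ^ (n + j + 1)) ((F ^ j) y) = 0 := by
  induction j with
  | zero => simp [coef, hn]
  | succ j ih =>
    have key : (E ^ (n + (j + 1))) ((F ^ (j + 1)) y) = coef κ n (j + 1) • (E ^ n) y := by
      rw [pow_succ' F, Module.End.mul_apply, ← add_assoc, t.pow_e_f, ih.2, map_zero, zero_add,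
        t.h_pow_f, hy, map_smul, map_add, map_sub, map_smul, map_smul, map_smul, ih.1, coef]
      push_cast; module
    refine ⟨key, ?_⟩
    rw [pow_succ' E, Module.End.mul_apply, key, map_smul, ← Module.End.mul_apply, ← pow_succ', hn,
      smul_zero]

include t in
/-- the divided injectivity of powers of `F` on a weight space. -/
lemma eq_zero_of_pow_f {κ : K} {x : V} (hx : H x = κ • x) {N j : ℕ} (hN : (E ^ N) x = 0)
    (hj : (F ^ j) x = 0) (hκ : ∀ n i : ℕ, i < j → κ + n - i ≠ 0) : x = 0 := by
  induction N with
  | zero => simpa using hN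
  | succ n ih =>
    have := (t.pow_e_pow_f hx hN j).1
    rw [hj, map_zero] at this
    exact ih ((smul_eq_zero.1 this.symm).resolve_left (coef_ne_zero (hκ n)))

include t in
lemma eq_zero_of_pow_f_nat {k : ℕ} {x : V} (hx : H x = (k : K) • x) {N j : ℕ}
    (hN : (E ^ N) x = 0) (hj : (F ^ j) x = 0) (hk : j ≤ k) : x = 0 := by
  refine t.eq_zero_of_pow_f hx hN hj fun n i hi h => ?_
  have : ((k + n : ℕ) : K) = i := by push_cast; linear_combination h
  have := Nat.cast_injective (R := K) this
  omega

include t in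
lemma exists_int {κ : K} {x : V} (hx : H x = κ • x) (h0 : x ≠ 0) {N j : ℕ} (hN : (E ^ N) x = 0)
    (hj : (F ^ j) x = 0) : ∃ z : ℤ, κ = z := by
  by_contra! hz
  refine h0 (t.eq_zero_of_pow_f hx hN hj fun n i _ h => hz (i - n) ?_)
  push_cast; linear_combination h

include t in
private lemma semisimple_aux {κ : K} (hκ : ∀ m : ℕ, κ + m + 1 ≠ 0) {N : ℕ} (hE : E ^ N = 0)
    (hF : F ^ N = 0) {y z : V} (hy : H y = κ • y + z) (hz : H z = κ • z) : z = 0 := by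
  have main : ∀ n : ℕ, ∀ y : V, H y = κ • y + z → (E ^ n) y = 0 → z = 0 := by
    intro n
    induction n with
    | zero =>
      intro y hy h0
      rw [pow_zero, Module.End.one_apply] at h0
      simpa [h0] using hy.symm
    | succ n ih =>
      intro y hy hn
      have hEz : (E ^ (n + 1)) z = 0 := by
        have h1 := t.h_pow_e (n + 1) y
        rw [hy, hn] at h1
        simpa [hn] using h1.symm
      have hform : ∀ j, (E ^ (n + j)) ((F ^ j) y)
          = coef κ n j • (E ^ n) y + coef' κ n j • (E ^ n) z ∧
          (E ^ (n + j + 1)) ((F ^ j) y) = 0 := by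
        intro j
        induction j with
        | zero => simp [coef, coef', hn]
        | succ j ihj =>
          have key : (E ^ (n + (j + 1))) ((F ^ (j + 1)) y)
              = coef κ n (j + 1) • (E ^ n) y + coef' κ n (j + 1) • (E ^ n) z := by
            rw [pow_succ' F, Module.End.mul_apply, ← add_assoc, t.pow_e_f, ihj.2, map_zero,
              zero_add, t.h_pow_f, hy]
            simp only [map_add, map_sub, map_smul]
            rw [(t.pow_e_pow_f hz hEz j).1, ihj.1, coef, coef']
            push_cast; module
          refine ⟨key, ?_⟩
          rw [pow_succ' E, Module.End.mul_apply, key, map_add, map_smul, map_smul,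
            ← Module.End.mul_apply, ← Module.End.mul_apply, ← pow_succ', hn, hEz]
          simp
      have h1 := (hform N).1
      rw [hF, LinearMap.zero_apply, map_zero] at h1
      have hEnz : (E ^ n) z = 0 := by
        have h2 : coef κ n N • (E ^ n) z = 0 := by
          have h3 := congrArg H h1
          rw [map_zero, map_add, map_smul, map_smul, t.h_pow_e, t.h_pow_e, hy, hz] at h3
          simp only [map_add, map_smul] at h3
          have : coef κ n N • (E ^ n) z = -(κ + 2 * n) •
            (coef κ n N • (E ^ n) y + coef' κ n N • (E ^ n) z) := by
            rw [← sub_eq_zero, h3]; module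
          rw [this, ← h1, smul_zero]
        rcases smul_eq_zero.1 h2 with h | h
        · rw [h, zero_smul, zero_add] at h1
          exact (smul_eq_zero.1 h1.symm).resolve_left (coef'_ne_zero h)
        · exact h
      set p := (E ^ n) y with hp
      have hHp : H p = (κ + 2 * n) • p := by
        rw [hp, t.h_pow_e, hy, map_add, map_smul, hEnz]; module
      have hEp : (E ^ (0 + 1)) p = 0 := by
        rw [hp, ← Module.End.mul_apply, ← pow_add, zero_add, add_comm]; exact hn
      have h4 := (t.pow_e_pow_f hHp hEp n).1
      rw [zero_add, pow_zero, Module.End.one_apply] at h4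
      have hc : coef (κ + 2 * n) 0 n ≠ 0 := coef_ne_zero fun i hi h => hκ (2 * n - i - 1) (by
        have : ((2 * n - i - 1 : ℕ) : K) = 2 * n - i - 1 := by
          rw [Nat.cast_sub (by omega), Nat.cast_sub (by omega)]; push_cast; ring
        rw [this]; push_cast at h; linear_combination h)
      refine ih (y - (coef (κ + 2 * n) 0 n)⁻¹ • (F ^ n) p) ?_ ?_
      · rw [map_sub, map_smul, t.h_pow_f, hHp, map_smul, hy]; module
      · rw [map_sub, map_smul, h4, smul_smul, inv_mul_cancel₀ hc, one_smul, sub_self]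
  exact main N y hy (by simp [hE])

include t in
/-- `H` acts semisimply when `E` and `F` are nilpotent. -/
lemma semisimple {κ : K} {N : ℕ} (hE : E ^ N = 0) (hF : F ^ N = 0) {y z : V}
    (hy : H y = κ • y + z) (hz : H z = κ • z) : z = 0 := by
  by_cases hκ : ∀ m : ℕ, κ + m + 1 ≠ 0
  · exact t.semisimple_aux hκ hE hF hy hz
  · push Not at hκ
    obtain ⟨m, hm⟩ := hκ
    have := t.symm.semisimple_aux (κ := -κ) (y := y) (z := -z) (N := N) (fun m' h => ?_) hF hE ?_ ?_
    · simpa using this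
    · have : ((m + m' + 2 : ℕ) : K) = 0 := by push_cast; linear_combination hm + h
      exact absurd this (Nat.cast_ne_zero.2 (by omega))
    · simp [hy]; abel
    · simp [hz]

end Sl2Ops

end Sl2

end

section

section SolvableIdeals

variable {K L : Type*} [Field K] [IsAlgClosed K] [CharZero K] [LieRing L] [LieAlgebra K L]
  [FiniteDimensional K L]

/-- Lie's theorem for a solvable ideal acting on a nonzero subquotient of the adjoint module. -/
lemma exists_ideal_weight (I A B : LieIdeal K L) [LieAlgebra.IsSolvable I] (hBA : ¬ B ≤ A) :
    ∃ (χ : Module.Dual K I) (P : LieIdeal K L), P ≤ B ∧ ¬ P ≤ A ∧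
      ∀ z : I, ∀ x ∈ P, ⁅(z : L), x⁆ - χ z • x ∈ A := by
  let N : LieSubmodule K L B := LieSubmodule.comap (LieSubmodule.incl B) A
  obtain ⟨b, hbB, hbA⟩ := SetLike.not_le_iff_exists.1 hBA
  have hmk : ∀ x : B, LieSubmodule.Quotient.mk (N := N) x = 0 ↔ (x : L) ∈ A := fun x => by
    rw [LieSubmodule.Quotient.mk_eq_zero']; rfl
  have : Nontrivial (B ⧸ N) := ⟨⟨LieSubmodule.Quotient.mk ⟨b, hbB⟩, 0, fun h =>
    hbA ((hmk _).1 h)⟩⟩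
  obtain ⟨χ, hχ⟩ := LieModule.exists_nontrivial_weightSpace_of_isSolvable K I (B ⧸ N)
  let W : LieSubmodule K L (B ⧸ N) := LieModule.weightSpaceOfIsLieTower K (B ⧸ N) (χ : I → K)
  have hW : ∀ v, v ∈ W ↔ ∀ z : I, ⁅(z : L), v⁆ = χ z • v := fun v =>
    LieModule.mem_weightSpace (χ : I → K) v
  let P : LieIdeal K L := (LieSubmodule.comap (LieSubmodule.Quotient.mk' N) W).map (LieSubmodule.incl B)
  have hP : ∀ x, x ∈ P ↔ ∃ h : x ∈ B, LieSubmodule.Quotient.mk (N := N) ⟨x, h⟩ ∈ W := by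
    intro x
    simp only [P, LieSubmodule.mem_map, LieSubmodule.mem_comap]
    constructor
    · rintro ⟨y, hy, rfl⟩
      exact ⟨y.2, hy⟩
    · rintro ⟨h, hx⟩
      exact ⟨⟨x, h⟩, hx, rfl⟩
  refine ⟨χ, P, fun x hx => ((hP x).1 hx).1, fun hPA => ?_, fun z x hx => ?_⟩
  · obtain ⟨v, hv⟩ := exists_ne (0 : LieModule.weightSpace (B ⧸ N) (χ : I → K))
    obtain ⟨y, hy⟩ := LieSubmodule.Quotient.surjective_mk' N (v : B ⧸ N)
    refine hv (Subtype.ext ?_)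
    rw [← hy]
    refine (hmk y).2 (hPA ((hP _).2 ⟨y.2, ?_⟩))
    have := v.2
    rw [← hy] at this
    exact this
  · obtain ⟨h, hx⟩ := (hP x).1 hx
    have h1 := (hW _).1 hx z
    have h2 := hmk (⁅(z : L), (⟨x, h⟩ : B)⁆ - χ z • (⟨x, h⟩ : B))
    refine h2.1 ?_
    rw [← sub_eq_zero] at h1
    exact h1

variable (hred : ∀ I : LieIdeal K L, IsLieAbelian I → I ≤ LieAlgebra.center K L)

omit [IsAlgClosed K] [CharZero K] [FiniteDimensional K L] in
lemma isLieAbelian_of_lie_eq_zero {I : LieIdeal K L} (h : ∀ x ∈ I, ∀ y ∈ I, ⁅x, y⁆ = 0) :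
    IsLieAbelian I :=
  ⟨fun x y => Subtype.ext (h x x.2 y y.2)⟩

omit [IsAlgClosed K] [CharZero K] [FiniteDimensional K L] in
lemma mem_center_iff {x : L} : x ∈ LieAlgebra.center K L ↔ ∀ y : L, ⁅y, x⁆ = 0 := by
  rw [LieModule.mem_maxTrivSubmodule]

include hred

lemma derived_le_center_aux (I : LieIdeal K L) [LieAlgebra.IsSolvable I]
    (h : ⁅⁅I, I⁆, ⁅I, I⁆⁆ ≤ LieAlgebra.center K L) : ⁅I, I⁆ ≤ LieAlgebra.center K L := by
  by_contra hJ
  obtain ⟨χ, P, hPJ, hPZ, hχ⟩ := exists_ideal_weight I _ _ hJ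
  have hPI : P ≤ I := hPJ.trans (LieSubmodule.lie_le_right _ _)
  by_cases h0 : χ = 0
  · refine hPZ (hred P (isLieAbelian_of_lie_eq_zero fun x hx y hy => ?_))
    have hz : ∀ z ∈ I, ∀ x ∈ P, ⁅z, x⁆ ∈ LieAlgebra.center K L := fun z hz x hx => by
      simpa [h0] using hχ ⟨z, hz⟩ x hx
    have hJP : ∀ u ∈ ⁅I, I⁆, ⁅u, y⁆ = 0 := by
      intro u hu
      rw [← LieSubmodule.mem_toSubmodule, LieSubmodule.lieIdeal_oper_eq_linear_span'] at hu
      induction hu using Submodule.span_induction with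
      | mem u hu =>
        obtain ⟨a, ha, b, hb, rfl⟩ := hu
        rw [lie_lie, mem_center_iff.1 (hz b hb y hy), mem_center_iff.1 (hz a ha y hy), sub_zero]
      | zero => simp
      | add a b _ _ ha hb => rw [add_lie, ha, hb, add_zero]
      | smul c a _ ha => rw [smul_lie, ha, smul_zero]
    exact hJP x (hPJ hx)
  · refine hPZ (hred P (isLieAbelian_of_lie_eq_zero fun x hx y hy => ?_))
    obtain ⟨z, hz⟩ : ∃ z, χ z ≠ 0 := by
      by_contra! hh; exact h0 (LinearMap.ext hh)
    have hxy : ⁅x, y⁆ ∈ LieAlgebra.center K L :=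
      h (LieSubmodule.lie_mem_lie (hPJ hx) (hPJ hy))
    have h1 : ⁅⁅(z : L), x⁆, y⁆ = χ z • ⁅x, y⁆ := by
      have := mem_center_iff.1 (hχ z x hx) y
      rw [lie_sub, sub_eq_zero, lie_smul] at this
      rw [← lie_skew, this, ← lie_skew y x, smul_neg, neg_neg]
      
    have h2 : ⁅x, ⁅(z : L), y⁆⁆ = χ z • ⁅x, y⁆ := by
      have := mem_center_iff.1 (hχ z y hy) x
      rwa [lie_sub, sub_eq_zero, lie_smul] at this
    have h3 := leibniz_lie (z : L) x y
    rw [mem_center_iff.1 hxy, h1, h2, ← two_smul K, smul_smul] at h3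
    exact (smul_eq_zero.1 h3.symm).resolve_left (mul_ne_zero two_ne_zero hz)

/-- The radical is two-step nilpotent modulo the center. -/
lemma radical_lie_le_center :
    ⁅LieAlgebra.radical K L, LieAlgebra.radical K L⁆ ≤ LieAlgebra.center K L := by
  set R := LieAlgebra.radical K L
  have hsol : ∃ k, LieAlgebra.derivedSeriesOfIdeal K L k R ≤ LieAlgebra.center K L := by
    obtain ⟨k, hk⟩ := (LieAlgebra.isSolvable_iff K R).1 inferInstance
    exact ⟨k, by
      rw [LieIdeal.derivedSeries_eq_bot_iff] at hk
      rw [hk]; exact bot_le⟩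
  classical
  have hk := Nat.find_spec hsol
  have hmin := fun m => Nat.find_min (m := m) hsol
  set k := Nat.find hsol
  match hk' : k with
  | 0 => 
    exact (LieSubmodule.lie_le_right _ _).trans hk
  | 1 => exact hk
  | k + 2 =>
    exfalso
    refine hmin (k + 1) (by omega) ?_
    rw [LieAlgebra.derivedSeriesOfIdeal_succ]
    have : LieAlgebra.IsSolvable (LieAlgebra.derivedSeriesOfIdeal K L k R) := by
      rw [LieAlgebra.LieIdeal.solvable_iff_le_radical]
      exact LieAlgebra.derivedSeriesOfIdeal_le_self R k
    exact derived_le_center_aux hred _ (by simpa only [LieAlgebra.derivedSeriesOfIdeal_succ] using hk)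

end SolvableIdeals

end

section

section Principal

variable {K A : Type*} [Field K] [CharZero K] [LieRing A] [LieAlgebra K A] [FiniteDimensional K A]
  [LieAlgebra.IsKilling K A] (C : LieSubalgebra K A) [C.IsCartanSubalgebra]
  [LieModule.IsTriangularizable K C A]

open LieAlgebra IsKilling in
/-- The principal `sl₂` of a semisimple Lie algebra: all roots take nonzero even values on it. -/
lemma exists_principal :
    ∃ (h : C) (e f : A), ⁅e, f⁆ = (h : A) ∧ ⁅(h : A), e⁆ = (2 : K) • e ∧
      ⁅(h : A), f⁆ = -(2 : K) • f ∧
      ∀ χ : LieModule.Weight K C A, ∃ z : ℤ, χ h = 2 * z ∧ (z = 0 → χ.IsZero) := by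
  classical
  obtain ⟨b⟩ := RootPairing.nonempty_base (rootSystem C)
  let bw := b.toWeightBasis
  let bc := b.toCoweightBasis
  obtain ⟨h, hh⟩ : ∃ h : C, ∀ i ∈ b.support, (rootSystem C).root i h = 2 := by
    obtain ⟨h, hh⟩ := (Module.evalEquiv K C).surjective
      (bw.constr K (fun _ => (2 : K)) : Module.Dual K (Module.Dual K C))
    refine ⟨h, fun i hi => ?_⟩
    have h1 := bw.constr_basis K (fun _ => (2 : K)) ⟨i, hi⟩
    rw [← hh] at h1
    simpa [bw] using h1
  have hnz : ∀ i : C.root, (i : LieModule.Weight K C A).IsNonZero := fun i =>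
    LieSubalgebra.isNonZero_coe_root i
  choose h' e f ht he hf using fun i : C.root => exists_isSl2Triple_of_weight_isNonZero (hnz i)
  have hc : ∀ i, h' i = coroot (i : LieModule.Weight K C A) := fun i =>
    (ht i).h_eq_coroot (hnz i) (he i) (hf i)
  let c : b.support → K := fun i => bc.repr h i
  have hsum : ∑ i : b.support, c i • h' i = (h : A) := by
    have h1 := bc.sum_repr h
    rw [← h1]
    simp only [AddSubmonoidClass.coe_finsetSum, SetLike.val_smul]
    refine Finset.sum_congr rfl fun i _ => ?_
    rw [hc]
    simp [bc, c]
  have hef : ∀ i j : b.support, i ≠ j → ⁅e i, f j⁆ = 0 := by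
    intro i j hij
    have h1 := LieAlgebra.lie_mem_genWeightSpace_of_mem_genWeightSpace (he i) (hf j)
    by_contra h0
    have hne : LieAlgebra.rootSpace C
        ((i.1 : LieModule.Weight K C A) + -(j.1 : LieModule.Weight K C A) : C → K) ≠ ⊥ := by
      intro hbot
      have h2 : ⁅e i, f j⁆ ∈ (⊥ : LieSubmodule K C A) := hbot ▸ h1
      exact h0 (by simpa using h2)
    let w : LieModule.Weight K C A := ⟨_, hne⟩
    by_cases hw : w.IsZero
    · have h2 : (rootSystem C).root i = (rootSystem C).root j := by
        ext x
        have := congrFun hw x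
        change (i.1 : LieModule.Weight K C A) x + -(j.1 : LieModule.Weight K C A) x = 0 at this
        simp only [rootSystem_root_apply, LieModule.Weight.toLinear_apply]
        linear_combination this
      exact hij (Subtype.ext ((rootSystem C).root.injective h2))
    · refine b.sub_notMem_range_root i.2 j.2 ⟨⟨w, by simpa using hw⟩, ?_⟩
      ext x
      simp [w, rootSystem_root_apply, LieModule.Weight.toLinear_apply, sub_eq_add_neg]
  refine ⟨h, ∑ i : b.support, c i • e i, ∑ i : b.support, f i, ?_, ?_, ?_, ?_⟩
  · rw [← hsum, sum_lie]
    refine Finset.sum_congr rfl fun i _ => ?_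
    rw [smul_lie, lie_sum, Finset.sum_eq_single i (fun j _ hj => hef i j hj.symm)
      (by simp), (ht i).lie_e_f]
  · rw [lie_sum, Finset.smul_sum]
    refine Finset.sum_congr rfl fun i _ => ?_
    have := lie_eq_smul_of_mem_rootSpace (he i) h
    have h2 := hh i i.2
    simp only [rootSystem_root_apply, LieModule.Weight.toLinear_apply] at h2
    rw [h2] at this
    rw [lie_smul, smul_comm, ← this]; rfl
  · rw [lie_sum, Finset.smul_sum]
    refine Finset.sum_congr rfl fun i _ => ?_
    have := lie_eq_smul_of_mem_rootSpace (hf i) h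
    have h2 := hh i i.2
    simp only [rootSystem_root_apply, LieModule.Weight.toLinear_apply] at h2
    rw [Pi.neg_apply, h2] at this
    exact this
  · intro χ
    by_cases hχ : χ.IsZero
    · refine ⟨0, ?_, fun _ => hχ⟩
      have : χ h = 0 := congrFun hχ h
      simp [this]
    · let i : C.root := ⟨χ, by simpa using hχ⟩
      refine ⟨b.height i, ?_, fun h0 => absurd h0 (b.height_ne_zero i)⟩
      obtain ⟨p, hp⟩ := b.exists_root_eq_sum_int i
      have h1 : (rootSystem C).root i = ∑ j ∈ b.support, p j • (rootSystem C).root j := hp.2.2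
      rw [b.height_eq_sum h1]
      have h3 := congrArg (fun φ : Module.Dual K C => φ h) h1
      simp only [LinearMap.coe_sum, Finset.sum_apply, LinearMap.smul_apply] at h3
      have h4 : (rootSystem C).root i h = χ h := rfl
      rw [← h4, h3]
      push_cast
      rw [Finset.mul_sum]
      refine Finset.sum_congr rfl fun j hj => ?_
      rw [hh j hj, zsmul_eq_mul, mul_comm]

end Principal

section Words

variable {K L V : Type*} [Field K] [LieRing L] [LieAlgebra K L] [AddCommGroup V] [Module K V]
  [LieRingModule L V] [LieModule K L V]

/-- If `L = N + B` and `B` preserves the line through `v`, then any subspace containing `v` and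
stable under `N` contains the `L`-submodule generated by `v`. -/
lemma lieSpan_le_of_stable (N B : Submodule K L) (hNB : N ⊔ B = ⊤) (v : V)
    (hB : ∀ b ∈ B, ∃ c : K, ⁅b, v⁆ = c • v) (P : Submodule K V) (hv : v ∈ P)
    (hN : ∀ x ∈ N, ∀ m ∈ P, ⁅x, m⁆ ∈ P) :
    (LieSubmodule.lieSpan K L {v}).toSubmodule ≤ P := by
  let W : ℕ → Submodule K V := fun n => Nat.rec (Submodule.span K {v})
    (fun _ X => X ⊔ Submodule.span K {y | ∃ x ∈ N, ∃ m ∈ X, ⁅x, m⁆ = y}) n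
  have hW1 : ∀ n, W (n + 1) = W n ⊔ Submodule.span K {y | ∃ x ∈ N, ∃ m ∈ W n, ⁅x, m⁆ = y} :=
    fun n => rfl
  have hWm : ∀ n, W n ≤ W (n + 1) := fun n => le_sup_left
  have hWN : ∀ n, ∀ x ∈ N, ∀ m ∈ W n, ⁅x, m⁆ ∈ W (n + 1) := fun n x hx m hm =>
    (le_sup_right : _ ≤ W (n + 1)) (Submodule.subset_span ⟨x, hx, m, hm, rfl⟩)
  have hWP : ∀ n, W n ≤ P := by
    intro n
    induction n with
    | zero => exact (Submodule.span_singleton_le_iff_mem _ _).2 hv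
    | succ n ih =>
      rw [hW1]
      refine sup_le ih (Submodule.span_le.2 ?_)
      rintro _ ⟨x, hx, m, hm, rfl⟩
      exact hN x hx m (ih hm)
  have hWB : ∀ n, ∀ b ∈ B, ∀ m ∈ W n, ⁅b, m⁆ ∈ W n := by
    intro n
    induction n with
    | zero =>
      intro b hb m hm
      obtain ⟨a, rfl⟩ := Submodule.mem_span_singleton.1 hm
      obtain ⟨c, hc⟩ := hB b hb
      rw [lie_smul, hc]
      exact Submodule.smul_mem _ _ (Submodule.smul_mem _ _ (Submodule.mem_span_singleton_self v))
    | succ n ih =>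
      intro b hb m hm
      have key : ∀ m ∈ {y | ∃ x ∈ N, ∃ m ∈ W n, ⁅x, m⁆ = y}, ⁅b, m⁆ ∈ W (n + 1) := by
        rintro _ ⟨x, hx, m, hm, rfl⟩
        rw [leibniz_lie]
        refine Submodule.add_mem _ ?_ (hWN n x hx _ (ih b hb m hm))
        have : ⁅b, x⁆ ∈ N ⊔ B := hNB ▸ Submodule.mem_top
        obtain ⟨y, hy, c, hc, h⟩ := Submodule.mem_sup.1 this
        rw [← h, add_lie]
        exact Submodule.add_mem _ (hWN n y hy m hm) (hWm n (ih c hc m hm))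
      have hle : W (n + 1) ≤ (W (n + 1)).comap (LieModule.toEnd K L V b) := by
        conv_lhs => rw [hW1]
        exact sup_le (fun m hm => hWm n (ih b hb m hm)) (Submodule.span_le.2 key)
      exact hle hm
  let U : LieSubmodule K L V :=
    { (⨆ n, W n) with
      lie_mem := by
        intro x m hm
        change ⁅x, m⁆ ∈ ⨆ n, W n
        obtain ⟨n, hn⟩ := (Submodule.mem_iSup_of_directed W
          (monotone_nat_of_le_succ hWm).directed_le).1 hm
        have : x ∈ N ⊔ B := hNB ▸ Submodule.mem_top
        obtain ⟨y, hy, c, hc, rfl⟩ := Submodule.mem_sup.1 this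
        rw [add_lie]
        refine Submodule.mem_iSup_of_mem (n + 1) ?_
        exact Submodule.add_mem _ (hWN n y hy m hn) (hWm n (hWB n c hc m hn)) }
  have hvU : v ∈ U := Submodule.mem_iSup_of_mem (p := W) 0 (Submodule.mem_span_singleton_self v)
  have h1 : LieSubmodule.lieSpan K L {v} ≤ U := LieSubmodule.lieSpan_le.2 (by simpa using hvU)
  exact le_trans h1 (iSup_le hWP)

end Words

section Nilp

variable {K V : Type*} [Field K] [CharZero K] [AddCommGroup V] [Module K V]
  [FiniteDimensional K V]

/-- An eigenvector of `ad H` with nonzero eigenvalue is nilpotent. -/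
lemma exists_pow_eq_zero {E H : Module.End K V} {c : K} (hc : c ≠ 0)
    (h : ∀ v, H (E v) = E (H v) + c • E v) : ∃ N : ℕ, E ^ N = 0 := by
  by_contra! hE
  have hpow : ∀ n : ℕ, H * E ^ n - E ^ n * H = ((n : K) * c) • E ^ n := by
    intro n
    induction n with
    | zero => simp
    | succ n ih =>
      have h1 : H * E = E * H + c • E := LinearMap.ext h
      have : H * E ^ (n + 1) - E ^ (n + 1) * H
          = (H * E ^ n - E ^ n * H) * E + E ^ n * (H * E - E * H) := by
        rw [pow_succ]; noncomm_ring
      rw [this, ih, h1, add_sub_cancel_left, mul_smul_comm, smul_mul_assoc, ← pow_succ]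
      push_cast; module
  let D : Module.End K (Module.End K V) := LinearMap.mulLeft K H - LinearMap.mulRight K H
  have hev : ∀ n : ℕ, Module.End.HasEigenvalue D ((n : K) * c) := fun n =>
    Module.End.hasEigenvalue_of_hasEigenvector (x := E ^ n)
      ⟨Module.End.mem_eigenspace_iff.2 (by simpa [D] using hpow n), hE n⟩
  have hfin := Module.End.finite_hasEigenvalue D
  refine Set.infinite_of_injective_forall_mem (f := fun n : ℕ => (n : K) * c) (fun a b hab => ?_)
    hev hfin
  exact Nat.cast_injective (mul_right_cancel₀ hc hab)

end Nilp

end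

section

section Families

variable {K M N ι : Type*} [Field K] [AddCommGroup M] [Module K M] [AddCommGroup N] [Module K N]

/-- A linear map compatible with two gradings has a graded range. -/
lemma mem_map_of_iSup_eq_top (f : M →ₗ[K] N) (P : ι → Submodule K M) (Q : ι → Submodule K N)
    (hP : ⨆ i, P i = ⊤) (hQ : iSupIndep Q) (h : ∀ i, (P i).map f ≤ Q i) {i : ι} {x : M}
    (hx : f x ∈ Q i) : f x ∈ (P i).map f := by
  classical
  have hx' : x ∈ ⨆ i, P i := hP ▸ Submodule.mem_top
  rw [iSup_split_single P i] at hx'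
  obtain ⟨y, hy, z, hz, rfl⟩ := Submodule.mem_sup.1 hx'
  have h1 : f z ∈ ⨆ j, ⨆ _ : j ≠ i, Q j := by
    have : (⨆ j, ⨆ _ : j ≠ i, P j).map f ≤ ⨆ j, ⨆ _ : j ≠ i, Q j := by
      simp only [Submodule.map_iSup]
      exact iSup₂_mono fun j _ => h j
    exact this (Submodule.mem_map_of_mem hz)
  have h2 : f z ∈ Q i := by
    have h3 := h i (Submodule.mem_map_of_mem hy)
    rw [map_add] at hx
    simpa using Submodule.sub_mem _ hx h3
  have h3 : f z = 0 := Submodule.disjoint_def.1 (hQ i) _ h2 h1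
  exact ⟨y, hy, by rw [map_add, h3, add_zero]⟩

end Families

section Levi

open LieAlgebra

variable {K L : Type*} [Field K] [IsAlgClosed K] [CharZero K] [LieRing L] [LieAlgebra K L]
  [FiniteDimensional K L]

lemma hasTrivialRadical_quotient : HasTrivialRadical K (L ⧸ radical K L) := by
  refine hasTrivialRadical_of_no_solvable_ideals fun I hI => ?_
  obtain ⟨k, hk⟩ := (isSolvable_iff K I).1 hI
  rw [LieIdeal.derivedSeries_eq_bot_iff] at hk
  let p : L →ₗ⁅K⁆ L ⧸ radical K L :=
    { (LieSubmodule.Quotient.mk' (radical K L) : L →ₗ[K] L ⧸ radical K L) with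
      map_lie' := fun {_ _} => rfl }
  let J : LieIdeal K L := I.comap p
  have hD : ∀ n, ∀ x ∈ derivedSeriesOfIdeal K L n J, p x ∈ derivedSeriesOfIdeal K _ n I := by
    intro n
    induction n with
    | zero => exact fun x hx => hx
    | succ n ih =>
      intro x hx
      rw [derivedSeriesOfIdeal_succ] at hx ⊢
      rw [← LieSubmodule.mem_toSubmodule, LieSubmodule.lieIdeal_oper_eq_linear_span'] at hx
      induction hx using Submodule.span_induction with
      | mem u hu =>
        obtain ⟨a, ha, b, hb, rfl⟩ := hu
        rw [LieHom.map_lie]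
        exact LieSubmodule.lie_mem_lie (ih a ha) (ih b hb)
      | zero => simp
      | add a b _ _ ha hb => rw [map_add]; exact add_mem ha hb
      | smul c a _ ha => rw [map_smul]; exact SMulMemClass.smul_mem c ha
  have h1 : derivedSeriesOfIdeal K L k J ≤ radical K L := by
    intro x hx
    have := hD k x hx
    rw [hk] at this
    exact LieSubmodule.Quotient.mk_eq_zero'.1 ((LieSubmodule.mem_bot _).1 this)
  have h2 : IsSolvable J := by
    obtain ⟨m, hm⟩ := (isSolvable_iff K (radical K L)).1 inferInstance
    rw [LieIdeal.derivedSeries_eq_bot_iff] at hm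
    refine (isSolvable_iff K J).2 ⟨m + k, ?_⟩
    rw [LieIdeal.derivedSeries_eq_bot_iff, derivedSeriesOfIdeal_add]
    exact le_bot_iff.1 ((derivedSeriesOfIdeal_mono h1 m).trans hm.le)
  rw [LieIdeal.solvable_iff_le_radical] at h2
  rw [eq_bot_iff]
  intro y hy
  obtain ⟨x, rfl⟩ := LieSubmodule.Quotient.surjective_mk' (radical K L) y
  have : x ∈ J := hy
  simpa using h2 this

/-- the quotient by the radical, as a homomorphism. -/
def toLevi : L →ₗ⁅K⁆ L ⧸ radical K L :=
  { (LieSubmodule.Quotient.mk' (radical K L) : L →ₗ[K] L ⧸ radical K L) with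
    map_lie' := fun {_ _} => rfl }

lemma toLevi_eq_zero {x : L} : toLevi (K := K) x = 0 ↔ x ∈ radical K L :=
  LieSubmodule.Quotient.mk_eq_zero'

lemma toLevi_surjective : Function.Surjective (toLevi : L →ₗ⁅K⁆ L ⧸ radical K L) :=
  LieSubmodule.Quotient.surjective_mk' (radical K L)

lemma lie_toLevi (x y : L) : ⁅x, toLevi (K := K) y⁆ = ⁅toLevi (K := K) x, toLevi y⁆ := rfl

instance : IsKilling K (L ⧸ radical K L) := by
  have := hasTrivialRadical_quotient (K := K) (L := L)
  exact HasTrivialRadical.instIsKilling _ _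

variable (H : LieSubalgebra K L)

lemma isNilpotent_map_toLevi [LieRing.IsNilpotent H] :
    LieRing.IsNilpotent (H.map (toLevi (K := K))) := by
  let f : H →ₗ⁅K⁆ H.map (toLevi (K := K)) :=
    { toFun := fun x => ⟨toLevi (x : L), ⟨x, x.2, rfl⟩⟩
      map_add' := fun x y => Subtype.ext (map_add _ _ _)
      map_smul' := fun x y => Subtype.ext (map_smul _ _ _)
      map_lie' := fun {x y} => Subtype.ext (LieHom.map_lie _ _ _) }
  refine Function.Surjective.lieAlgebra_isNilpotent (f := f) ?_
  rintro ⟨_, x, hx, rfl⟩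
  exact ⟨⟨x, hx⟩, rfl⟩

lemma toEnd_pow_toLevi (H : LieSubalgebra K L) [LieRing.IsNilpotent H] (y : H) (c : K) (k : ℕ)
    (x : L) :
    ((LieModule.toEnd K H (L ⧸ radical K L) y - c • 1) ^ k) (toLevi x)
      = toLevi (((LieModule.toEnd K H L y - c • 1) ^ k) x) := by
  induction k generalizing x with
  | zero => rfl
  | succ k ih =>
    rw [pow_succ, pow_succ, Module.End.mul_apply, Module.End.mul_apply, ← ih]
    congr 1

lemma toLevi_mem_genWeightSpace (H : LieSubalgebra K L) [LieRing.IsNilpotent H] {χ : H → K}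
    {x : L} (hx : x ∈ rootSpace H χ) :
    toLevi x ∈ LieModule.genWeightSpace (L ⧸ radical K L) χ := by
  rw [LieModule.mem_genWeightSpace] at hx ⊢
  intro y
  obtain ⟨k, hk⟩ := hx y
  exact ⟨k, by rw [toEnd_pow_toLevi, hk, map_zero]⟩

lemma exists_of_toLevi_mem (H : LieSubalgebra K L) [LieRing.IsNilpotent H] {χ : H → K}
    {x : L} (hx : toLevi x ∈ LieModule.genWeightSpace (L ⧸ radical K L) χ) :
    ∃ y ∈ rootSpace H χ, toLevi (K := K) y = toLevi x :=
  mem_map_of_iSup_eq_top (toLevi : L →ₗ⁅K⁆ L ⧸ radical K L).toLinearMap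
    (fun χ : H → K => (rootSpace H χ).toSubmodule)
    (fun χ : H → K => (LieModule.genWeightSpace (L ⧸ radical K L) χ).toSubmodule)
    (by
      have h1 := LieModule.iSup_genWeightSpace_eq_top K H L
      rw [← LieSubmodule.toSubmodule_inj] at h1
      simpa using h1)
    (by
      have := LieModule.iSupIndep_genWeightSpace K H (L ⧸ radical K L)
      rwa [← LieSubmodule.iSupIndep_toSubmodule] at this)
    (by
      rintro χ _ ⟨x, hx, rfl⟩
      exact toLevi_mem_genWeightSpace H hx) hx

instance isCartan_map_toLevi [H.IsCartanSubalgebra] :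
    (H.map (toLevi (K := K))).IsCartanSubalgebra := by
  have := isNilpotent_map_toLevi H
  refine is_cartan_of_zeroRootSubalgebra_eq K _ _ (le_antisymm ?_ (le_zeroRootSubalgebra K _ _))
  intro a ha
  obtain ⟨x, rfl⟩ := toLevi_surjective a
  rw [mem_zeroRootSubalgebra] at ha
  obtain ⟨y, hy, hxy⟩ := exists_of_toLevi_mem H (χ := 0) (x := x) (by
    rw [LieModule.mem_genWeightSpace]
    intro y
    obtain ⟨k, hk⟩ := ha ⟨toLevi y, y, y.2, rfl⟩
    refine ⟨k, ?_⟩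
    rw [Pi.zero_apply, zero_smul, sub_zero]
    exact hk)
  rw [rootSpace_zero_eq] at hy
  exact ⟨y, hy, hxy⟩

variable {V : Type*} [AddCommGroup V] [Module K V] [LieRingModule L V] [LieModule K L V]
  [FiniteDimensional K V] [H.IsCartanSubalgebra]

/-- Elements with the same image in the Levi quotient act in the same way. -/
lemma lie_eq_of_toLevi_eq (hV : ∀ x ∈ radical K L, ∀ v : V, ⁅x, v⁆ = 0) {x y : L}
    (h : toLevi (K := K) x = toLevi y) (v : V) : ⁅x, v⁆ = ⁅y, v⁆ := by
  rw [← sub_eq_zero, ← sub_lie]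
  exact hV _ (toLevi_eq_zero.1 (by rw [map_sub, h, sub_self])) v

lemma sl2Ops_of_toLevi (hV : ∀ x ∈ radical K L, ∀ v : V, ⁅x, v⁆ = 0) {e f t : L}
    (h1 : ⁅toLevi (K := K) e, toLevi f⁆ = toLevi (K := K) t)
    (h2 : ⁅toLevi (K := K) t, toLevi e⁆ = (2 : K) • toLevi (K := K) e)
    (h3 : ⁅toLevi (K := K) t, toLevi f⁆ = -(2 : K) • toLevi (K := K) f) :
    Sl2Ops (LieModule.toEnd K L V e) (LieModule.toEnd K L V f) (LieModule.toEnd K L V t) where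
  ef v := by
    have := lie_eq_of_toLevi_eq hV (x := ⁅e, f⁆) (y := t) (by rw [LieHom.map_lie, h1]) v
    simp only [LieModule.toEnd_apply_apply, ← this, lie_lie]; abel
  he v := by
    have := lie_eq_of_toLevi_eq hV (x := ⁅t, e⁆) (y := (2 : K) • e)
      (by rw [LieHom.map_lie, h2, map_smul]) v
    rw [smul_lie, lie_lie] at this
    simp only [LieModule.toEnd_apply_apply, ← this]; abel
  hf v := by
    have := lie_eq_of_toLevi_eq hV (x := ⁅t, f⁆) (y := -(2 : K) • f)
      (by rw [LieHom.map_lie, h3, map_smul]) v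
    rw [smul_lie, lie_lie, neg_smul] at this
    simp only [LieModule.toEnd_apply_apply, sub_eq_add_neg, ← this]; abel

/-- On a module killed by the radical, a Cartan subalgebra acts by honest scalars on its generalized
weight spaces. -/
lemma lie_eq_smul_of_mem_genWeightSpace (hV : ∀ x ∈ radical K L, ∀ v : V, ⁅x, v⁆ = 0)
    (χ : H → K) {v : V} (hv : v ∈ LieModule.genWeightSpace V χ) (x : H) :
    ⁅(x : L), v⁆ = χ x • v := by
  set C := H.map (toLevi (K := K)) with hC
  let S : Submodule K H :=
    { carrier := {x | ∃ c : K, ∀ v ∈ LieModule.genWeightSpace V χ, ⁅(x : L), v⁆ = c • v}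
      add_mem' := by
        rintro a b ⟨c, hc⟩ ⟨d, hd⟩
        exact ⟨c + d, fun v hv => by
          rw [AddMemClass.coe_add, add_lie, hc v hv, hd v hv, add_smul]⟩
      zero_mem' := ⟨0, fun v _ => by simp⟩
      smul_mem' := by
        rintro a b ⟨c, hc⟩
        exact ⟨a * c, fun v hv => by
          rw [SetLike.val_smul, smul_lie, hc v hv, mul_smul]⟩ }
  have hS : ∀ x : H, x ∈ S := by
    have hcor : ∀ c : C, ∃ y ∈ S, toLevi (K := K) (y : L) = c := by
      intro c
      have hc : c ∈ Submodule.span K (Set.range (IsKilling.rootSystem C).coroot) := by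
        rw [RootPairing.IsRootSystem.span_coroot_eq_top (P := IsKilling.rootSystem C)]; trivial
      induction hc using Submodule.span_induction with
      | mem c hc =>
        obtain ⟨α, rfl⟩ := hc
        rw [IsKilling.rootSystem_coroot_apply]
        have hnz := LieSubalgebra.isNonZero_coe_root α
        obtain ⟨h', e, f, ht, he, hf⟩ := IsKilling.exists_isSl2Triple_of_weight_isNonZero hnz
        have hh := ht.h_eq_coroot hnz he hf
        obtain ⟨e, rfl⟩ := toLevi_surjective e
        obtain ⟨f, rfl⟩ := toLevi_surjective f
        obtain ⟨y, hy, hyc⟩ := (IsKilling.coroot (α : LieModule.Weight K C _)).2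
        refine ⟨⟨y, hy⟩, ⟨χ ⟨y, hy⟩, ?_⟩, hyc⟩
        have hy' : toLevi (K := K) y = h' := by rw [hh]; exact hyc
        rw [← hy'] at ht
        have ops := sl2Ops_of_toLevi hV ht.lie_e_f
          (by rw [ht.lie_h_e_nsmul]; module) (by rw [ht.lie_h_f_nsmul]; module)
        obtain ⟨N, hN⟩ := exists_pow_eq_zero (c := (2 : K)) two_ne_zero ops.he
        obtain ⟨N', hN'⟩ := exists_pow_eq_zero (c := -(2 : K)) (neg_ne_zero.2 two_ne_zero)
          (fun v => by rw [ops.hf, sub_eq_add_neg, neg_smul])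
        have hE : LieModule.toEnd K L V e ^ (N + N') = 0 := by rw [pow_add, hN, zero_mul]
        have hF : LieModule.toEnd K L V f ^ (N + N') = 0 := by rw [pow_add, hN', mul_zero]
        intro v hv
        rw [LieModule.mem_genWeightSpace] at hv
        obtain ⟨k, hk⟩ := hv ⟨y, hy⟩
        set D : Module.End K V := LieModule.toEnd K H V ⟨y, hy⟩ - χ ⟨y, hy⟩ • 1 with hD
        have hD' : ∀ v, D v = ⁅y, v⁆ - χ ⟨y, hy⟩ • v := fun v => rfl
        have h2 : ∀ v, D (D v) = 0 → D v = 0 := by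
          intro v hv
          refine ops.semisimple hE hF (κ := χ ⟨y, hy⟩) (y := v) ?_ ?_
          · rw [hD']; simp
          · rw [hD', sub_eq_zero] at hv; exact hv
        have h3 : ∀ k, ∀ v, (D ^ k) v = 0 → D v = 0 := by
          intro k
          induction k with
          | zero => intro v hv; rw [pow_zero, Module.End.one_apply] at hv; rw [hv, map_zero]
          | succ k ih =>
            intro v hv
            rw [pow_succ, Module.End.mul_apply] at hv
            exact h2 v (ih _ hv)
        exact sub_eq_zero.1 (h3 k v hk)
      | zero => exact ⟨0, S.zero_mem, by simp⟩
      | add a b _ _ ha hb =>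
        obtain ⟨y, hy, h1⟩ := ha
        obtain ⟨z, hz, h2⟩ := hb
        exact ⟨y + z, S.add_mem hy hz, by simp [h1, h2]⟩
      | smul c a _ ha =>
        obtain ⟨y, hy, h1⟩ := ha
        exact ⟨c • y, S.smul_mem c hy, by simp [h1]⟩
    intro x
    obtain ⟨y, ⟨c, hc⟩, hy⟩ := hcor ⟨toLevi x, x, x.2, rfl⟩
    exact ⟨c, fun v hv => by rw [← hc v hv]; exact lie_eq_of_toLevi_eq hV hy.symm v⟩
  obtain ⟨c, hc⟩ := hS x
  by_cases h0 : v = 0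
  · simp [h0]
  obtain ⟨k, hk⟩ := (LieModule.mem_genWeightSpace V χ v).1 hv x
  have h2 : ∀ n, ((LieModule.toEnd K H V x - χ x • 1) ^ n) v = (c - χ x) ^ n • v := by
    intro n
    induction n with
    | zero => simp
    | succ n ih =>
      rw [pow_succ', Module.End.mul_apply, ih, map_smul, pow_succ, mul_smul]
      congr 1
      simp only [LinearMap.sub_apply, LieModule.toEnd_apply_apply, LinearMap.smul_apply,
        Module.End.one_apply, LieSubalgebra.coe_bracket_of_module, hc v hv, sub_smul]
  rw [h2, smul_eq_zero] at hk
  rw [hc v hv, sub_eq_zero.1 (eq_zero_of_pow_eq_zero (hk.resolve_right h0))]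

end Levi

end

section

section Symplectic

open LieAlgebra

variable {K L : Type*} [Field K] [IsAlgClosed K] [CharZero K] [LieRing L] [LieAlgebra K L]
  [FiniteDimensional K L] (H : LieSubalgebra K L) [H.IsCartanSubalgebra]
variable {V : Type*} [AddCommGroup V] [Module K V] [LieRingModule L V] [LieModule K L V]
  [FiniteDimensional K V]

lemma radical_lie_quotient {x : L} (hx : x ∈ radical K L) (v : L ⧸ radical K L) : ⁅x, v⁆ = 0 := by
  obtain ⟨y, rfl⟩ := toLevi_surjective v
  rw [lie_toLevi, toLevi_eq_zero.2 hx, zero_lie]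

lemma lie_toLevi_eq_smul {χ : H → K} {x : L} (hx : x ∈ rootSpace H χ) (y : H) :
    ⁅toLevi (K := K) (y : L), toLevi x⁆ = χ y • toLevi (K := K) x :=
  lie_eq_smul_of_mem_genWeightSpace H (fun _ hx v => radical_lie_quotient hx v) χ
    (toLevi_mem_genWeightSpace H hx) y

/-- The principal `sl₂` of the Levi quotient, lifted. -/
lemma exists_principal_lift : ∃ (t : H) (e f : L),
    ⁅toLevi (K := K) e, toLevi f⁆ = toLevi (K := K) (t : L) ∧
    ⁅toLevi (K := K) (t : L), toLevi e⁆ = (2 : K) • toLevi (K := K) e ∧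
    ⁅toLevi (K := K) (t : L), toLevi f⁆ = -(2 : K) • toLevi (K := K) f ∧
    ∀ (χ : H → K), ∀ x ∈ rootSpace H χ, toLevi (K := K) x ≠ 0 →
      ∃ z : ℤ, χ t = 2 * z ∧ (z = 0 → ∃ y ∈ H, toLevi (K := K) y = toLevi x) := by
  obtain ⟨⟨h, t, ht, rfl⟩, e, f, h1, h2, h3, h4⟩ := exists_principal (H.map (toLevi (K := K)))
  obtain ⟨e, rfl⟩ := toLevi_surjective e
  obtain ⟨f, rfl⟩ := toLevi_surjective f
  refine ⟨⟨t, ht⟩, e, f, h1, h2, h3, fun χ x hx hx0 => ?_⟩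
  have hex : ∀ c : H.map (toLevi (K := K)), ∃ a : K,
      ⁅(c : L ⧸ radical K L), toLevi x⁆ = a • toLevi (K := K) x := by
    rintro ⟨_, y, hy, rfl⟩
    exact ⟨_, lie_toLevi_eq_smul H hx ⟨y, hy⟩⟩
  choose a ha using hex
  have hmem : toLevi x ∈ rootSpace (H.map (toLevi (K := K))) a := by
    rw [LieModule.mem_genWeightSpace]
    intro c
    refine ⟨1, ?_⟩
    rw [pow_one, LinearMap.sub_apply, LieModule.toEnd_apply_apply,
      LieSubalgebra.coe_bracket_of_module, ha]
    simp
  obtain ⟨z, hz, hz0⟩ := h4 ⟨a, fun hbot => hx0 (by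
    have h9 : toLevi x ∈ (⊥ : LieSubmodule K (H.map (toLevi (K := K))) (L ⧸ radical K L)) :=
      hbot ▸ hmem
    simpa using h9)⟩
  refine ⟨z, ?_, fun h0 => ?_⟩
  · rw [← hz]
    have h5 := ha ⟨toLevi t, t, ht, rfl⟩
    have h6 := lie_toLevi_eq_smul H hx ⟨t, ht⟩
    rw [h6] at h5
    exact smul_left_injective K hx0 h5
  · have h5 : a = 0 := hz0 h0
    rw [h5, rootSpace_zero_eq] at hmem
    exact hmem

/-- A symplectic module without isotropic submodules has no zero weight. -/
lemma genWeightSpace_zero_eq_bot (hV : ∀ x ∈ radical K L, ∀ v : V, ⁅x, v⁆ = 0)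
    {Z : Type*} [AddCommGroup Z] [Module K Z] (ω : V →ₗ[K] V →ₗ[K] Z)
    (hinv : ∀ (x : L) (u v : V), ω ⁅x, u⁆ v + ω u ⁅x, v⁆ = 0) (halt : ∀ u v, ω u v = - ω v u)
    (hiso : ∀ U : LieSubmodule K L V, (∀ u ∈ U, ∀ v ∈ U, ω u v = 0) → U = ⊥) :
    LieModule.genWeightSpace V (0 : H → K) = ⊥ := by
  by_contra hne
  obtain ⟨t, e, f, h1, h2, h3, h4⟩ := exists_principal_lift H
  have ops := sl2Ops_of_toLevi hV h1 h2 h3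
  obtain ⟨NE, hNE⟩ := exists_pow_eq_zero (c := (2 : K)) two_ne_zero ops.he
  obtain ⟨NF, hNF⟩ := exists_pow_eq_zero (c := -(2 : K)) (neg_ne_zero.2 two_ne_zero)
    (fun v => by rw [ops.hf, sub_eq_add_neg, neg_smul])
  set T := LieModule.toEnd K L V (t : L) with hT
  set E := LieModule.toEnd K L V e with hE
  set F := LieModule.toEnd K L V f with hF
  let G : K → Submodule K V := fun c => Module.End.eigenspace T c
  have hG : ∀ {c : K} {v : V}, v ∈ G c ↔ ⁅(t : L), v⁆ = c • v :=
    Module.End.mem_eigenspace_iff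
  have hindG : iSupIndep G := Module.End.eigenspaces_iSupIndep T
  have hhon := lie_eq_smul_of_mem_genWeightSpace H hV
  have hVtop : (⨆ χ : H → K, (LieModule.genWeightSpace V χ).toSubmodule) = ⊤ := by
    have h1 := LieModule.iSup_genWeightSpace_eq_top K H V
    rw [← LieSubmodule.toSubmodule_inj] at h1
    simpa using h1
  let W : K → Submodule K V := fun c =>
    ⨆ χ : {χ : H → K // χ t = c}, (LieModule.genWeightSpace V χ.1).toSubmodule
  have hWG : ∀ c, W c ≤ G c := fun c => iSup_le fun ⟨χ, hχ⟩ v hv => by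
    rw [hG, hhon χ hv t, hχ]
  have hWtop : ⨆ c, W c = ⊤ := by
    rw [eq_top_iff, ← hVtop]
    exact iSup_le fun χ => le_trans (le_iSup (fun χ' : {χ' : H → K // χ' t = χ t} =>
      (LieModule.genWeightSpace V χ'.1).toSubmodule) ⟨χ, rfl⟩) (le_iSup W (χ t))
  have hGtop : ⨆ c, G c = ⊤ := by
    rw [eq_top_iff, ← hWtop]; exact iSup_mono hWG
  have hGW : ∀ c, G c ≤ W c := fun c v hv => by
    have := mem_map_of_iSup_eq_top (LinearMap.id : V →ₗ[K] V) W G hWtop hindG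
      (fun c => by rw [Submodule.map_id]; exact hWG c) (i := c) (x := v) hv
    simpa using this
  have hGmove : ∀ {x : L} {a c : K} {m : V},
      ⁅toLevi (K := K) (t : L), toLevi x⁆ = a • toLevi (K := K) x → m ∈ G c → ⁅x, m⁆ ∈ G (c + a) := by
    intro x a c m hx hm
    rw [hG] at hm ⊢
    have := lie_eq_of_toLevi_eq hV (x := ⁅(t : L), x⁆) (y := a • x)
      (by rw [LieHom.map_lie, hx, map_smul]) m
    rw [leibniz_lie, this, hm, lie_smul, smul_lie, add_smul, add_comm]
  have hfinG : {c | G c ≠ ⊥}.Finite := Module.End.finite_hasEigenvalue T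
  have hG0 : G 0 ≠ ⊥ := fun h => hne (by
    rw [eq_bot_iff]
    intro v hv
    have : v ∈ G 0 := by rw [hG, hhon 0 hv t]; rfl
    rw [h] at this; simpa using this)
  obtain ⟨z, hz, hzmax⟩ : ∃ z : ℕ, G ((2 * z : ℕ) : K) ≠ ⊥ ∧
      ∀ z' : ℕ, z < z' → G ((2 * z' : ℕ) : K) = ⊥ := by
    have hfin : {z : ℕ | G ((2 * z : ℕ) : K) ≠ ⊥}.Finite :=
      hfinG.preimage (f := fun z : ℕ => ((2 * z : ℕ) : K)) (fun a _ b _ hab => by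
        have := Nat.cast_injective (R := K) hab; omega)
    obtain ⟨z, hz, hmax⟩ := Set.exists_max_image _ id hfin ⟨0, by simpa using hG0⟩
    exact ⟨z, hz, fun z' hz' => by
      by_contra h; exact absurd (hmax z' h) (by simpa using hz')⟩
  set k := 2 * z with hk
  obtain ⟨χ, hχt, v, hvχ, hv0⟩ : ∃ χ : H → K, χ t = (k : K) ∧
      ∃ v ∈ LieModule.genWeightSpace V χ, v ≠ 0 := by
    by_contra! hcon
    refine hz (eq_bot_iff.2 ((hGW _).trans (iSup_le fun ⟨χ, hχ⟩ v hv => ?_)))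
    simpa using hcon χ hχ v hv
  have hvG : v ∈ G k := by rw [hG, hhon χ hvχ t, hχt]
  let P : Submodule K V := Submodule.span K {v} ⊔ ⨆ z' : {z' : ℤ // z' < z}, G (2 * z'.1)
  let N : Submodule K L := Submodule.span K {x | ∃ w : ℤ, w < 0 ∧
    ⁅toLevi (K := K) (t : L), toLevi x⁆ = (2 * w : K) • toLevi (K := K) x}
  let B : Submodule K L :=
    { carrier := {x | ∃ c : K, ⁅x, v⁆ = c • v}
      add_mem' := by
        rintro a b ⟨c, hc⟩ ⟨d, hd⟩; exact ⟨c + d, by rw [add_lie, hc, hd, add_smul]⟩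
      zero_mem' := ⟨0, by simp⟩
      smul_mem' := by
        rintro a b ⟨c, hc⟩; exact ⟨a * c, by rw [smul_lie, hc, mul_smul]⟩ }
  have hNB : N ⊔ B = ⊤ := by
    have h1 := LieModule.iSup_genWeightSpace_eq_top K H L
    rw [← LieSubmodule.toSubmodule_inj, LieSubmodule.iSup_toSubmodule,
      LieSubmodule.top_toSubmodule] at h1
    rw [eq_top_iff, ← h1]
    refine iSup_le fun χ' x hx => ?_
    by_cases hx0 : toLevi (K := K) x = 0
    · exact Submodule.mem_sup_right ⟨0, by rw [hV x (toLevi_eq_zero.1 hx0), zero_smul]⟩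
    obtain ⟨w, hw, hw0⟩ := h4 χ' x hx hx0
    have hxt : ⁅toLevi (K := K) (t : L), toLevi x⁆ = (2 * w : K) • toLevi (K := K) x := by
      rw [lie_toLevi_eq_smul H hx t, hw]
    rcases lt_trichotomy w 0 with h | h | h
    · exact Submodule.mem_sup_left (Submodule.subset_span ⟨w, h, hxt⟩)
    · obtain ⟨y, hy, hyx⟩ := hw0 h
      refine Submodule.mem_sup_right ⟨χ ⟨y, hy⟩, ?_⟩
      rw [← lie_eq_of_toLevi_eq hV hyx v]
      exact hhon χ hvχ ⟨y, hy⟩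
    · refine Submodule.mem_sup_right ⟨0, ?_⟩
      have h5 := hGmove hxt hvG
      lift w to ℕ using h.le
      have h6 := hzmax (z + w) (by omega)
      have h7 : ((2 * (z + w) : ℕ) : K) = (k : K) + 2 * ((w : ℤ) : K) := by
        rw [hk]; push_cast; ring
      rw [h7] at h6
      rw [h6] at h5
      rw [zero_smul]; simpa using h5
  let U := LieSubmodule.lieSpan K L {v}
  have hvU : v ∈ U := LieSubmodule.subset_lieSpan rfl
  have hUP : U.toSubmodule ≤ P := by
    refine lieSpan_le_of_stable N B hNB v (fun b hb => hb) P
      (Submodule.mem_sup_left (Submodule.mem_span_singleton_self v)) ?_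
    intro x hx
    change P ≤ P.comap (LieModule.toEnd K L V x)
    have main : ∀ y ∈ N, ∀ z' : ℤ, z' ≤ z → ∀ m ∈ G (2 * z'), ⁅y, m⁆ ∈ P := by
      intro y hy z' hz' m hm
      induction hy using Submodule.span_induction with
      | mem y hy =>
        obtain ⟨w, hw, hyw⟩ := hy
        have h5 := hGmove hyw hm
        refine Submodule.mem_sup_right (Submodule.mem_iSup_of_mem ⟨z' + w, by omega⟩ ?_)
        convert h5 using 2
        push_cast; ring
      | zero => simp
      | add a b _ _ ha hb => rw [add_lie]; exact P.add_mem ha hb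
      | smul c a _ ha => rw [smul_lie]; exact P.smul_mem c ha
    refine sup_le ?_ (iSup_le fun ⟨z', hz'⟩ m hm => main x hx z' hz'.le m hm)
    rw [Submodule.span_singleton_le_iff_mem]
    exact main x hx z le_rfl v (by convert hvG using 2; rw [hk]; push_cast; ring)
  have hUk : ∀ m ∈ U, m ∈ G k → ∃ a : K, m = a • v := by
    intro m hm hmk
    obtain ⟨y, hy, p, hp, hyp⟩ := Submodule.mem_sup.1 (hUP hm)
    obtain ⟨a, rfl⟩ := Submodule.mem_span_singleton.1 hy
    refine ⟨a, ?_⟩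
    have hpk : p ∈ G k := by
      have : p = m - a • v := by rw [← hyp]; abel
      rw [this]; exact Submodule.sub_mem _ hmk (Submodule.smul_mem _ _ hvG)
    have hp' : p ∈ ⨆ j, ⨆ _ : j ≠ (k : K), G j := by
      refine (iSup_le fun ⟨z', hz'⟩ => ?_ : (⨆ z' : {z' : ℤ // z' < z}, G (2 * z'.1)) ≤ _) hp
      refine le_iSup₂_of_le (2 * (z' : K)) (fun h => ?_) le_rfl
      rw [hk] at h
      have : ((2 * z' : ℤ) : K) = ((2 * z : ℤ) : K) := by push_cast at h ⊢; exact h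
      have := Int.cast_injective this
      omega
    have := Submodule.disjoint_def.1 (hindG k) _ hpk hp'
    rw [← hyp, this, add_zero]
  have hTv : T v = (k : K) • v := hG.1 hvG
  have hEv : E v = 0 := by
    have h5 := hGmove h2 hvG
    have h6 := hzmax (z + 1) (by omega)
    have h7 : ((2 * (z + 1) : ℕ) : K) = (k : K) + 2 := by rw [hk]; push_cast; ring
    rw [h7] at h6
    rw [h6] at h5
    exact (Submodule.mem_bot K).1 h5
  have hEF := (ops.pow_e_pow_f hTv (n := 0) (by simpa using hEv) k).1
  rw [zero_add, pow_zero, Module.End.one_apply] at hEF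
  have hcoef : Sl2Ops.coef (k : K) 0 k ≠ 0 := Sl2Ops.coef_ne_zero fun i hi h => by
    have : (i : K) = k := by push_cast at h; linear_combination -h
    have := Nat.cast_injective this
    omega
  have hpowU : ∀ (x : L) (n : ℕ), ∀ m ∈ U, (LieModule.toEnd K L V x ^ n) m ∈ U := by
    intro x n m hm
    induction n with
    | zero => simpa using hm
    | succ n ih =>
      rw [pow_succ', Module.End.mul_apply]; exact U.lie_mem ih
  have hUneg : ∀ m ∈ U, m ∈ G (-(k : K)) → ∃ a : K, m = a • (F ^ k) v := by
    intro m hm hmk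
    have hTm : T m = (-(k : K)) • m := hG.1 hmk
    obtain ⟨a, ha⟩ := hUk ((E ^ k) m) (hpowU e k m hm) (by
      rw [hG]
      have := ops.h_pow_e k m
      rw [hTm, map_smul, ← add_smul] at this
      refine this.trans ?_
      congr 1; ring)
    refine ⟨a / Sl2Ops.coef (k : K) 0 k, sub_eq_zero.1 ?_⟩
    refine ops.symm.eq_zero_of_pow_f_nat (k := k) (N := NF) (j := k) ?_ (by rw [hNF]; rfl) ?_ le_rfl
    · have := ops.h_pow_f k v
      rw [hTv, map_smul] at this
      rw [LinearMap.neg_apply, map_sub, map_smul, this, hTm]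
      module
    · rw [map_sub, map_smul, hEF, ha, smul_smul, div_mul_cancel₀ _ hcoef, sub_self]
  have hωF : ∀ n (u w : V), ω ((F ^ n) u) w = (-1 : K) ^ n • ω u ((F ^ n) w) := by
    intro n
    induction n with
    | zero => simp
    | succ n ih =>
      intro u w
      have h5 := hinv f ((F ^ n) u) w
      have h6 := ih u (F w)
      rw [← Module.End.mul_apply (F ^ n), ← pow_succ] at h6
      rw [pow_succ' F n, Module.End.mul_apply]
      refine (eq_neg_of_add_eq_zero_left h5).trans ?_
      refine (congrArg Neg.neg h6).trans ?_
      rw [← pow_succ', pow_succ (-1 : K), mul_neg_one, neg_smul]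
  have hωv : ω v ((F ^ k) v) = 0 := by
    have h5 := hωF k v v
    have h7 : (-1 : K) ^ k = 1 := by rw [hk, pow_mul, neg_one_sq, one_pow]
    rw [h7, one_smul, halt] at h5
    have h6 : (2 : K) • ω v ((F ^ k) v) = 0 := by
      rw [two_smul]; nth_rewrite 1 [← h5]; abel
    exact (smul_eq_zero.1 h6).resolve_left two_ne_zero
  have hvm : ∀ m ∈ U, ω v m = 0 := by
    have hUle : U.toSubmodule ≤ ⨆ c, U.toSubmodule ⊓ G c := by
      have h5 := Submodule.inf_iSup_genEigenspace (f := T) (p := U.toSubmodule)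
        (fun x hx => U.lie_mem hx) 1
      have h6 : (⨆ c, Module.End.genEigenspace T c 1) = ⊤ := hGtop
      rw [h6, inf_top_eq] at h5
      exact h5.le
    intro m hm
    refine (hUle.trans (iSup_le fun c m hm => ?_) : U.toSubmodule ≤ LinearMap.ker (ω v)) hm
    rw [LinearMap.mem_ker]
    by_cases hc : (k : K) + c = 0
    · obtain ⟨a, rfl⟩ := hUneg m hm.1 (by rw [← eq_neg_of_add_eq_zero_right hc]; exact hm.2)
      rw [map_smul, hωv, smul_zero]
    · have h5 := hinv t v m
      rw [hG.1 hvG, hG.1 hm.2, map_smul, map_smul, LinearMap.smul_apply, ← add_smul] at h5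
      exact (smul_eq_zero.1 h5).resolve_left hc
  let U' : LieSubmodule K L V :=
    { carrier := {u | ∀ w ∈ U, ω u w = 0}
      add_mem' := fun {a b} ha hb w hw => by
        rw [map_add, LinearMap.add_apply, ha w hw, hb w hw, add_zero]
      zero_mem' := fun w _ => by simp
      smul_mem' := fun c a ha w hw => by rw [map_smul, LinearMap.smul_apply, ha w hw, smul_zero]
      lie_mem := fun {x m} hm w hw => by
        have h5 := hinv x m w
        rwa [hm _ (U.lie_mem hw), add_zero] at h5 }
  have hUU' : U ≤ U' := LieSubmodule.lieSpan_le.2 (Set.singleton_subset_iff.2 hvm)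
  have := hiso U fun u hu w hw => hUU' hu w hw
  rw [this] at hvU
  exact hv0 (by simpa using hvU)

end Symplectic

end

section

section Reductive

open LieAlgebra

variable {K L : Type*} [Field K] [IsAlgClosed K] [CharZero K] [LieRing L] [LieAlgebra K L]
  [FiniteDimensional K L] (hred : ∀ I : LieIdeal K L, IsLieAbelian I → I ≤ center K L)

/-- the radical modulo the center. -/
abbrev RadModCenter (K L : Type*) [Field K] [LieRing L] [LieAlgebra K L] : Type _ :=
  (radical K L) ⧸ (LieSubmodule.comap (LieSubmodule.incl (radical K L)) (center K L))

/-- projection of the radical to its quotient by the center. -/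
def radMk : radical K L →ₗ⁅K, L⁆ RadModCenter K L := LieSubmodule.Quotient.mk' _

lemma radMk_eq_zero {r : radical K L} : radMk r = 0 ↔ (r : L) ∈ center K L :=
  LieSubmodule.Quotient.mk_eq_zero'

lemma radMk_surjective : Function.Surjective (radMk : radical K L →ₗ⁅K, L⁆ RadModCenter K L) :=
  LieSubmodule.Quotient.surjective_mk' _

include hred

lemma lie_mem_center {x y : L} (hx : x ∈ radical K L) (hy : y ∈ radical K L) :
    ⁅x, y⁆ ∈ center K L :=
  radical_lie_le_center hred (LieSubmodule.lie_mem_lie hx hy)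

lemma radical_lie_radMod {x : L} (hx : x ∈ radical K L) (v : RadModCenter K L) : ⁅x, v⁆ = 0 := by
  obtain ⟨r, rfl⟩ := radMk_surjective v
  rw [← LieModuleHom.map_lie, radMk_eq_zero]
  exact lie_mem_center hred hx r.2

variable (H : LieSubalgebra K L) [H.IsCartanSubalgebra]

lemma radMod_zero_weight : LieModule.genWeightSpace (RadModCenter K L) (0 : H → K) = ⊥ := by
  obtain ⟨s, hs⟩ := (radMk (K := K) (L := L) : radical K L →ₗ[K]
    RadModCenter K L).exists_rightInverse_of_surjective (LinearMap.range_eq_top.2 radMk_surjective)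
  have hs' : ∀ r : radical K L, ((s (radMk r) : L) - r) ∈ center K L := fun r => by
    have h1 : radMk (s (radMk r)) = radMk r := LinearMap.congr_fun hs (radMk r)
    have := radMk_eq_zero (K := K) (r := s (radMk r) - r)
    rw [map_sub, h1, sub_self] at this
    exact this.1 rfl
  let ω : RadModCenter K L →ₗ[K] RadModCenter K L →ₗ[K] L :=
    LinearMap.mk₂ K (fun u v => ⁅(s u : L), (s v : L)⁆)
      (fun a b c => by simp) (fun a b c => by simp) (fun a b c => by simp) (fun a b c => by simp)
  have hω : ∀ a b : radical K L, ω (radMk a) (radMk b) = ⁅(a : L), (b : L)⁆ := by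
    intro a b
    change ⁅(s (radMk a) : L), (s (radMk b) : L)⁆ = _
    have h1 := mem_center_iff.1 (hs' a) (s (radMk b))
    have h2 := mem_center_iff.1 (hs' b) a
    rw [lie_sub, sub_eq_zero] at h1 h2
    rw [← lie_skew, h1, lie_skew, h2]
  refine genWeightSpace_zero_eq_bot H (fun _ hx v => radical_lie_radMod hred hx v) ω ?_ ?_ ?_
  · intro x u v
    obtain ⟨a, rfl⟩ := radMk_surjective u
    obtain ⟨b, rfl⟩ := radMk_surjective v
    rw [← LieModuleHom.map_lie, ← LieModuleHom.map_lie, hω, hω]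
    have h1 := mem_center_iff.1 (lie_mem_center hred a.2 b.2) x
    rw [leibniz_lie] at h1
    exact h1
  · intro u v
    obtain ⟨a, rfl⟩ := radMk_surjective u
    obtain ⟨b, rfl⟩ := radMk_surjective v
    rw [hω, hω, lie_skew]
  · intro U hU
    let I : LieIdeal K L := (U.comap radMk).map (LieSubmodule.incl (radical K L))
    have hI : ∀ x ∈ I, ∃ r : radical K L, radMk r ∈ U ∧ (r : L) = x := by
      intro x hx
      obtain ⟨r, hr, rfl⟩ := (LieSubmodule.mem_map _).1 hx
      exact ⟨r, hr, rfl⟩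
    have hIab : IsLieAbelian I := isLieAbelian_of_lie_eq_zero fun x hx y hy => by
      obtain ⟨a, ha, rfl⟩ := hI x hx
      obtain ⟨b, hb, rfl⟩ := hI y hy
      rw [← hω]; exact hU _ ha _ hb
    rw [eq_bot_iff]
    intro u hu
    obtain ⟨a, rfl⟩ := radMk_surjective u
    rw [LieSubmodule.mem_bot, radMk_eq_zero]
    exact hred I hIab ((LieSubmodule.mem_map _).2 ⟨a, hu, rfl⟩)

lemma toEnd_pow_radMk (y : H) (c : K) (k : ℕ) (r : radical K L) :
    ∃ r' : radical K L, (r' : L) = ((LieModule.toEnd K H L y - c • 1) ^ k) (r : L) ∧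
    ((LieModule.toEnd K H (RadModCenter K L) y - c • 1) ^ k) (radMk r) = radMk r' := by
  induction k generalizing r with
  | zero => exact ⟨r, rfl, rfl⟩
  | succ k ih =>
    obtain ⟨r', h1, h2⟩ := ih (⁅(y : L), r⁆ - c • r)
    exact ⟨r', h1, h2⟩

lemma radMk_mem_genWeightSpace {χ : H → K} {r : radical K L} (hr : (r : L) ∈ rootSpace H χ) :
    radMk r ∈ LieModule.genWeightSpace (RadModCenter K L) χ := by
  rw [LieModule.mem_genWeightSpace] at hr ⊢
  intro y
  obtain ⟨k, hk⟩ := hr y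
  obtain ⟨r', h1, h2⟩ := toEnd_pow_radMk hred H y (χ y) k r
  exact ⟨k, by rw [h2, radMk_eq_zero, h1, hk]; exact zero_mem _⟩

lemma mem_center_of_mem_radical {x : L} (hx : x ∈ radical K L) (hH : x ∈ H) :
    x ∈ center K L := by
  have h1 := radMk_mem_genWeightSpace hred H (χ := 0) (r := ⟨x, hx⟩)
    (by rw [rootSpace_zero_eq]; exact hH)
  rw [radMod_zero_weight hred H] at h1
  exact radMk_eq_zero.1 ((LieSubmodule.mem_bot _).1 h1)

lemma center_le_cartan {x : L} (hx : x ∈ center K L) : x ∈ rootSpace H 0 := by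
  rw [LieModule.mem_genWeightSpace]
  exact fun y => ⟨1, by simp [mem_center_iff.1 hx]⟩

lemma eq_zero_of_mem_rootSpace {χ ψ : H → K} (h : χ ≠ ψ) {x : L} (h1 : x ∈ rootSpace H χ)
    (h2 : x ∈ rootSpace H ψ) : x = 0 := by
  have := LieModule.disjoint_genWeightSpace K H L h
  rw [← LieSubmodule.disjoint_toSubmodule] at this
  exact Submodule.disjoint_def.1 this x h1 h2

/-- A root of the Levi quotient lifts to an `sl₂`-triple. -/
lemma exists_triple {χ : H → K} (hχ : χ ≠ 0) {x : L} (hx : x ∈ rootSpace H χ)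
    (hxR : x ∉ radical K L) :
    (∀ r ∈ rootSpace H χ, r ∈ radical K L → r = 0) ∧
    (∀ r ∈ rootSpace H (-χ), r ∈ radical K L → r = 0) ∧
    (∀ x' ∈ rootSpace H χ, ∃ c : K, x' = c • x) ∧
    ∃ y ∈ rootSpace H (-χ), ∃ h : H, (h : L) = ⁅x, y⁆ ∧ χ h = 2 ∧ y ∉ radical K L := by
  set C := H.map (toLevi (K := K)) with hC
  have hx0 : toLevi (K := K) x ≠ 0 := fun h => hxR (toLevi_eq_zero.1 h)
  have hex : ∀ c : C, ∃ y : H, toLevi (K := K) (y : L) = c := by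
    rintro ⟨_, y, hy, rfl⟩
    exact ⟨⟨y, hy⟩, rfl⟩
  choose s hs using hex
  let a : C → K := fun c => χ (s c)
  have hχs : ∀ y : H, χ (s ⟨toLevi (y : L), y, y.2, rfl⟩) = χ y := by
    intro y
    have h1 := lie_toLevi_eq_smul H hx y
    have h2 := lie_toLevi_eq_smul H hx (s ⟨toLevi (y : L), y, y.2, rfl⟩)
    rw [hs, h1] at h2
    exact (smul_left_injective K hx0 h2).symm
  have hmem : ∀ x' ∈ rootSpace H χ, toLevi x' ∈ rootSpace C a := by
    intro x' hx'
    rw [LieModule.mem_genWeightSpace]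
    intro c
    refine ⟨1, ?_⟩
    have := lie_toLevi_eq_smul H hx' (s c)
    rw [hs] at this
    rw [pow_one, LinearMap.sub_apply, LieModule.toEnd_apply_apply,
      LieSubalgebra.coe_bracket_of_module, this]
    simp [a]
  let α : LieModule.Weight K C (L ⧸ radical K L) := ⟨a, fun hbot => hx0 (by
    have h9 : toLevi x ∈ (⊥ : LieSubmodule K C (L ⧸ radical K L)) := hbot ▸ hmem x hx
    simpa using h9)⟩
  have hα : α.IsNonZero := by
    intro h0
    apply hχ
    funext y
    rw [← hχs y]
    exact congrFun h0 _
  obtain ⟨h', e, f, ht, he, hf⟩ := IsKilling.exists_isSl2Triple_of_weight_isNonZero hα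
  have hh := ht.h_eq_coroot hα he hf
  have h1dim : ∀ u ∈ rootSpace C a, ∃ c : K, u = c • toLevi (K := K) x := by
    have h1 := IsKilling.finrank_rootSpace_eq_one α hα
    intro u hu
    obtain ⟨c, hc⟩ := (finrank_eq_one_iff_of_nonzero' (⟨toLevi x, hmem x hx⟩ : rootSpace C a)
      (fun h => hx0 (congrArg Subtype.val h))).1 h1 ⟨u, hu⟩
    exact ⟨c, (congrArg Subtype.val hc).symm⟩
  obtain ⟨f, rfl⟩ := toLevi_surjective f
  obtain ⟨y, hy, hyf⟩ := exists_of_toLevi_mem H (χ := -χ) (x := f) (by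
    rw [LieModule.mem_genWeightSpace]
    intro y
    obtain ⟨k, hk⟩ := (LieModule.mem_genWeightSpace _ _ _).1 hf ⟨toLevi (y : L), y, y.2, rfl⟩
    refine ⟨k, ?_⟩
    have h5 : (-α : C → K) ⟨toLevi (y : L), y, y.2, rfl⟩ = (-χ) y := by
      simp only [Pi.neg_apply]; exact congrArg Neg.neg (hχs y)
    rw [h5] at hk
    exact hk)
  rw [← hyf] at ht hf
  obtain ⟨c, hc⟩ := h1dim e he
  have hc0 : c ≠ 0 := fun h => ht.e_ne_zero (by rw [hc, h, zero_smul])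
  have hcoe : ∃ h : H, toLevi (K := K) (h : L) = h' ∧ χ h = 2 := by
    refine ⟨s (IsKilling.coroot α), by rw [hs, hh], ?_⟩
    exact IsKilling.root_apply_coroot hα
  obtain ⟨h, hh1, hχh⟩ := hcoe
  rw [← hh1, hc] at ht
  have hV := fun x hx v => radical_lie_radMod hred (x := x) hx v
  have key : ∀ (ψ : H → K) (e f : L) (T : Module.End K (RadModCenter K L)),
      f ∈ rootSpace H (-ψ) →
      (∀ v ∈ LieModule.genWeightSpace (RadModCenter K L) ψ, T v = (2 : K) • v) →
      Sl2Ops (LieModule.toEnd K L (RadModCenter K L) e)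
        (LieModule.toEnd K L (RadModCenter K L) f) T → ψ ≠ 0 →
      ∀ r ∈ rootSpace H ψ, r ∈ radical K L → r = 0 := by
    intro ψ e f T hf hT ops hψ r hr hrR
    have hv := radMk_mem_genWeightSpace hred H (r := ⟨r, hrR⟩) hr
    have h0 : ⁅f, radMk (K := K) (⟨r, hrR⟩ : radical K L)⁆ = 0 := by
      have h3 := LieAlgebra.lie_mem_genWeightSpace_of_mem_genWeightSpace hf hv
      rw [neg_add_cancel, radMod_zero_weight hred H] at h3
      exact (LieSubmodule.mem_bot _).1 h3
    obtain ⟨N, hN⟩ := exists_pow_eq_zero (two_ne_zero (α := K)) ops.he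
    have h4 : radMk (K := K) (⟨r, hrR⟩ : radical K L) = 0 := by
      refine ops.eq_zero_of_pow_f_nat (k := 2) (N := N) (j := 1) ?_ ?_ ?_ (by norm_num)
      · rw [hT _ hv]; simp
      · rw [hN]; rfl
      · rw [pow_one]; exact h0
    exact eq_zero_of_mem_rootSpace hred H hψ hr (center_le_cartan hred H (radMk_eq_zero.1 h4))
  have ht3 := ht.lie_lie_smul_f K
  have hops : Sl2Ops (LieModule.toEnd K L (RadModCenter K L) (c • x))
        (LieModule.toEnd K L (RadModCenter K L) y)
        (LieModule.toEnd K L (RadModCenter K L) (h : L)) := by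
    refine sl2Ops_of_toLevi hV ?_ ?_ ?_
    · rw [map_smul]; exact ht.lie_e_f
    · rw [map_smul]; exact ht.lie_h_e_smul K
    · rw [ht3, neg_smul]
  have h1 := key χ (c • x) y _ hy (fun v hv => by
    rw [LieModule.toEnd_apply_apply, lie_eq_smul_of_mem_genWeightSpace H hV χ hv, hχh]) hops hχ
  have h2 := key (-χ) y (c • x) _ (by rw [neg_neg]; exact Submodule.smul_mem _ _ hx)
    (fun v hv => by
      rw [LinearMap.neg_apply, LieModule.toEnd_apply_apply,
        lie_eq_smul_of_mem_genWeightSpace H hV (-χ) hv, Pi.neg_apply, hχh, neg_smul, neg_neg])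
    hops.symm (neg_ne_zero.2 hχ)
  refine ⟨h1, h2, ?_, c • y, Submodule.smul_mem _ _ hy, ?_⟩
  · intro x' hx'
    obtain ⟨d, hd⟩ := h1dim _ (hmem x' hx')
    refine ⟨d, sub_eq_zero.1 (h1 _ (Submodule.sub_mem _ hx' (Submodule.smul_mem _ d hx)) ?_)⟩
    rw [← toLevi_eq_zero (K := K), map_sub, hd, map_smul, sub_self]
  · have hxy : ⁅x, c • y⁆ ∈ H := by
      have h3 := LieAlgebra.lie_mem_genWeightSpace_of_mem_genWeightSpace hx
        (Submodule.smul_mem _ c hy)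
      rw [add_neg_cancel] at h3
      have h4 : ⁅x, c • y⁆ ∈ rootSpace H 0 := h3
      rw [rootSpace_zero_eq] at h4
      exact h4
    refine ⟨⟨_, hxy⟩, rfl, ?_, ?_⟩
    · have h4 := lie_toLevi_eq_smul H hx ⟨_, hxy⟩
      have h5 := lie_toLevi_eq_smul H hx h
      have h6 : toLevi (K := K) ⁅x, c • y⁆ = toLevi (h : L) := by
        rw [← ht.lie_e_f, LieHom.map_lie, map_smul, lie_smul, smul_lie]
      simp only [h6] at h4
      rw [h5] at h4
      rw [← hχh]
      exact (smul_left_injective K hx0 h4).symm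
    · intro h7
      have : toLevi (K := K) (c • y) = 0 := toLevi_eq_zero.2 h7
      rw [map_smul] at this
      exact ht.f_ne_zero ((smul_eq_zero.1 this).resolve_left hc0)

end Reductive

end

section

section CartanToral

open LieAlgebra

variable {K L : Type*} [Field K] [IsAlgClosed K] [CharZero K] [LieRing L] [LieAlgebra K L]
  [FiniteDimensional K L] (hred : ∀ I : LieIdeal K L, IsLieAbelian I → I ≤ center K L)
  (H : LieSubalgebra K L) [H.IsCartanSubalgebra]

include hred

lemma lie_sub_smul_mem_radical {ψ : H → K} {x : L} (hx : x ∈ rootSpace H ψ) (y : H) :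
    ⁅(y : L), x⁆ - ψ y • x ∈ radical K L := by
  rw [← toLevi_eq_zero (K := K), map_sub, LieHom.map_lie, lie_toLevi_eq_smul H hx, map_smul,
    sub_self]

lemma lie_sub_smul_mem_rootSpace {ψ : H → K} {x : L} (hx : x ∈ rootSpace H ψ) (y : H) :
    ⁅(y : L), x⁆ - ψ y • x ∈ rootSpace H ψ :=
  Submodule.sub_mem _ (LieSubmodule.lie_mem (x := y) _ hx) (Submodule.smul_mem _ _ hx)

lemma lie_eq_smul_of_ne_zero {ψ : H → K} (hψ : ψ ≠ 0) {x : L} (hx : x ∈ rootSpace H ψ) (y : H) :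
    ⁅(y : L), x⁆ = ψ y • x := by
  have h1 := lie_sub_smul_mem_radical hred H hx y
  have h2 := lie_sub_smul_mem_rootSpace hred H hx y
  rw [← sub_eq_zero]
  by_cases hxR : x ∈ radical K L
  · have h3 := lie_eq_smul_of_mem_genWeightSpace H (fun x hx v => radical_lie_radMod hred hx v) ψ
      (radMk_mem_genWeightSpace hred H (r := ⟨x, hxR⟩) hx) y
    rw [← LieModuleHom.map_lie, ← sub_eq_zero, ← map_smul, ← map_sub,
      radMk_eq_zero] at h3
    exact eq_zero_of_mem_rootSpace hred H hψ h2 (center_le_cartan hred H h3)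
  · exact (exists_triple hred H hψ hx hxR).1 _ h2 h1

lemma cartan_lie_cartan (x y : H) : ⁅(y : L), (x : L)⁆ = 0 := by
  set C := H.map (toLevi (K := K)) with hC
  have key : ∀ c ∈ Submodule.span K (Set.range (IsKilling.rootSystem C).coroot),
      ∃ x : H, toLevi (K := K) (x : L) = (c : C) ∧ ∀ y : H, ⁅(y : L), (x : L)⁆ = 0 := by
    intro c hc
    induction hc using Submodule.span_induction with
    | zero => exact ⟨0, by simp, by simp⟩
    | add a b _ _ ha hb =>
      obtain ⟨x, hx, hx'⟩ := ha
      obtain ⟨x2, hx2, hx2'⟩ := hb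
      exact ⟨x + x2, by simp [hx, hx2], fun y => by simp [hx', hx2']⟩
    | smul t a _ ha =>
      obtain ⟨x, hx, hx'⟩ := ha
      exact ⟨t • x, by simp [hx], fun y => by simp [hx']⟩
    | mem a ha =>
      obtain ⟨α, rfl⟩ := ha
      rw [IsKilling.rootSystem_coroot_apply]
      have hα : (α : LieModule.Weight K C (L ⧸ radical K L)).IsNonZero := by
        have := α.2
        simpa only [LieSubalgebra.root, Finset.mem_filter, Finset.mem_univ, true_and] using this
      obtain ⟨e, he, he0⟩ := (α : LieModule.Weight K C (L ⧸ radical K L)).exists_ne_zero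
      let χ : H → K := fun y => α.1 ⟨toLevi (y : L), y, y.2, rfl⟩
      obtain ⟨u, rfl⟩ := toLevi_surjective e
      obtain ⟨x, hx, hxu⟩ := exists_of_toLevi_mem H (χ := χ) (x := u) (by
        rw [LieModule.mem_genWeightSpace] at he ⊢
        exact fun y => he ⟨toLevi (y : L), y, y.2, rfl⟩)
      have hχ : χ ≠ 0 := by
        intro h0
        apply hα
        funext c
        obtain ⟨_, y, hy, rfl⟩ := c
        exact congrFun h0 ⟨y, hy⟩
      have hxR : x ∉ radical K L := fun h => he0 (by rw [← hxu, toLevi_eq_zero.2 h])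
      obtain ⟨-, -, -, y, hy, h, hh, hh2, hyR⟩ := exists_triple hred H hχ hx hxR
      refine ⟨h, ?_, fun z => ?_⟩
      · have t : IsSl2Triple (toLevi (K := K) (h : L)) (toLevi (K := K) x) (toLevi y) :=
          { h_ne_zero := fun h0 => by
              have h5 := lie_toLevi_eq_smul H hx h
              rw [h0, hh2, zero_lie, hxu] at h5
              exact he0 ((smul_eq_zero.1 h5.symm).resolve_left two_ne_zero)
            lie_e_f := by rw [hh, LieHom.map_lie]
            lie_h_e_nsmul := by
              rw [lie_toLevi_eq_smul H hx h, hh2, two_smul, two_nsmul]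
            lie_h_f_nsmul := by
              rw [lie_toLevi_eq_smul H hy h, Pi.neg_apply, hh2, neg_smul, two_smul, two_nsmul] }
        refine t.h_eq_coroot hα (hxu ▸ he) ?_
        have := toLevi_mem_genWeightSpace H hy
        rw [LieModule.mem_genWeightSpace] at this ⊢
        rintro ⟨_, y, hy, rfl⟩
        exact this ⟨y, hy⟩
      · rw [hh, leibniz_lie, lie_eq_smul_of_ne_zero hred H hχ hx,
          lie_eq_smul_of_ne_zero hred H (neg_ne_zero.2 hχ) hy]
        simp
  have htop : Submodule.span K (Set.range (IsKilling.rootSystem C).coroot) = ⊤ :=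
    by
    have := RootPairing.IsRootSystem.span_coroot_eq_top (P := IsKilling.rootSystem C)
    exact this
  obtain ⟨x0, hx0, hx0'⟩ := key ⟨toLevi (x : L), x, x.2, rfl⟩ (htop ▸ Submodule.mem_top)
  have h1 : ((x - x0 : H) : L) ∈ center K L := by
    refine mem_center_of_mem_radical hred H ?_ (x - x0).2
    rw [← toLevi_eq_zero (K := K), AddSubgroupClass.coe_sub, map_sub, hx0, sub_self]
  have h2 := mem_center_iff.1 h1 y
  rw [AddSubgroupClass.coe_sub, lie_sub, hx0', sub_zero] at h2
  exact h2

/-- A Cartan subalgebra acts by honest weights. -/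
lemma cartan_lie_eq_smul {ψ : H → K} {x : L} (hx : x ∈ rootSpace H ψ) (y : H) :
    ⁅(y : L), x⁆ = ψ y • x := by
  by_cases hψ : ψ = 0
  · subst hψ
    rw [rootSpace_zero_eq] at hx
    rw [cartan_lie_cartan hred H ⟨x, hx⟩ y]; simp
  · exact lie_eq_smul_of_ne_zero hred H hψ hx y

end CartanToral

end

section

section MaxToral

open LieAlgebra

lemma eq_zero_of_sq_eq_zero {K V : Type*} [Field K] [AddCommGroup V] [Module K V]
    (f : Module.End K V) (hf : ⨆ μ : K, f.eigenspace μ = ⊤) {x : V} (hx : f (f x) = 0) :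
    f x = 0 := by
  have h1 : x ∈ f.maxGenEigenspace 0 := by
    rw [Module.End.mem_maxGenEigenspace]
    exact ⟨2, by simp [pow_two, hx]⟩
  have h2 := mem_map_of_iSup_eq_top (LinearMap.id : V →ₗ[K] V) f.eigenspace
    f.maxGenEigenspace hf f.independent_maxGenEigenspace (fun μ => by
      rw [Submodule.map_id]; exact (f.genEigenspace μ).monotone le_top) (i := 0) (x := x) h1
  rw [Submodule.map_id] at h2
  simpa using Module.End.mem_eigenspace_iff.1 h2

variable {K L : Type} [Field K] [IsAlgClosed K] [CharZero K] [LieRing L] [LieAlgebra K L]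

lemma iSup_eigenspace_of_toral {T : LieSubalgebra K L} (hT : ⨆ α, adWeightSpace K L T α = ⊤)
    (t : T) : ⨆ μ : K, (ad K L t).eigenspace μ = ⊤ := by
  rw [eq_top_iff, ← hT]
  refine iSup_le fun α => le_trans ?_ (le_iSup _ (α t))
  exact fun x hx => Module.End.mem_eigenspace_iff.2 (hx t)

/-- the centralizer of a subalgebra. -/
def centralizer' (T : LieSubalgebra K L) : LieSubalgebra K L where
  carrier := {x | ∀ t ∈ T, ⁅t, x⁆ = 0}
  add_mem' ha hb t ht := by rw [lie_add, ha t ht, hb t ht, add_zero]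
  zero_mem' t _ := lie_zero t
  smul_mem' c x hx t ht := by rw [lie_smul, hx t ht, smul_zero]
  lie_mem' {x y} hx hy t ht := by rw [leibniz_lie, hx t ht, hy t ht, zero_lie, lie_zero, add_zero]

variable [FiniteDimensional K L] (hred : ∀ I : LieIdeal K L, IsLieAbelian I → I ≤ center K L)

include hred

/-- In a reductive Lie algebra, maximal toral subalgebras are Cartan subalgebras. -/
lemma isCartan_of_maxToral (T : LieSubalgebra K L) (hab : IsLieAbelian T)
    (hT : ⨆ α, adWeightSpace K L T α = ⊤)
    (hmax : ∀ T' : LieSubalgebra K L, IsLieAbelian T' → ⨆ α, adWeightSpace K L T' α = ⊤ →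
      T ≤ T' → T' = T) : T.IsCartanSubalgebra := by
  have hab' : ∀ x ∈ T, ∀ y ∈ T, ⁅x, y⁆ = 0 := fun x hx y hy =>
    congrArg Subtype.val (hab.trivial ⟨x, hx⟩ ⟨y, hy⟩)
  set M := centralizer' T with hM
  have hTM : T ≤ M := fun x hx t ht => hab' t ht x hx
  obtain ⟨m, hm⟩ := LieAlgebra.exists_isCartanSubalgebra_engel K M
  set H' := LieSubalgebra.engel K m
  set H : LieSubalgebra K L := H'.map M.incl with hH
  have hTH : T ≤ H := by
    intro t ht
    refine ⟨⟨t, hTM ht⟩, ?_, rfl⟩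
    have : (⟨t, hTM ht⟩ : M) ∈ H'.normalizer := by
      rw [LieSubalgebra.mem_normalizer_iff]
      intro y _
      have : ⁅(⟨t, hTM ht⟩ : M), y⁆ = 0 := Subtype.ext (y.2 t ht)
      rw [this]; exact zero_mem _
    rw [LieSubalgebra.IsCartanSubalgebra.self_normalizing] at this
    exact this
  have hHcar : H.IsCartanSubalgebra := by
    constructor
    · have e := H'.equivMapOfInjective M.incl Subtype.val_injective
      exact e.surjective.lieAlgebra_isNilpotent (f := e.toLieHom)
    · refine le_antisymm ?_ H.le_normalizer
      intro x hx
      rw [LieSubalgebra.mem_normalizer_iff] at hx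
      have hHM : ∀ y ∈ H, y ∈ M := by
        rintro _ ⟨y, _, rfl⟩; exact y.2
      have hxM : x ∈ M := by
        intro t ht
        refine eq_zero_of_sq_eq_zero (ad K L t) (iSup_eigenspace_of_toral hT ⟨t, ht⟩) ?_
        rw [ad_apply, ad_apply, ← lie_skew t x, lie_neg, hHM _ (hx t (hTH ht)) t ht, neg_zero]
      refine ⟨⟨x, hxM⟩, ?_, rfl⟩
      have : (⟨x, hxM⟩ : M) ∈ H'.normalizer := by
        rw [LieSubalgebra.mem_normalizer_iff]
        intro y hy
        obtain ⟨z, hz, hz'⟩ := hx (y : L) ⟨y, hy, rfl⟩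
        have : ⁅(⟨x, hxM⟩ : M), y⁆ = z := Subtype.ext hz'.symm
        rw [this]; exact hz
      rw [LieSubalgebra.IsCartanSubalgebra.self_normalizing] at this
      exact this
  have hHT : H = T := by
    refine hmax H ⟨fun x y => Subtype.ext (cartan_lie_cartan hred H y x)⟩ ?_ hTH
    have h1 := LieModule.iSup_genWeightSpace_eq_top K H L
    rw [← LieSubmodule.toSubmodule_inj, LieSubmodule.iSup_toSubmodule,
      LieSubmodule.top_toSubmodule] at h1
    rw [eq_top_iff, ← h1]
    refine iSup_le fun χ => ?_
    intro x hx
    have hx' : ∀ y : H, ⁅(y : L), x⁆ = χ y • x := cartan_lie_eq_smul hred H hx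
    by_cases hx0 : x = 0
    · rw [hx0]; exact zero_mem _
    · let α : Module.Dual K H :=
        { toFun := χ
          map_add' := fun a b => smul_left_injective K hx0 (by
            change χ (a + b) • x = (χ a + χ b) • x
            rw [← hx', add_smul, ← hx', ← hx', ← add_lie]; rfl)
          map_smul' := fun c a => smul_left_injective K hx0 (by
            change χ (c • a) • x = (c * χ a) • x
            rw [← hx', mul_smul, ← hx', ← smul_lie]; rfl) }
      exact (le_iSup (fun α => adWeightSpace K L H α) α) hx'
  rw [← hHT]; exact hHcar

end MaxToral

end

section

namespace Setup

open LieAlgebra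

variable {K : Type} [Field K] [IsAlgClosed K] [CharZero K]
variable {g : Type} [LieRing g] [LieAlgebra K g] (S : Setup K g)

instance (n : ℕ) : FiniteDimensional K (S.F n) := S.F_findim n

/-- the `α`-weight space of `g`. -/
abbrev gw (α : Module.Dual K S.h) : Submodule K g := adWeightSpace K g S.h α

lemma lie_mem_gw {α β : Module.Dual K S.h} {x y : g} (hx : x ∈ S.gw α) (hy : y ∈ S.gw β) :
    ⁅x, y⁆ ∈ S.gw (α + β) := by
  intro H
  rw [leibniz_lie, hx H, hy H, smul_lie, lie_smul, LinearMap.add_apply, add_smul]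

lemma eq_zero_of_mem_gw {α β : Module.Dual K S.h} (h : α ≠ β) {x : g} (hx : x ∈ S.gw α)
    (hy : x ∈ S.gw β) : x = 0 := by
  obtain ⟨H, hH⟩ : ∃ H, α H ≠ β H := by
    by_contra! h'
    exact h (LinearMap.ext h')
  have h1 := (hx H).symm.trans (hy H)
  rw [← sub_eq_zero, ← sub_smul] at h1
  exact (smul_eq_zero.1 h1).resolve_left (sub_ne_zero.2 hH)

/-- `h ∩ F n` as a subalgebra of `F n`. -/
def T (n : ℕ) : LieSubalgebra K (S.F n) := LieSubalgebra.comap (S.F n).incl (S.hn n)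

lemma mem_T {n : ℕ} {x : S.F n} : x ∈ S.T n ↔ (x : g) ∈ S.h :=
  ⟨fun h => h.1, fun h => ⟨h, x.2⟩⟩

lemma lie_h {x y : g} (hx : x ∈ S.h) (hy : y ∈ S.h) : ⁅x, y⁆ = 0 := by
  obtain ⟨n, hn⟩ := S.F_exhaust x
  obtain ⟨m, hm⟩ := S.F_exhaust y
  have := (S.h_maxToral (n ⊔ m)).1.2.1
  exact congrArg Subtype.val (this.trivial
    ⟨x, hx, S.F_mono le_sup_left hn⟩ ⟨y, hy, S.F_mono le_sup_right hm⟩)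

instance isCartan_T (n : ℕ) : (S.T n).IsCartanSubalgebra := by
  refine isCartan_of_maxToral (S.F_reductive n) (S.T n) ?_ ?_ ?_
  · exact ⟨fun x y => Subtype.ext (Subtype.ext (S.lie_h x.2.1 y.2.1))⟩
  · have h1 := (S.h_maxToral n).1.2.2
    have h2 : ∀ α : Module.Dual K ↥(S.h ⊓ S.F n), (S.F n).toSubmodule ⊓
        adWeightSpace K g (S.h ⊓ S.F n) α ≤
        (⨆ β, adWeightSpace K (S.F n) (S.T n) β).map (S.F n).toSubmodule.subtype := by
      rintro α x ⟨hx, hxα⟩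
      let i : S.T n →ₗ[K] ↥(S.h ⊓ S.F n) :=
        { toFun := fun t => ⟨(t : S.F n), t.2⟩
          map_add' := fun _ _ => rfl
          map_smul' := fun _ _ => rfl }
      refine ⟨⟨x, hx⟩, ?_, rfl⟩
      refine (le_iSup (fun β => adWeightSpace K (S.F n) (S.T n) β) (α.comp i)) ?_
      intro t
      exact Subtype.ext (hxα (i t))
    rw [eq_top_iff]
    rintro ⟨x, hx⟩ -
    obtain ⟨y, hy, hyx⟩ := (iSup_le h2) (h1 hx)
    have : y = ⟨x, hx⟩ := Subtype.ext hyx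
    rw [← this]; exact hy
  · intro T' hab hT' hle
    have h1 := (S.h_maxToral n).2 (T'.map (S.F n).incl) ⟨?_, ?_, ?_⟩ ?_
    · refine le_antisymm ?_ hle
      intro x hx
      have : (x : g) ∈ T'.map (S.F n).incl := ⟨x, hx, rfl⟩
      rw [h1] at this
      exact this
    · rintro _ ⟨x, _, rfl⟩; exact x.2
    · constructor
      rintro ⟨_, x, hx, rfl⟩ ⟨_, y, hy, rfl⟩
      have := hab.trivial ⟨x, hx⟩ ⟨y, hy⟩
      exact Subtype.ext (congrArg (fun z : T' => ((z : S.F n) : g)) this)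
    · intro x hx
      have h3 : (⟨x, hx⟩ : S.F n) ∈ ⨆ α, adWeightSpace K (S.F n) T' α := hT' ▸ Submodule.mem_top
      have h4 : ∀ α, adWeightSpace K (S.F n) T' α ≤ (⨆ α, (S.F n).toSubmodule ⊓
          adWeightSpace K g (T'.map (S.F n).incl) α).comap (S.F n).toSubmodule.subtype := by
        intro α y hy
        let e := T'.equivMapOfInjective (S.F n).incl Subtype.val_injective
        refine Submodule.mem_comap.2 (le_iSup (fun α => (S.F n).toSubmodule ⊓
          adWeightSpace K g (T'.map (S.F n).incl) α)
          (α.comp e.symm.toLinearEquiv.toLinearMap) ⟨y.2, ?_⟩)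
        intro t
        obtain ⟨t, rfl⟩ := e.surjective t
        have h5 := congrArg Subtype.val (hy t)
        have h6 : e.symm (e t) = t := e.symm_apply_apply t
        change ⁅((t : S.F n) : g), (y : g)⁆ = α (e.symm (e t)) • (y : g)
        rw [h6]; exact h5
      exact iSup_le h4 h3
    · rintro x ⟨hx, hx'⟩
      exact ⟨⟨x, hx'⟩, hle ⟨hx, hx'⟩, rfl⟩

/-- the restriction of a weight to `T n`. -/
def resT (n : ℕ) (α : Module.Dual K S.h) : S.T n → K := fun t => α ⟨(t : S.F n), t.2.1⟩

lemma mem_rootSpace_of_mem_gw {n : ℕ} {α : Module.Dual K S.h} {x : g} (hx : x ∈ S.gw α)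
    (hn : x ∈ S.F n) : (⟨x, hn⟩ : S.F n) ∈ rootSpace (S.T n) (S.resT n α) := by
  rw [LieModule.mem_genWeightSpace]
  refine fun t => ⟨1, ?_⟩
  rw [pow_one, LinearMap.sub_apply, sub_eq_zero]
  exact Subtype.ext (hx ⟨(t : S.F n), t.2.1⟩)

lemma gw_zero : S.gw 0 = S.h.toSubmodule := by
  refine le_antisymm (fun x hx => ?_) fun x hx H => ?_
  · obtain ⟨n, hn⟩ := S.F_exhaust x
    have h1 : (⟨x, hn⟩ : S.F n) ∈ rootSpace (S.T n) 0 := S.mem_rootSpace_of_mem_gw hx hn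
    rw [rootSpace_zero_eq] at h1
    exact S.mem_T.1 h1
  · rw [S.lie_h H.2 hx]; simp

lemma eventually_mem (x : g) : ∀ᶠ n in Filter.atTop, x ∈ S.F n := by
  obtain ⟨n, hn⟩ := S.F_exhaust x
  filter_upwards [Filter.eventually_ge_atTop n] with m hm using S.F_mono hm hn

lemma eventually_resT_ne_zero {α : Module.Dual K S.h} (hα : α ≠ 0) :
    ∀ᶠ n in Filter.atTop, S.resT n α ≠ 0 := by
  obtain ⟨H, hH⟩ : ∃ H, α H ≠ 0 := by
    by_contra! h'
    exact hα (LinearMap.ext h')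
  filter_upwards [S.eventually_mem H] with n hn h0
  exact hH (congrFun h0 ⟨⟨H, hn⟩, H.2, hn⟩)

/-- the elements lying in the radical of `F n` for large `n`. -/
def rad : LieIdeal K g where
  carrier := {x | ∀ᶠ n in Filter.atTop, ∃ h : x ∈ S.F n, (⟨x, h⟩ : S.F n) ∈ radical K (S.F n)}
  add_mem' ha hb := by
    filter_upwards [ha, hb] with n ⟨h1, h2⟩ ⟨h3, h4⟩
    exact ⟨add_mem h1 h3, add_mem h2 h4⟩
  zero_mem' := Filter.Eventually.of_forall fun n => ⟨zero_mem _, zero_mem (radical K (S.F n))⟩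
  smul_mem' c x hx := by
    filter_upwards [hx] with n ⟨h1, h2⟩
    exact ⟨(S.F n).smul_mem c h1, Submodule.smul_mem (radical K (S.F n)).toSubmodule c h2⟩
  lie_mem {x y} hy := by
    filter_upwards [hy, S.eventually_mem x] with n ⟨h1, h2⟩ h3
    exact ⟨(S.F n).lie_mem h3 h1, LieSubmodule.lie_mem (radical K (S.F n)) (x := ⟨x, h3⟩) h2⟩

lemma lie_eq_zero_of_eventually {x : g}
    (hx : ∀ᶠ n in Filter.atTop, ∃ h : x ∈ S.F n, (⟨x, h⟩ : S.F n) ∈ center K (S.F n)) (y : g) :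
    ⁅y, x⁆ = 0 := by
  obtain ⟨n, ⟨h1, h2⟩, h3⟩ := (hx.and (S.eventually_mem y)).exists
  exact congrArg Subtype.val (mem_center_iff.1 h2 ⟨y, h3⟩)

lemma lie_rad_rad {x y : g} (hx : x ∈ S.rad) (hy : y ∈ S.rad) (z : g) : ⁅z, ⁅x, y⁆⁆ = 0 := by
  refine S.lie_eq_zero_of_eventually ?_ z
  filter_upwards [hx, hy] with n ⟨h1, h2⟩ ⟨h3, h4⟩
  exact ⟨(S.F n).lie_mem h1 h3, lie_mem_center (S.F_reductive n) h2 h4⟩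

lemma lie_rad_h {x : g} (hx : x ∈ S.rad) (hxh : x ∈ S.h) (z : g) : ⁅z, x⁆ = 0 := by
  refine S.lie_eq_zero_of_eventually ?_ z
  filter_upwards [hx] with n ⟨h1, h2⟩
  exact ⟨h1, mem_center_of_mem_radical (S.F_reductive n) (S.T n) h2 (S.mem_T.2 hxh)⟩

include S in
lemma lie_eq_zero_of_isLieAbelian (I : LieIdeal K g) (hI : ∀ x ∈ I, ∀ y ∈ I, ⁅x, y⁆ = 0) {x : g}
    (hx : x ∈ I) (y : g) : ⁅y, x⁆ = 0 := by
  refine S.lie_eq_zero_of_eventually ?_ y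
  filter_upwards [S.eventually_mem x] with n hn
  refine ⟨hn, S.F_reductive n (I.comap (S.F n).incl) ?_ (by simpa using hx)⟩
  refine isLieAbelian_of_lie_eq_zero fun a ha b hb => Subtype.ext (hI _ ?_ _ ?_)
  · simpa using ha
  · simpa using hb

/-- A root vector outside the radical extends to an `sl₂`-triple. -/
lemma exists_triple_of_notMem_rad {α : Module.Dual K S.h} (hα : α ≠ 0) {x : g} (hx : x ∈ S.gw α)
    (hxR : x ∉ S.rad) : ∃ y ∈ S.gw (-α), ∃ H : S.h, (H : g) = ⁅x, y⁆ ∧ α H = 2 := by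
  obtain ⟨n, hxn, hn, hn2⟩ := ((Filter.not_eventually.1 hxR).and_eventually
    ((S.eventually_mem x).and (S.eventually_resT_ne_zero hα))).exists
  obtain ⟨-, -, -, y, hy, H, hH, hH2, -⟩ := exists_triple (S.F_reductive n) (S.T n) hn2
    (S.mem_rootSpace_of_mem_gw hx hn) (fun h => hxn ⟨hn, h⟩)
  have hH' : ((H : S.F n) : g) = ⁅x, (y : g)⁆ := congrArg Subtype.val hH
  have h1 := mem_map_of_iSup_eq_top (LieModule.toEnd K g g x : g →ₗ[K] g)
    (fun β => S.gw (β - α)) S.gw ?_ S.h_indep ?_ (i := 0) (x := (y : g)) ?_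
  · obtain ⟨z, hz, hz'⟩ := h1
    rw [zero_sub] at hz
    refine ⟨z, hz, ⟨(H : S.F n), H.2.1⟩, ?_, hH2⟩
    exact hH'.trans hz'.symm
  · rw [← S.h_span]
    exact (Equiv.subRight α).iSup_comp (g := fun β => S.gw β)
  · rintro β _ ⟨z, hz, rfl⟩
    have := S.lie_mem_gw hx hz
    rwa [add_sub_cancel] at this
  · rw [S.gw_zero]
    change ⁅x, (y : g)⁆ ∈ S.h
    rw [← hH']; exact H.2.1

section Coroot

variable {S} {α : Module.Dual K S.h} {H : S.h} (hc : S.IsCoroot α H)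
include hc

lemma IsCoroot.ne_zero : α ≠ 0 := by
  rintro rfl
  exact two_ne_zero (α := K) (by rw [← hc.1]; rfl)

lemma IsCoroot.neg : S.IsCoroot (-α) (-H) := by
  obtain ⟨h1, x, hx, y, hy, h⟩ := hc
  refine ⟨by simp [h1], y, hy, x, by rwa [neg_neg], ?_⟩
  rw [← lie_skew, ← h]; rfl

lemma IsCoroot.notMem_rad_of_lie {x y : g} (hx : x ∈ S.gw α)  (hxy : (H : g) = ⁅x, y⁆) :
    x ∉ S.rad := by
  intro hR
  have h1 : (H : g) ∈ S.rad := by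
    rw [hxy, ← lie_skew]
    exact neg_mem (S.rad.lie_mem (x := y) hR)
  have h2 := S.lie_rad_h h1 H.2 x
  have h3 := hx H
  rw [← lie_skew, h2, hc.1, neg_zero] at h3
  have hx0 : x = 0 := (smul_eq_zero.1 h3.symm).resolve_left two_ne_zero
  have hH0 : H = 0 := Subtype.ext (by rw [hxy, hx0, zero_lie]; rfl)
  have := hc.1
  rw [hH0, map_zero] at this
  exact two_ne_zero this.symm

lemma IsCoroot.exists_gen : ∃ x ∈ S.gw α, x ∉ S.rad ∧ (∃ y ∈ S.gw (-α), (H : g) = ⁅x, y⁆) ∧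
    (∀ x' ∈ S.gw α, ∃ c : K, x' = c • x) := by
  obtain ⟨h1, x, hx, y, hy, h⟩ := id hc
  have hxR := hc.notMem_rad_of_lie hx h
  refine ⟨x, hx, hxR, ⟨y, hy, h⟩, fun x' hx' => ?_⟩
  obtain ⟨n, hxn, hn, hn1, hn2⟩ := ((Filter.not_eventually.1 hxR).and_eventually
    ((S.eventually_mem x).and ((S.eventually_mem x').and
      (S.eventually_resT_ne_zero hc.ne_zero)))).exists
  obtain ⟨-, -, h3, -⟩ := exists_triple (S.F_reductive n) (S.T n) hn2
    (S.mem_rootSpace_of_mem_gw hx hn) (fun h => hxn ⟨hn, h⟩)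
  obtain ⟨c, hc⟩ := h3 _ (S.mem_rootSpace_of_mem_gw hx' hn1)
  exact ⟨c, congrArg Subtype.val hc⟩

end Coroot

end Setup

end

section

section Form

open LieAlgebra

variable {K L : Type*} [Field K] [IsAlgClosed K] [CharZero K] [LieRing L] [LieAlgebra K L]
  [FiniteDimensional K L] (T : LieSubalgebra K L) [LieRing.IsNilpotent T]

lemma traceForm_rat {t : T} (ht : ∀ χ : LieModule.Weight K T L, ∃ r : ℚ, χ t = r) :
    ∃ q : ℚ, 0 ≤ q ∧ LieModule.traceForm K T L t t = q ∧
      (q = 0 → (∀ s, LieModule.traceForm K T L t s = 0) ∧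
        ∀ χ : LieModule.Weight K T L, χ t = 0) := by
  choose r hr using ht
  refine ⟨∑ χ : LieModule.Weight K T L,
    Module.finrank K (LieModule.genWeightSpace L χ) • (r χ * r χ), ?_, ?_, fun h0 => ?_⟩
  · exact Finset.sum_nonneg fun χ _ => nsmul_nonneg (mul_self_nonneg _) _
  · rw [LieModule.traceForm_eq_sum_finrank_nsmul_mul]
    simp [hr]
  · have h2 : ∀ χ : LieModule.Weight K T L, χ t = 0 := by
      intro χ
      have h1 := (Finset.sum_eq_zero_iff_of_nonneg fun χ _ =>
        nsmul_nonneg (mul_self_nonneg (r χ)) _).1 h0 χ (Finset.mem_univ _)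
      rw [smul_eq_zero] at h1
      rcases h1 with h1 | h1
      · have : Module.finrank K (LieModule.genWeightSpace L χ) ≠ 0 := by
          have := χ.2
          intro h
          apply χ.2
          rw [← LieSubmodule.toSubmodule_eq_bot]
          exact Submodule.finrank_eq_zero.1 h
        exact absurd h1 this
      · rw [hr, mul_self_eq_zero.1 h1]; simp
    refine ⟨fun s => ?_, h2⟩
    rw [LieModule.traceForm_eq_sum_finrank_nsmul_mul]
    exact Finset.sum_eq_zero fun χ _ => by rw [h2]; simp

variable {T} (hT : ∀ (ψ : T → K) (x : L), x ∈ rootSpace T ψ → ∀ y : T, ⁅(y : L), x⁆ = ψ y • x)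
  {δ : T → K} {e f : L} {t : T} (hef : (t : L) = ⁅e, f⁆) (he : ∀ s : T, ⁅(s : L), e⁆ = δ s • e)
  (hf : ∀ s : T, ⁅(s : L), f⁆ = -(δ s • f)) (hδ : δ t = 2)

include hef he hf hδ

lemma sl2Ops_ad {V : Type*} [AddCommGroup V] [Module K V] [LieRingModule L V] [LieModule K L V] :
    Sl2Ops (LieModule.toEnd K L V e) (LieModule.toEnd K L V f) (LieModule.toEnd K L V (t : L)) where
  ef v := by
    simp only [LieModule.toEnd_apply_apply]
    rw [leibniz_lie, ← hef, add_comm]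
  he v := by
    simp only [LieModule.toEnd_apply_apply]
    rw [leibniz_lie, he, hδ, smul_lie, add_comm]
  hf v := by
    simp only [LieModule.toEnd_apply_apply]
    rw [leibniz_lie, hf, hδ, neg_lie, smul_lie]; abel

include hT

lemma weight_coroot_int (χ : LieModule.Weight K T L) : ∃ z : ℤ, χ t = z := by
  have ops := sl2Ops_ad hef he hf hδ (V := L)
  obtain ⟨x, hx, hx0⟩ := χ.exists_ne_zero
  obtain ⟨N, hN⟩ := exists_pow_eq_zero (two_ne_zero (α := K)) ops.he
  obtain ⟨M, hM⟩ := exists_pow_eq_zero (E := LieModule.toEnd K L L f) (c := (-2 : K)) (by simp)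
    (fun v => by rw [ops.hf, neg_smul, sub_eq_add_neg])
  exact ops.exists_int (hT _ x hx t) hx0 (N := N) (j := M) (by rw [hN]; rfl) (by rw [hM]; rfl)

lemma traceForm_coroot (he0 : e ≠ 0) : ∃ b : ℚ, 0 < b ∧ ∀ s, LieModule.traceForm K T L t s = b * δ s := by
  have h1 : ∀ s, LieModule.traceForm K T L t s = δ s * LieModule.traceForm K L L e f := by
    intro s
    have : LieModule.traceForm K T L t s = LieModule.traceForm K L L (t : L) (s : L) := rfl
    rw [this, hef, LieModule.traceForm_apply_lie_apply, ← lie_skew, hf, neg_neg, map_smul,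
      smul_eq_mul]
  obtain ⟨q, hq, hq', hq0⟩ := traceForm_rat T (t := t) fun χ => by
    obtain ⟨z, hz⟩ := weight_coroot_int hT hef he hf hδ χ
    exact ⟨z, by rw [hz]; simp⟩
  have h2 : q ≠ 0 := by
    intro h
    have hw : e ∈ rootSpace T δ := by
      rw [LieModule.mem_genWeightSpace]
      refine fun s => ⟨1, ?_⟩
      rw [pow_one, LinearMap.sub_apply, sub_eq_zero]
      exact he s
    have := (hq0 h).2 ⟨δ, fun hb => he0 (by
      have h9 : e ∈ (⊥ : LieSubmodule K T L) := hb ▸ hw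
      simpa using h9)⟩
    change δ t = 0 at this
    rw [hδ] at this
    exact two_ne_zero this
  refine ⟨q / 2, by positivity, fun s => ?_⟩
  have h3 := h1 t
  rw [hδ, hq'] at h3
  rw [h1 s]
  push_cast
  rw [h3]; ring

end Form

end

section

lemma Sl2Ops.eq_zero_of_ef {K V : Type*} [Field K] [CharZero K] [AddCommGroup V] [Module K V]
    {E F H : Module.End K V} (t : Sl2Ops E F H) {v : V} {k : ℕ} (hk : 0 < k)
    (hv : H v = (k : K) • v) {N : ℕ} (hN : (E ^ N) v = 0) (hEF : E (F v) = 0) : v = 0 := by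
  induction N with
  | zero => simpa using hN
  | succ N ih =>
    apply ih
    have h1 := t.pow_e_f N v
    rw [hN, map_zero, zero_add, pow_succ, Module.End.mul_apply, hEF, map_zero, hv, ← add_smul,
      map_smul, smul_smul] at h1
    refine (smul_eq_zero.1 h1.symm).resolve_left ?_
    have : ((N : K) + 1) * (k + N) = (((N + 1) * (k + N) : ℕ) : K) := by push_cast; ring
    rw [this]; refine Nat.cast_ne_zero.2 ?_
    positivity

namespace Setup

open LieAlgebra

variable {K : Type} [Field K] [IsAlgClosed K] [CharZero K]
variable {g : Type} [LieRing g] [LieAlgebra K g] (S : Setup K g)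

/-- roots which have a coroot. -/
def Good (α : Module.Dual K S.h) : Prop := ∃ H, S.IsCoroot α H

/-- `x`, `y`, `H` form an `sl₂`-triple spanning the root spaces of `α` and `-α`. -/
structure Triple (α : Module.Dual K S.h) (x y : g) (H : S.h) : Prop where
  hx : x ∈ S.gw α
  hy : y ∈ S.gw (-α)
  lie : (H : g) = ⁅x, y⁆
  two : α H = 2
  x_rad : x ∉ S.rad
  y_rad : y ∉ S.rad
  x_gen : ∀ x' ∈ S.gw α, ∃ c : K, x' = c • x
  y_gen : ∀ y' ∈ S.gw (-α), ∃ c : K, y' = c • y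

variable {S} {α : Module.Dual K S.h}

lemma IsCoroot.exists_triple {H : S.h} (hc : S.IsCoroot α H) : ∃ x y, S.Triple α x y H := by
  obtain ⟨x, hx, hxR, ⟨y, hy, hxy⟩, hg⟩ := hc.exists_gen
  have hyR : y ∉ S.rad := hc.neg.notMem_rad_of_lie hy (y := x) (by rw [← lie_skew, ← hxy]; rfl)
  refine ⟨x, y, hx, hy, hxy, hc.1, hxR, hyR, hg, ?_⟩
  obtain ⟨y₀, -, -, -, hg'⟩ := hc.neg.exists_gen
  obtain ⟨c, hc'⟩ := hg' y hy
  have hc0 : c ≠ 0 := by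
    rintro rfl
    rw [zero_smul] at hc'
    exact hyR (hc' ▸ zero_mem S.rad)
  intro y' hy'
  obtain ⟨d, hd⟩ := hg' y' hy'
  exact ⟨d * c⁻¹, by rw [hd, hc', smul_smul, mul_assoc, inv_mul_cancel₀ hc0, mul_one]⟩

lemma Good.exists_triple (h : S.Good α) : ∃ (x y : g) (H : S.h), S.Triple α x y H := by
  obtain ⟨H, hc⟩ := h
  obtain ⟨x, y, t⟩ := hc.exists_triple
  exact ⟨x, y, H, t⟩

open Classical in
/-- the chosen root vector. -/
def ev (S : Setup K g) (α : Module.Dual K S.h) : g :=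
  if h : S.Good α then h.exists_triple.choose else 0

open Classical in
/-- the chosen opposite root vector. -/
def fv (S : Setup K g) (α : Module.Dual K S.h) : g :=
  if h : S.Good α then h.exists_triple.choose_spec.choose else 0

open Classical in
/-- the coroot. -/
def cr (S : Setup K g) (α : Module.Dual K S.h) : S.h :=
  if h : S.Good α then h.exists_triple.choose_spec.choose_spec.choose else 0

lemma Good.triple (h : S.Good α) : S.Triple α (S.ev α) (S.fv α) (S.cr α) := by
  rw [ev, fv, cr, dif_pos h, dif_pos h, dif_pos h]
  exact h.exists_triple.choose_spec.choose_spec.choose_spec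

namespace Triple

variable {x y : g} {H : S.h} (t : S.Triple α x y H)
include t

lemma isCoroot : S.IsCoroot α H := ⟨t.two, x, t.hx, y, t.hy, t.lie⟩

lemma good : S.Good α := ⟨H, t.isCoroot⟩

lemma ne_zero : α ≠ 0 := t.isCoroot.ne_zero

lemma x_ne_zero : x ≠ 0 := fun h => t.x_rad (h ▸ zero_mem S.rad)

lemma isRootOf : IsRootOf K g S.h α :=
  ⟨t.ne_zero, fun h => t.x_ne_zero ((Submodule.mem_bot K).1 (h ▸ t.hx))⟩

lemma symm : S.Triple (-α) y x (-H) where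
  hx := t.hy
  hy := by rw [neg_neg]; exact t.hx
  lie := by rw [← lie_skew, ← t.lie]; rfl
  two := by simp [t.two]
  x_rad := t.y_rad
  y_rad := t.x_rad
  x_gen := t.y_gen
  y_gen := by rw [neg_neg]; exact t.x_gen

lemma lie_h_x : ⁅(H : g), x⁆ = (2 : K) • x := by rw [t.hx H, t.two]

lemma lie_h_y : ⁅(H : g), y⁆ = -((2 : K) • y) := by
  rw [t.hy H, LinearMap.neg_apply, t.two, neg_smul]

/-- the operators of the triple on a module. -/
lemma ops (V : Type*) [AddCommGroup V] [Module K V] [LieRingModule g V] [LieModule K g V] :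
    Sl2Ops (LieModule.toEnd K g V x) (LieModule.toEnd K g V y)
      (LieModule.toEnd K g V (H : g)) where
  ef v := by
    simp only [LieModule.toEnd_apply_apply]
    rw [leibniz_lie, ← t.lie, add_comm]
  he v := by
    simp only [LieModule.toEnd_apply_apply]
    rw [leibniz_lie, t.lie_h_x, smul_lie, add_comm]
  hf v := by
    simp only [LieModule.toEnd_apply_apply]
    rw [leibniz_lie, t.lie_h_y, neg_lie, smul_lie]; abel

lemma unique {x' y' : g} {H' : S.h} (t' : S.Triple α x' y' H') : H' = H := by
  obtain ⟨c, hc⟩ := t.x_gen x' t'.hx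
  obtain ⟨d, hd⟩ := t.y_gen y' t'.hy
  have h1 : H' = (c * d) • H := Subtype.ext (by
    rw [t'.lie, hc, hd, smul_lie, lie_smul, ← t.lie, smul_smul]; rfl)
  have h2 := t'.two
  rw [h1, map_smul, t.two, smul_eq_mul] at h2
  rw [h1, mul_right_cancel₀ (two_ne_zero (α := K)) (h2.trans (one_mul 2).symm), one_smul]

end Triple

/-- root vectors act locally nilpotently. -/
lemma exists_pow_ad_eq_zero (hα : α ≠ 0) {x : g} (hx : x ∈ S.gw α) (z : g) :
    ∃ N : ℕ, (LieModule.toEnd K g g x ^ N) z = 0 := by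
  obtain ⟨H, hH⟩ : ∃ H, α H ≠ 0 := by
    by_contra! h'
    exact hα (LinearMap.ext h')
  obtain ⟨n, h1, h2, h3⟩ := ((S.eventually_mem x).and
    ((S.eventually_mem z).and (S.eventually_mem H))).exists
  have key : ∀ (N : ℕ) (w : S.F n),
      (((LieModule.toEnd K (S.F n) (S.F n) ⟨x, h1⟩ ^ N) w : S.F n) : g) =
        (LieModule.toEnd K g g x ^ N) (w : g) := by
    intro N
    induction N with
    | zero => intro w; simp
    | succ N ih => intro w; rw [pow_succ, pow_succ]; exact ih _
  obtain ⟨N, hN⟩ := exists_pow_eq_zero (E := LieModule.toEnd K (S.F n) (S.F n) ⟨x, h1⟩)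
    (H := LieModule.toEnd K (S.F n) (S.F n) ⟨H, h3⟩) hH (fun v => by
      simp only [LieModule.toEnd_apply_apply]
      rw [leibniz_lie, add_comm]
      congr 1
      have : ⁅(⟨H, h3⟩ : S.F n), (⟨x, h1⟩ : S.F n)⁆ = α H • ⟨x, h1⟩ := Subtype.ext (hx H)
      rw [this, smul_lie])
  exact ⟨N, by rw [← key N ⟨z, h2⟩, hN]; rfl⟩

variable {x y : g} {H : S.h} {β : Module.Dual K S.h}

lemma Triple.eq_zero_of_lie_lie (t : S.Triple α x y H) {k : ℕ} (hk : 0 < k) (hβ : β H = k)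
    {v : g} (hv : v ∈ S.gw β) (h0 : ⁅x, ⁅y, v⁆⁆ = 0) : v = 0 := by
  obtain ⟨N, hN⟩ := exists_pow_ad_eq_zero t.ne_zero t.hx v
  exact (t.ops g).eq_zero_of_ef hk ((hv H).trans (by rw [hβ])) hN h0

/-- coroots are integral on roots. -/
lemma Triple.exists_int (t : S.Triple α x y H) (hβ : S.gw β ≠ ⊥) : ∃ z : ℤ, β H = z := by
  obtain ⟨v, hv, hv0⟩ := Submodule.exists_mem_ne_zero_of_ne_bot hβ
  obtain ⟨N, hN⟩ := exists_pow_ad_eq_zero t.ne_zero t.hx v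
  obtain ⟨M, hM⟩ := exists_pow_ad_eq_zero t.symm.ne_zero t.hy v
  exact (t.ops g).exists_int (hv H) hv0 hN hM

/-- lowering a good root by a triple gives a vector outside the radical. -/
lemma Triple.lie_notMem_rad (t : S.Triple α x y H) {x' y' : g} {H' : S.h}
    (t' : S.Triple β x' y' H') {k : ℕ} (hk : 0 < k) (hβ : β H = k) : ⁅y, x'⁆ ∉ S.rad := by
  intro hR
  have h1 : ⁅x, ⁅y, x'⁆⁆ ∈ S.rad := S.rad.lie_mem hR
  have h2 : ⁅x, ⁅y, x'⁆⁆ ∈ S.gw β := by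
    have := S.lie_mem_gw t.hx (S.lie_mem_gw t.hy t'.hx)
    rwa [add_neg_cancel_left] at this
  obtain ⟨c, hc⟩ := t'.x_gen _ h2
  by_cases hc0 : c = 0
  · rw [hc0, zero_smul] at hc
    exact t'.x_ne_zero (t.eq_zero_of_lie_lie hk hβ t'.hx hc)
  · apply t'.x_rad
    have : x' = c⁻¹ • ⁅x, ⁅y, x'⁆⁆ := by rw [hc, smul_smul, inv_mul_cancel₀ hc0, one_smul]
    rw [this]
    exact S.rad.smul_mem _ h1

lemma good_of_notMem_rad (hα : α ≠ 0) (hx : x ∈ S.gw α) (hR : x ∉ S.rad) : S.Good α := by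
  obtain ⟨y, hy, H, h1, h2⟩ := S.exists_triple_of_notMem_rad hα hx hR
  exact ⟨H, h2, x, hx, y, hy, h1⟩

lemma Good.neg (h : S.Good α) : S.Good (-α) := h.triple.symm.good

/-- a common finite level: coroots of finitely many roots are proportional to trace duals. -/
lemma exists_trace_level (A : Finset (Module.Dual K S.h)) (hA : ∀ α ∈ A, S.Good α)
    {p : ℕ → Prop} (hp : ∀ᶠ n in Filter.atTop, p n) :
    ∃ n, p n ∧ ∀ α ∈ A, ∃ t : S.T n, ((t : S.F n) : g) = S.cr α ∧
      (∃ b : ℚ, 0 < b ∧ ∀ s, LieModule.traceForm K (S.T n) (S.F n) t s = b * S.resT n α s) ∧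
      ∀ χ : LieModule.Weight K (S.T n) (S.F n), ∃ z : ℤ, χ t = z := by
  have h1 : ∀ᶠ n in Filter.atTop, ∀ α ∈ A, S.ev α ∈ S.F n ∧ S.fv α ∈ S.F n ∧ (S.cr α : g) ∈ S.F n := by
    rw [Filter.eventually_all_finset]
    intro α _
    exact (S.eventually_mem _).and ((S.eventually_mem _).and (S.eventually_mem _))
  obtain ⟨n, hn, hpn⟩ := (h1.and hp).exists
  refine ⟨n, hpn, fun α hα => ?_⟩
  obtain ⟨he, hf, hc⟩ := hn α hα
  have t := (hA α hα).triple
  let t' : S.T n := ⟨⟨S.cr α, hc⟩, (S.cr α).2, hc⟩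
  have hT : ∀ (ψ : S.T n → K) (x : S.F n), x ∈ rootSpace (S.T n) ψ →
      ∀ y : S.T n, ⁅(y : S.F n), x⁆ = ψ y • x := fun ψ x hx y =>
    cartan_lie_eq_smul (S.F_reductive n) (S.T n) hx y
  have hef : (t' : S.F n) = ⁅(⟨S.ev α, he⟩ : S.F n), (⟨S.fv α, hf⟩ : S.F n)⁆ := Subtype.ext t.lie
  have hhe : ∀ s : S.T n, ⁅(s : S.F n), (⟨S.ev α, he⟩ : S.F n)⁆ = S.resT n α s • ⟨S.ev α, he⟩ :=
    fun s => Subtype.ext (t.hx ⟨s, s.2.1⟩)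
  have hhf : ∀ s : S.T n, ⁅(s : S.F n), (⟨S.fv α, hf⟩ : S.F n)⁆ = -(S.resT n α s • ⟨S.fv α, hf⟩) :=
    fun s => Subtype.ext ((t.hy ⟨s, s.2.1⟩).trans (by rw [LinearMap.neg_apply, neg_smul]; rfl))
  refine ⟨t', rfl, ?_, fun χ => weight_coroot_int hT hef hhe hhf t.two χ⟩
  exact traceForm_coroot hT hef hhe hhf t.two fun h => t.x_ne_zero (congrArg Subtype.val h)

lemma resT_apply (n : ℕ) (t : S.T n) (H : S.h) (h : ((t : S.F n) : g) = H) :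
    S.resT n α t = α H := by
  unfold resT
  congr 1
  exact Subtype.ext h

/-- a nonzero sum of good roots is positive on the coroot of one of them. -/
lemma exists_pos_of_sum_ne_zero (s : Multiset (Module.Dual K S.h)) (hs : ∀ δ ∈ s, S.Good δ)
    (h0 : s.sum ≠ 0) : ∃ δ ∈ s, ∃ k : ℕ, 0 < k ∧ s.sum (S.cr δ) = k := by
  classical
  obtain ⟨n, hn, hA⟩ := exists_trace_level s.toFinset (fun α h => hs α (Multiset.mem_toFinset.1 h))
    (S.eventually_resT_ne_zero h0)
  choose! t ht hb hz using hA
  choose! b hb0 hb using hb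
  simp only [Multiset.mem_toFinset] at ht hb hz hb0
  have hz' : ∀ δ ∈ s, ∃ z : ℤ, s.sum (S.cr δ) = z := by
    intro δ hδ
    have : ∀ u : Multiset (Module.Dual K S.h), u ≤ s → ∃ z : ℤ, u.sum (S.cr δ) = z := by
      intro u
      induction u using Multiset.induction_on with
      | empty => exact fun _ => ⟨0, by simp⟩
      | cons a u ih =>
        intro hu
        obtain ⟨z, hz⟩ := ih ((Multiset.le_cons_self u a).trans hu)
        obtain ⟨z', hz'⟩ := (hs δ hδ).triple.exists_int
          (hs a (Multiset.mem_of_le hu (Multiset.mem_cons_self a u))).triple.isRootOf.2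
        exact ⟨z' + z, by rw [Multiset.sum_cons, LinearMap.add_apply, hz, hz']; push_cast; rfl⟩
    exact this s le_rfl
  by_contra! hneg
  have hle : ∀ δ ∈ s, ∃ z : ℤ, z ≤ 0 ∧ s.sum (S.cr δ) = z := by
    intro δ hδ
    obtain ⟨z, hzz⟩ := hz' δ hδ
    refine ⟨z, ?_, hzz⟩
    by_contra! hpos
    refine hneg δ hδ z.toNat (by omega) ?_
    rw [hzz]
    exact_mod_cast (Int.toNat_of_nonneg hpos.le).symm
  choose! z hz0 hzz using hle
  let τ : S.T n := (s.map fun δ => ((b δ)⁻¹ : K) • t δ).sum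
  let σ : S.T n →ₗ[K] K :=
    { toFun := S.resT n s.sum
      map_add' := fun a b => LinearMap.map_add s.sum ⟨((a : S.F n) : g), a.2.1⟩ ⟨((b : S.F n) : g), b.2.1⟩
      map_smul' := fun c a => LinearMap.map_smul s.sum c ⟨((a : S.F n) : g), a.2.1⟩ }
  have hres : ∀ (u : Multiset (Module.Dual K S.h)) x,
      S.resT n u.sum x = (u.map fun δ => S.resT n δ x).sum := by
    intro u x
    induction u using Multiset.induction_on with
    | empty => simp [resT]
    | cons a u ih =>
      rw [Multiset.sum_cons, Multiset.map_cons, Multiset.sum_cons, ← ih]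
      rfl
  have hτ : ∀ x, LieModule.traceForm K (S.T n) (S.F n) τ x = S.resT n s.sum x := by
    intro x
    rw [hres]
    have : LieModule.traceForm K (S.T n) (S.F n) τ x =
        ((LieModule.traceForm K (S.T n) (S.F n)).flip x) τ := rfl
    rw [this, map_multiset_sum, Multiset.map_map]
    congr 1
    refine Multiset.map_congr rfl fun δ hδ => ?_
    simp only [Function.comp_apply, map_smul, smul_eq_mul]
    have : (b δ : K) ≠ 0 := by exact_mod_cast (hb0 δ hδ).ne'
    field_simp
    exact hb δ hδ x
  have hrat : ∀ χ : LieModule.Weight K (S.T n) (S.F n), ∃ r : ℚ, χ τ = r := by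
    intro χ
    have hχ : ∀ u : Multiset (Module.Dual K S.h), u ≤ s →
        ∃ r : ℚ, χ ((u.map fun δ => ((b δ)⁻¹ : K) • t δ).sum) = r := by
      intro u
      induction u using Multiset.induction_on with
      | empty => exact fun _ => ⟨0, by simp⟩
      | cons a u ih =>
        intro hu
        obtain ⟨r, hr⟩ := ih ((Multiset.le_cons_self u a).trans hu)
        obtain ⟨w, hw⟩ := hz a (Multiset.mem_of_le hu (Multiset.mem_cons_self a u)) χ
        refine ⟨(b a)⁻¹ * w + r, ?_⟩
        rw [Multiset.map_cons, Multiset.sum_cons]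
        have := (LieModule.Weight.toLinear K (S.T n) (S.F n) χ).map_add (((b a)⁻¹ : K) • t a)
          (u.map fun δ => ((b δ)⁻¹ : K) • t δ).sum
        rw [map_smul] at this
        simp only [LieModule.Weight.toLinear_apply] at this
        rw [this, hr, hw, smul_eq_mul]
        push_cast; rfl
    exact hχ s le_rfl
  obtain ⟨q, hq0, hq, hq'⟩ := traceForm_rat (S.T n) hrat
  have hq2 : q ≤ 0 := by
    have h1 : ∀ u : Multiset (Module.Dual K S.h), u ≤ s →
        ∃ r : ℚ, r ≤ 0 ∧ σ ((u.map fun δ => ((b δ)⁻¹ : K) • t δ).sum) = r := by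
      intro u
      induction u using Multiset.induction_on with
      | empty => exact fun _ => ⟨0, le_rfl, by simp⟩
      | cons a u ih =>
        intro hu
        have has := Multiset.mem_of_le hu (Multiset.mem_cons_self a u)
        obtain ⟨r, hr0, hr⟩ := ih ((Multiset.le_cons_self u a).trans hu)
        refine ⟨(b a)⁻¹ * z a + r, ?_, ?_⟩
        · have h1 : (0 : ℚ) < (b a)⁻¹ := inv_pos.2 (hb0 a has)
          have h2 : (z a : ℚ) ≤ 0 := by exact_mod_cast hz0 a has
          nlinarith [mul_nonneg h1.le (neg_nonneg.2 h2)]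
        · rw [Multiset.map_cons, Multiset.sum_cons, map_add, map_smul, hr]
          have h3 : σ (t a) = z a := (resT_apply n (t a) (S.cr a) (ht a has)).trans (hzz a has)
          rw [h3, smul_eq_mul]
          push_cast; rfl
    obtain ⟨r, hr0, hr⟩ := h1 s le_rfl
    have h2 : (q : K) = r := by rw [← hq, hτ]; exact hr
    rw [Rat.cast_injective h2]
    exact hr0
  refine hn (funext fun x => ?_)
  rw [← hτ, (hq' (le_antisymm hq2 hq0)).1 x]; rfl

end Setup

end

section

section WeightComponents

variable {K V X I : Type*} [Field K] [AddCommGroup V] [Module K V] {op : X → Module.End K V}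
  {wt : I → X → K}

/-- A stable subspace contains the components of its elements. -/
lemma mem_of_sum_mem (hwt : Function.Injective wt) {N : Submodule K V}
    (hN : ∀ H, ∀ v ∈ N, op H v ∈ N) (s : Finset I) :
    ∀ v : I → V, (∀ i ∈ s, ∀ H, op H (v i) = wt i H • v i) → ∑ i ∈ s, v i ∈ N →
      ∀ i ∈ s, v i ∈ N := by
  classical
  induction s using Finset.strongInduction with
  | H s ih =>
    intro v hv hs i hi
    by_cases h1 : ∃ j ∈ s, j ≠ i
    · obtain ⟨j, hj, hji⟩ := h1
      obtain ⟨H, hH⟩ : ∃ H, wt i H ≠ wt j H := by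
        by_contra! h'
        exact hji (hwt (funext h')).symm
      have h2 := ih (s.erase j) (Finset.erase_ssubset hj) (fun k => (wt k H - wt j H) • v k) ?_ ?_ i
        (Finset.mem_erase.2 ⟨hji.symm, hi⟩)
      · have := N.smul_mem (wt i H - wt j H)⁻¹ h2
        rwa [smul_smul, inv_mul_cancel₀ (sub_ne_zero.2 hH), one_smul] at this
      · intro k hk H'
        rw [map_smul, hv k (Finset.mem_of_mem_erase hk), smul_comm]
      · have h3 := N.sub_mem (hN H _ hs) (N.smul_mem (wt j H) hs)
        have h4 : op H (∑ k ∈ s, v k) - wt j H • ∑ k ∈ s, v k =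
            ∑ k ∈ s.erase j, (wt k H - wt j H) • v k := by
          rw [Finset.sum_erase _ (by simp), map_sum, Finset.smul_sum, ← Finset.sum_sub_distrib]
          exact Finset.sum_congr rfl fun k hk => by rw [hv k hk, sub_smul]
        rwa [h4] at h3
    · push Not at h1
      have : s = {i} := Finset.eq_singleton_iff_unique_mem.2 ⟨hi, h1⟩
      rwa [this, Finset.sum_singleton] at hs

/-- A vector of weight `i` lying in a stable subspace plus the sum of other weight spaces lies in
the stable subspace. -/
lemma mem_of_mem_sup (hwt : Function.Injective wt) {N : Submodule K V}
    (hN : ∀ H, ∀ v ∈ N, op H v ∈ N) (W : I → Submodule K V)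
    (hW : ∀ i, ∀ v ∈ W i, ∀ H, op H v = wt i H • v) {A : Set I} {i : I} (hi : i ∉ A) {x : V}
    (hx : x ∈ W i) (hxN : x ∈ N ⊔ ⨆ j ∈ A, W j) : x ∈ N := by
  classical
  obtain ⟨n, hn, y, hy, rfl⟩ := Submodule.mem_sup.1 hxN
  obtain ⟨f, hf, rfl⟩ := (Submodule.mem_iSup_iff_exists_finsupp _ _).1 hy
  have hfi : f i = 0 := by
    have := hf i
    rw [iSup_neg hi] at this
    simpa using this
  have hf' : ∀ j, f j ∈ W j := by
    intro j
    by_cases h : j ∈ A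
    · have := hf j
      rwa [iSup_pos h] at this
    · have := hf j
      rw [iSup_neg h] at this
      rw [(Submodule.mem_bot K).1 this]
      exact zero_mem _
  have hni : i ∉ f.support := by simp [hfi]
  have h1 := mem_of_sum_mem hwt hN (insert i f.support)
    (fun j => if j = i then n + f.sum (fun _ v => v) else - f j) ?_ ?_ i (Finset.mem_insert_self _ _)
  · simpa using h1
  · intro j _ H
    split_ifs with h
    · rw [h]; exact hW i _ hx H
    · rw [map_neg, hW j _ (hf' j), smul_neg]
  · rw [Finset.sum_insert hni, if_pos rfl]
    have h2 : ∑ j ∈ f.support, (if j = i then n + f.sum (fun _ v => v) else - f j) =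
        - f.sum (fun _ v => v) := by
      rw [Finsupp.sum, ← Finset.sum_neg_distrib]
      exact Finset.sum_congr rfl fun j hj => if_neg fun h : j = i => hni (h ▸ hj)
    rw [h2, add_neg_cancel_right]
    exact hn

end WeightComponents

namespace Setup

open LieAlgebra

variable {K : Type} [Field K] [IsAlgClosed K] [CharZero K]
variable {g : Type} [LieRing g] [LieAlgebra K g] {S : Setup K g}

/-- A root vector lying in a stable subspace plus other root spaces lies in the subspace. -/
lemma mem_of_mem_gw_sup {N : Submodule K g} (hN : ∀ H : S.h, ∀ v ∈ N, ⁅(H : g), v⁆ ∈ N)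
    {A : Set (Module.Dual K S.h)} {α : Module.Dual K S.h} (hα : α ∉ A) {x : g} (hx : x ∈ S.gw α)
    (hxN : x ∈ N ⊔ ⨆ β ∈ A, S.gw β) : x ∈ N :=
  mem_of_mem_sup (op := fun H : S.h => (LieModule.toEnd K g g (H : g) : Module.End K g))
    (wt := fun (β : Module.Dual K S.h) H => β H) DFunLike.coe_injective hN S.gw
    (fun _ _ hv H => hv H) hα hx hxN

variable {α β γ δ : Module.Dual K S.h}

lemma gw_eq_bot (h0 : α ≠ 0) (h : ¬ IsRootOf K g S.h α) : S.gw α = ⊥ := by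
  by_contra h'
  exact h ⟨h0, h'⟩

lemma Good.isRootOf (h : S.Good α) : IsRootOf K g S.h α := h.triple.isRootOf

lemma zero_notMem_pos : (0 : Module.Dual K S.h) ∉ S.pos := fun h => (S.pos_root 0 h).1 rfl

lemma neg_notMem_pos (h : α ∈ S.pos) : -α ∉ S.pos := (S.pos_polar α (S.pos_root α h)).1 h

lemma add_ne_zero_of_pos (ha : α ∈ S.pos) (hb : β ∈ S.pos) : α + β ≠ 0 := fun h =>
  neg_notMem_pos ha ((neg_eq_of_add_eq_zero_right h) ▸ hb)

lemma IsSimpleRoot.not_add (h : S.IsSimpleRoot α) (hb : β ∈ S.pos) (hc : γ ∈ S.pos) :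
    α ≠ β + γ := fun h' => h.2 ⟨{β, γ}, by simp, by simp [hb, hc], by simp [h']⟩

/-- the difference of two distinct simple roots is not a root. -/
lemma IsSimpleRoot.gw_sub (h : S.IsSimpleRoot α) (h' : S.IsSimpleRoot β) (hne : α ≠ β) :
    S.gw (α - β) = ⊥ := by
  refine gw_eq_bot (sub_ne_zero.2 hne) fun hr => ?_
  by_cases hp : α - β ∈ S.pos
  · exact h.not_add h'.1 hp (by abel)
  · have h1 : -(α - β) ∈ S.pos := by
      by_contra h2; exact hp ((S.pos_polar _ hr).2 h2)
    exact h'.not_add h.1 h1 (by abel)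

/-- a subset of weights closed under addition spans a subalgebra. -/
def wtSubalgebra (S : Setup K g) (P : Set (Module.Dual K S.h))
    (hP : ∀ α ∈ P, ∀ β ∈ P, α + β ∈ P ∨ S.gw (α + β) = ⊥) : LieSubalgebra K g where
  toSubmodule := ⨆ α ∈ P, S.gw α
  lie_mem' := by
    intro x y hx hy
    change x ∈ ⨆ α ∈ P, S.gw α at hx
    change y ∈ ⨆ α ∈ P, S.gw α at hy
    change ⁅x, y⁆ ∈ ⨆ α ∈ P, S.gw α
    have h1 : ∀ α ∈ P, ∀ x ∈ S.gw α, (⨆ β ∈ P, S.gw β) ≤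
        (⨆ α ∈ P, S.gw α).comap (LieModule.toEnd K g g x : g →ₗ[K] g) := by
      intro α hα x hx
      refine iSup₂_le fun β hβ y hy => ?_
      change ⁅x, y⁆ ∈ ⨆ α ∈ P, S.gw α
      have h2 := S.lie_mem_gw hx hy
      rcases hP α hα β hβ with h | h
      · exact (le_iSup₂ (f := fun α (_ : α ∈ P) => S.gw α) _ h) h2
      · rw [h, Submodule.mem_bot] at h2
        rw [h2]; exact zero_mem _
    have h2 : (⨆ α ∈ P, S.gw α) ≤
        (⨆ α ∈ P, S.gw α).comap (LieModule.toEnd K g g y : g →ₗ[K] g) := by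
      refine iSup₂_le fun α hα x hx => ?_
      change ⁅y, x⁆ ∈ ⨆ α ∈ P, S.gw α
      rw [← lie_skew]
      exact neg_mem (h1 α hα x hx hy)
    rw [← lie_skew]
    exact neg_mem (h2 hx)

lemma pos_closed : ∀ α ∈ S.pos, ∀ β ∈ S.pos, α + β ∈ S.pos ∨ S.gw (α + β) = ⊥ := by
  intro α hα β hβ
  by_cases h : IsRootOf K g S.h (α + β)
  · exact .inl (S.pos_add α hα β hβ h)
  · exact .inr (gw_eq_bot (add_ne_zero_of_pos hα hβ) h)

/-- a set of positive elements whose simple root spaces all meet a condition or lie in an ideal. -/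
lemma exists_simple_sum (hD : S.IsDynkin) {p : Module.Dual K S.h → Prop} (N : LieIdeal K g)
    (hp : ∀ δ, S.IsSimpleRoot δ → ¬ p δ → S.gw δ ≤ N.toSubmodule) (hγ : γ ∈ S.pos) {x : g}
    (hx : x ∈ S.gw γ) (hxN : x ∉ N) :
    ∃ s : Multiset (Module.Dual K S.h), (∀ δ ∈ s, S.IsSimpleRoot δ ∧ p δ) ∧ s.sum = γ := by
  let P : Set (Module.Dual K S.h) :=
    {γ | ∃ s : Multiset (Module.Dual K S.h), (∀ δ ∈ s, S.IsSimpleRoot δ ∧ p δ) ∧ s.sum = γ}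
  have hP0 : (0 : Module.Dual K S.h) ∈ P := ⟨0, by simp, rfl⟩
  have hP : ∀ α ∈ P, ∀ β ∈ P, α + β ∈ P ∨ S.gw (α + β) = ⊥ := by
    rintro _ ⟨s, hs, rfl⟩ _ ⟨t, ht, rfl⟩
    refine .inl ⟨s + t, fun δ hδ => ?_, Multiset.sum_add _ _⟩
    rcases Multiset.mem_add.1 hδ with h | h
    exacts [hs δ h, ht δ h]
  let Q : LieSubalgebra K g :=
    { toSubmodule := N.toSubmodule ⊔ (S.wtSubalgebra P hP).toSubmodule
      lie_mem' := by
        intro x y hx hy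
        obtain ⟨n, hn, u, hu, rfl⟩ := Submodule.mem_sup.1 hx
        obtain ⟨m, hm, w, hw, rfl⟩ := Submodule.mem_sup.1 hy
        rw [add_lie, lie_add]
        refine Submodule.add_mem _ (Submodule.mem_sup_left ?_) ?_
        · have h1 : ⁅n, m⁆ ∈ N := N.lie_mem hm
          have h2 : ⁅n, w⁆ ∈ N := by rw [← lie_skew]; exact neg_mem (N.lie_mem hn)
          exact add_mem h1 h2
        · rw [lie_add]
          exact Submodule.add_mem _ (Submodule.mem_sup_left (N.lie_mem hm))
            (Submodule.mem_sup_right ((S.wtSubalgebra P hP).lie_mem hu hw)) }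
  have hbQ : S.b ≤ Q := by
    rw [hD, LieSubalgebra.lieSpan_le]
    rintro y (hy | hy)
    · refine Submodule.mem_sup_right ?_
      change y ∈ ⨆ α ∈ P, S.gw α
      refine (le_iSup₂ (f := fun α (_ : α ∈ P) => S.gw α) _ hP0) ?_
      rw [S.gw_zero]; exact hy
    · simp only [Set.mem_iUnion] at hy
      obtain ⟨δ, hδ, hy⟩ := hy
      by_cases h : p δ
      · refine Submodule.mem_sup_right ?_
        change y ∈ ⨆ α ∈ P, S.gw α
        refine (le_iSup₂ (f := fun α (_ : α ∈ P) => S.gw α) δ ?_) hy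
        exact ⟨{δ}, fun ε hε => by rw [Multiset.mem_singleton.1 hε]; exact ⟨hδ, h⟩, by simp⟩
      · exact Submodule.mem_sup_left (hp δ hδ h hy)
  have hxb : x ∈ S.b := by
    have : x ∈ S.b.toSubmodule := by
      rw [S.b_eq]
      exact Submodule.mem_sup_right
        ((le_iSup₂ (f := fun α (_ : α ∈ S.pos) => adWeightSpace K g S.h α) γ hγ) hx)
    exact this
  by_contra hs
  exact hxN (mem_of_mem_gw_sup (N := N.toSubmodule) (fun H v hv => N.lie_mem hv) (A := P) hs hx
    (hbQ hxb))

/-- the root space of a sum of good roots is generated by the root spaces of the summands. -/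
lemma gw_le_of_sum (Q : LieSubalgebra K g) (s : Multiset (Module.Dual K S.h))
    (hs : ∀ δ ∈ s, S.Good δ) (hQ : ∀ δ ∈ s, S.gw δ ≤ Q.toSubmodule) (h : S.Good s.sum) :
    S.gw s.sum ≤ Q.toSubmodule := by
  classical
  induction hn : Multiset.card s generalizing s with
  | zero =>
    rw [Multiset.card_eq_zero.1 hn] at h
    exact absurd rfl h.triple.ne_zero
  | succ n ih =>
    obtain ⟨δ, hδ, k, hk, hk'⟩ := exists_pos_of_sum_ne_zero s hs h.triple.ne_zero
    have t := (hs δ hδ).triple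
    have hsum : δ + (s.erase δ).sum = s.sum := Multiset.sum_erase hδ
    by_cases h0 : (s.erase δ).sum = 0
    · rw [← hsum, h0, add_zero]; exact hQ δ hδ
    have hmem : ⁅S.fv δ, S.ev s.sum⁆ ∈ S.gw (s.erase δ).sum := by
      have := S.lie_mem_gw t.hy h.triple.hx
      rwa [show -δ + s.sum = (s.erase δ).sum by rw [← hsum, neg_add_cancel_left]] at this
    have hg : S.Good (s.erase δ).sum :=
      good_of_notMem_rad h0 hmem (t.lie_notMem_rad h.triple hk hk')
    have h1 := ih (s.erase δ) (fun ε hε => hs ε (Multiset.mem_of_mem_erase hε))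
      (fun ε hε => hQ ε (Multiset.mem_of_mem_erase hε)) hg
      (by rw [Multiset.card_erase_of_mem hδ, hn]; rfl) hmem
    have h2 : ⁅S.ev δ, ⁅S.fv δ, S.ev s.sum⁆⁆ ∈ S.gw s.sum := by
      have := S.lie_mem_gw t.hx (S.lie_mem_gw t.hy h.triple.hx)
      rwa [add_neg_cancel_left] at this
    obtain ⟨c, hc⟩ := h.triple.x_gen _ h2
    have hc0 : c ≠ 0 := by
      rintro rfl
      rw [zero_smul] at hc
      exact h.triple.x_ne_zero (t.eq_zero_of_lie_lie hk hk' h.triple.hx hc)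
    intro x hx
    obtain ⟨d, hd⟩ := h.triple.x_gen x hx
    have h3 : x = (d * c⁻¹) • ⁅S.ev δ, ⁅S.fv δ, S.ev s.sum⁆⁆ := by
      rw [hc, smul_smul, mul_assoc, inv_mul_cancel₀ hc0, mul_one, hd]
    rw [h3]
    exact Q.smul_mem _ (Q.lie_mem (hQ δ hδ t.hx) h1)

lemma gw_neg_le_of_sum (Q : LieSubalgebra K g) (s : Multiset (Module.Dual K S.h))
    (hs : ∀ δ ∈ s, S.Good δ) (hQ : ∀ δ ∈ s, S.gw (-δ) ≤ Q.toSubmodule) (h : S.Good s.sum) :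
    S.gw (-s.sum) ≤ Q.toSubmodule := by
  have hs' : (s.map Neg.neg).sum = -s.sum := by
    rw [Multiset.sum_map_neg, Multiset.map_id']
  rw [← hs']
  refine gw_le_of_sum Q _ ?_ ?_ ?_
  · intro δ hδ
    obtain ⟨ε, hε, rfl⟩ := Multiset.mem_map.1 hδ
    exact (hs ε hε).neg
  · intro δ hδ
    obtain ⟨ε, hε, rfl⟩ := Multiset.mem_map.1 hδ
    exact hQ ε hε
  · rw [hs']; exact h.neg

end Setup

end

section

namespace Setup

open LieAlgebra

variable {K : Type} [Field K] [IsAlgClosed K] [CharZero K]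
variable {g : Type} [LieRing g] [LieAlgebra K g] {S : Setup K g}
variable {α β γ δ : Module.Dual K S.h}

lemma gw_le_top_sup : (⨆ α ∈ S.pos, S.gw α) ⊔ (S.h.toSubmodule ⊔ ⨆ α ∈ S.pos, S.gw (-α)) = ⊤ := by
  rw [eq_top_iff, ← S.h_span]
  refine iSup_le fun α => ?_
  by_cases h0 : α = 0
  · rw [h0]
    change S.gw 0 ≤ _
    rw [S.gw_zero]
    exact le_sup_left.trans le_sup_right
  by_cases hr : IsRootOf K g S.h α
  · by_cases hp : α ∈ S.pos
    · exact (le_iSup₂ (f := fun α (_ : α ∈ S.pos) => S.gw α) α hp).trans le_sup_left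
    · have h1 : -α ∈ S.pos := by
        by_contra h2; exact hp ((S.pos_polar _ hr).2 h2)
      refine le_trans ?_ (le_sup_right.trans le_sup_right)
      have := le_iSup₂ (f := fun α (_ : α ∈ S.pos) => S.gw (-α)) (-α) h1
      rwa [neg_neg] at this
  · rw [show adWeightSpace K g S.h α = ⊥ from gw_eq_bot h0 hr]
    exact bot_le

/-- a vector of the radical of positive weight on which negative simple root vectors act
centrally vanishes. -/
lemma eq_zero_of_mem_rad (hD : S.IsDynkin) (hβ : β ∈ S.pos) {x : g} (hx : x ∈ S.gw β)
    (hR : x ∈ S.rad)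
    (h : ∀ δ, S.IsSimpleRoot δ → S.Good δ → ∀ y ∈ S.gw (-δ), ⁅y, x⁆ ∈ center K g) : x = 0 := by
  let Q : LieSubalgebra K g :=
    { carrier := {y | ⁅y, x⁆ ∈ center K g}
      add_mem' := fun {a b} ha hb => by
        change ⁅a + b, x⁆ ∈ center K g; rw [add_lie]; exact add_mem ha hb
      zero_mem' := by change ⁅0, x⁆ ∈ center K g; rw [zero_lie]; exact zero_mem _
      smul_mem' := fun c a ha => by
        change ⁅c • a, x⁆ ∈ center K g; rw [smul_lie]; exact (center K g).smul_mem c ha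
      lie_mem' := by
        intro y z hy hz
        change ⁅y, x⁆ ∈ center K g at hy
        change ⁅z, x⁆ ∈ center K g at hz
        change ⁅⁅y, z⁆, x⁆ ∈ center K g
        rw [lie_lie, mem_center_iff.1 hz y, mem_center_iff.1 hy z, sub_zero]
        exact zero_mem _ }
  have hneg : ∀ γ ∈ S.pos, S.gw (-γ) ≤ Q.toSubmodule := by
    intro γ hγ y hy
    by_cases hyR : y ∈ S.rad
    · exact (mem_center_iff (K := K)).2 fun z => S.lie_rad_rad hyR hR z
    · have hg : S.Good γ := by
        have := (good_of_notMem_rad (neg_ne_zero.2 (S.pos_root γ hγ).1) hy hyR).neg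
        rwa [neg_neg] at this
      obtain ⟨s, hs, rfl⟩ := exists_simple_sum hD (p := S.Good) S.rad (fun δ hδ hb z hz => by
        by_contra hzR
        exact hb (good_of_notMem_rad (S.pos_root δ hδ.1).1 hz hzR)) hγ hg.triple.hx hg.triple.x_rad
      exact gw_neg_le_of_sum Q s (fun δ hδ => (hs δ hδ).2)
        (fun δ hδ z hz => h δ (hs δ hδ).1 (hs δ hδ).2 z hz) hg hy
  let np := S.wtSubalgebra S.pos pos_closed
  let π : g →ₗ⁅K, g⁆ (g ⧸ center K g) := LieSubmodule.Quotient.mk' (center K g)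
  have hπ : ∀ z, π z = 0 ↔ z ∈ center K g := fun z => LieSubmodule.Quotient.mk_eq_zero _
  have hxn : x ∈ np := (le_iSup₂ (f := fun α (_ : α ∈ S.pos) => S.gw α) β hβ) hx
  have hspan := lieSpan_le_of_stable (K := K) (⨆ α ∈ S.pos, S.gw α)
    (S.h.toSubmodule ⊔ ⨆ α ∈ S.pos, S.gw (-α)) gw_le_top_sup (π x) (fun b hb => by
      obtain ⟨H, hH, y, hy, rfl⟩ := Submodule.mem_sup.1 hb
      refine ⟨β ⟨H, hH⟩, ?_⟩
      have h1 : ⁅y, x⁆ ∈ center K g := (iSup₂_le hneg) hy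
      rw [add_lie, ← LieModuleHom.map_lie, ← LieModuleHom.map_lie, (hπ _).2 h1, add_zero,
        hx ⟨H, hH⟩, map_smul]) (np.toSubmodule.map (π : g →ₗ[K] _)) ⟨x, hxn, rfl⟩ (by
      rintro n hn _ ⟨m, hm, rfl⟩
      exact ⟨⁅n, m⁆, np.lie_mem hn hm, LieModuleHom.map_lie π n m⟩)
  let I : LieIdeal K g := S.rad ⊓ (LieSubmodule.lieSpan K g {π x}).comap π
  have hI : ∀ u ∈ I, ∃ n ∈ np, ∃ z ∈ center K g, u = n + z := by
    rintro u ⟨-, hu⟩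
    obtain ⟨n, hn, hnu⟩ := hspan hu
    refine ⟨n, hn, u - n, ?_, by abel⟩
    rw [← hπ, map_sub, sub_eq_zero]
    exact hnu.symm
  have hab : ∀ u ∈ I, ∀ w ∈ I, ⁅u, w⁆ = 0 := by
    intro u hu w hw
    have hc : ⁅u, w⁆ ∈ S.gw 0 := fun H => by
      rw [S.lie_rad_rad hu.1 hw.1]; simp
    obtain ⟨n, hn, z, hz, rfl⟩ := hI u hu
    obtain ⟨m, hm, z', hz', rfl⟩ := hI w hw
    have h1 : ⁅n + z, m + z'⁆ = ⁅n, m⁆ := by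
      rw [lie_add, mem_center_iff.1 hz', add_zero, add_lie, ← lie_skew z m, mem_center_iff.1 hz,
        neg_zero, add_zero]
    rw [h1] at hc ⊢
    have h2 := mem_of_mem_gw_sup (N := ⊥) (fun H v hv => by
      rw [(Submodule.mem_bot K).1 hv, lie_zero]; exact zero_mem _) zero_notMem_pos hc
      (Submodule.mem_sup_right (np.lie_mem hn hm))
    exact (Submodule.mem_bot K).1 h2
  have hxI : x ∈ I := ⟨hR, LieSubmodule.subset_lieSpan rfl⟩
  obtain ⟨H, hH⟩ : ∃ H, β H ≠ 0 := by
    by_contra! h'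
    exact (S.pos_root β hβ).1 (LinearMap.ext h')
  have h1 := S.lie_eq_zero_of_isLieAbelian I hab hxI (H : g)
  rw [hx H] at h1
  exact (smul_eq_zero.1 h1).resolve_left hH

lemma mem_rad_of_not_good (h0 : α ≠ 0) (h : ¬ S.Good α) {x : g} (hx : x ∈ S.gw α) : x ∈ S.rad := by
  by_contra hR
  exact h (good_of_notMem_rad h0 hx hR)

/-- a multiple of a good root vector in the radical vanishes. -/
lemma Good.eq_zero_of_mem_rad (h : S.Good α) {x : g} (hx : x ∈ S.gw α) (hR : x ∈ S.rad) :
    x = 0 := by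
  obtain ⟨c, rfl⟩ := h.triple.x_gen x hx
  by_cases hc : c = 0
  · rw [hc, zero_smul]
  · refine absurd ?_ h.triple.x_rad
    have := S.rad.smul_mem c⁻¹ hR
    rwa [smul_smul, inv_mul_cancel₀ hc, one_smul] at this

lemma IsSimpleRoot.good (hD : S.IsDynkin) (h : S.IsSimpleRoot α) : S.Good α := by
  by_contra hb
  obtain ⟨x, hx, hx0⟩ := Submodule.exists_mem_ne_zero_of_ne_bot (S.pos_root α h.1).2
  refine hx0 (S.eq_zero_of_mem_rad hD h.1 hx
    (mem_rad_of_not_good (S.pos_root α h.1).1 hb hx) fun δ hδ hg y hy => ?_)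
  have h1 := S.lie_mem_gw hy hx
  rw [neg_add_eq_sub, h.gw_sub hδ fun h' => hb (h' ▸ hg)] at h1
  rw [(Submodule.mem_bot K).1 h1]
  exact zero_mem _

/-- distinct simple roots have non-positive integral pairing. -/
lemma IsSimpleRoot.exists_nonpos (hD : S.IsDynkin) (h : S.IsSimpleRoot α) (h' : S.IsSimpleRoot β)
    (hne : α ≠ β) : ∃ z : ℤ, z ≤ 0 ∧ α (S.cr β) = z := by
  have t := (h'.good hD).triple
  obtain ⟨z, hz⟩ := t.exists_int (S.pos_root α h.1).2
  refine ⟨z, ?_, hz⟩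
  by_contra! hpos
  have h1 := t.lie_notMem_rad (h.good hD).triple (k := z.toNat) (by omega)
    (by rw [hz]; exact_mod_cast (Int.toNat_of_nonneg hpos.le).symm)
  have h2 := S.lie_mem_gw t.hy (h.good hD).triple.hx
  rw [neg_add_eq_sub, h.gw_sub h' hne, Submodule.mem_bot] at h2
  rw [h2] at h1
  exact h1 (zero_mem _)

/-- a nonempty sum of good positive roots is nonzero. -/
lemma sum_ne_zero_of_good (s : Multiset (Module.Dual K S.h)) (hs0 : s ≠ 0)
    (hs : ∀ δ ∈ s, S.Good δ ∧ δ ∈ S.pos) : s.sum ≠ 0 := by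
  classical
  induction hn : Multiset.card s generalizing s with
  | zero => exact absurd (Multiset.card_eq_zero.1 hn) hs0
  | succ n ih =>
    intro h0
    obtain ⟨γ, hγ⟩ := Multiset.exists_mem_of_ne_zero hs0
    have t := (hs γ hγ).1.triple
    have hsum := Multiset.sum_erase hγ
    rw [h0] at hsum
    obtain ⟨δ, hδ, k, hk, hk'⟩ : ∃ δ ∈ s.erase γ, ∃ k : ℕ, 0 < k ∧ δ (S.cr γ) = -(k : K) := by
      by_contra! hno
      have : ∀ u : Multiset (Module.Dual K S.h), (∀ δ ∈ u, δ ∈ s.erase γ) →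
          ∃ m : ℕ, u.sum (S.cr γ) = m := by
        intro u
        induction u using Multiset.induction_on with
        | empty => exact fun _ => ⟨0, by simp⟩
        | cons a u ih =>
          intro hu
          obtain ⟨m, hm⟩ := ih fun δ h => hu δ (Multiset.mem_cons_of_mem h)
          have ha := hu a (Multiset.mem_cons_self a u)
          obtain ⟨z, hz⟩ := t.exists_int (hs a (Multiset.mem_of_mem_erase ha)).1.isRootOf.2
          have hz0 : 0 ≤ z := by
            by_contra! hneg
            refine hno a ha (-z).toNat (by omega) ?_
            have : (((-z).toNat : ℤ) : K) = ((-z : ℤ) : K) := by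
              rw [Int.toNat_of_nonneg (by omega)]
            rw [hz]; push_cast at this; rw [this, neg_neg]
          refine ⟨z.toNat + m, ?_⟩
          rw [Multiset.sum_cons, LinearMap.add_apply, hm, hz]
          have : ((z.toNat : ℤ) : K) = (z : K) := by rw [Int.toNat_of_nonneg hz0]
          push_cast at this ⊢; rw [this]
      obtain ⟨m, hm⟩ := this (s.erase γ) fun _ h => h
      have h1 := congrArg (fun f : Module.Dual K S.h => f (S.cr γ)) hsum
      simp only [LinearMap.add_apply, LinearMap.zero_apply, t.two, hm] at h1
      have : ((2 + m : ℕ) : K) = 0 := by push_cast; exact h1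
      rw [Nat.cast_eq_zero] at this
      omega
    have hδs := hs δ (Multiset.mem_of_mem_erase hδ)
    have hγs := hs γ hγ
    have h1 := t.symm.lie_notMem_rad hδs.1.triple hk (by rw [map_neg, hk', neg_neg])
    have h2 := S.lie_mem_gw t.hx hδs.1.triple.hx
    have h3 := add_ne_zero_of_pos hγs.2 hδs.2
    have h4 : S.Good (γ + δ) := good_of_notMem_rad h3 h2 h1
    have h5 : γ + δ ∈ S.pos := S.pos_add _ hγs.2 _ hδs.2 h4.isRootOf
    refine ih ((γ + δ) ::ₘ (s.erase γ).erase δ) (Multiset.cons_ne_zero) ?_ ?_ ?_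
    · intro ε hε
      rcases Multiset.mem_cons.1 hε with rfl | hε
      · exact ⟨h4, h5⟩
      · exact hs ε (Multiset.mem_of_mem_erase (Multiset.mem_of_mem_erase hε))
    · rw [Multiset.card_cons, Multiset.card_erase_of_mem hδ, Multiset.card_erase_of_mem hγ, hn]
      have : 0 < Multiset.card (s.erase γ) := Multiset.card_pos_iff_exists_mem.2 ⟨δ, hδ⟩
      rw [Multiset.card_erase_of_mem hγ, hn] at this
      simp only [Nat.pred_eq_sub_one, Nat.add_sub_cancel] at this ⊢
      omega
    · rw [Multiset.sum_cons, add_assoc, Multiset.sum_erase hδ, hsum]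

/-- simple roots are linearly independent over `ℕ`. -/
lemma simple_sum_inj (hD : S.IsDynkin) {s t : Multiset (Module.Dual K S.h)}
    (hs : ∀ δ ∈ s, S.IsSimpleRoot δ) (ht : ∀ δ ∈ t, S.IsSimpleRoot δ) (h : s.sum = t.sum) :
    s = t := by
  classical
  have key : ∀ (s t : Multiset (Module.Dual K S.h)), (∀ δ ∈ s, S.IsSimpleRoot δ) →
      (∀ δ ∈ t, S.IsSimpleRoot δ) → s.sum = t.sum → Disjoint s t → s = 0 := by
    intro s t hs ht h hd
    by_contra hs0
    have h0 := sum_ne_zero_of_good s hs0 fun δ hδ => ⟨(hs δ hδ).good hD, (hs δ hδ).1⟩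
    obtain ⟨δ, hδ, k, hk, hk'⟩ := exists_pos_of_sum_ne_zero s (fun δ hδ => (hs δ hδ).good hD) h0
    have : ∀ u : Multiset (Module.Dual K S.h), (∀ ε ∈ u, ε ∈ t) →
        ∃ z : ℤ, z ≤ 0 ∧ u.sum (S.cr δ) = z := by
      intro u
      induction u using Multiset.induction_on with
      | empty => exact fun _ => ⟨0, le_rfl, by simp⟩
      | cons a u ih =>
        intro hu
        obtain ⟨m, hm0, hm⟩ := ih fun δ h => hu δ (Multiset.mem_cons_of_mem h)
        have ha := hu a (Multiset.mem_cons_self a u)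
        obtain ⟨z, hz0, hz⟩ := (ht a ha).exists_nonpos hD (hs δ hδ) fun hh =>
          Multiset.disjoint_left.1 hd hδ (hh ▸ ha)
        exact ⟨z + m, by omega, by
          rw [Multiset.sum_cons, LinearMap.add_apply, hm, hz]; push_cast; rfl⟩
    obtain ⟨z, hz0, hz⟩ := this t fun _ h => h
    rw [← h, hk'] at hz
    have : (k : ℤ) = z := by exact_mod_cast hz
    omega
  have h1 : (s - s ∩ t).sum = (t - s ∩ t).sum := by
    have e1 := congrArg Multiset.sum (tsub_add_cancel_of_le (Multiset.inter_le_left (s := s) (t := t)))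
    have e2 := congrArg Multiset.sum (tsub_add_cancel_of_le (Multiset.inter_le_right (s := s) (t := t)))
    rw [Multiset.sum_add] at e1 e2
    rw [← e1, ← e2] at h
    exact add_right_cancel h
  have hd : Disjoint (s - s ∩ t) (t - s ∩ t) := by
    rw [Multiset.disjoint_left]
    intro a ha hb
    have := Multiset.mem_sub.1 ha
    have := Multiset.mem_sub.1 hb
    rw [Multiset.count_inter] at *
    omega
  have hs' : ∀ δ ∈ s - s ∩ t, S.IsSimpleRoot δ := fun δ hδ => hs δ (Multiset.mem_of_le tsub_le_self hδ)
  have ht' : ∀ δ ∈ t - s ∩ t, S.IsSimpleRoot δ := fun δ hδ => ht δ (Multiset.mem_of_le tsub_le_self hδ)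
  have a1 := key _ _ hs' ht' h1 hd
  have a2 := key _ _ ht' hs' h1.symm hd.symm
  rw [tsub_eq_zero_iff_le] at a1 a2
  exact le_antisymm (a1.trans Multiset.inter_le_right) (a2.trans Multiset.inter_le_left)

/-- positive roots are sums of simple roots. -/
lemma exists_simple_sum' (hD : S.IsDynkin) (hγ : γ ∈ S.pos) :
    ∃ s : Multiset (Module.Dual K S.h), (∀ δ ∈ s, S.IsSimpleRoot δ) ∧ s.sum = γ := by
  obtain ⟨x, hx, hx0⟩ := Submodule.exists_mem_ne_zero_of_ne_bot (S.pos_root γ hγ).2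
  obtain ⟨s, hs, h⟩ := exists_simple_sum hD (p := fun _ => True) ⊥ (by simp) hγ hx (by simpa using hx0)
  exact ⟨s, fun δ hδ => (hs δ hδ).1, h⟩

/-- every positive root has a coroot. -/
lemma good_of_mem_pos (hD : S.IsDynkin) (hγ : γ ∈ S.pos) : S.Good γ := by
  classical
  obtain ⟨s, hs, hsum⟩ := exists_simple_sum' hD hγ
  induction hn : Multiset.card s using Nat.strong_induction_on generalizing s γ with
  | _ n ih =>
    by_contra hb
    have hr := S.pos_root γ hγ
    obtain ⟨x, hx, hx0⟩ := Submodule.exists_mem_ne_zero_of_ne_bot hr.2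
    have hR := mem_rad_of_not_good hr.1 hb hx
    refine hx0 (S.eq_zero_of_mem_rad hD hγ hx hR fun δ hδ hg y hy => ?_)
    have h1 := S.lie_mem_gw hy hx
    have h2 : ⁅y, x⁆ ∈ S.rad := S.rad.lie_mem hR
    rw [neg_add_eq_sub] at h1
    suffices h3 : ⁅y, x⁆ = 0 by rw [h3]; exact zero_mem _
    by_contra h3
    have hne : γ - δ ≠ 0 := fun h => hb ((sub_eq_zero.1 h) ▸ hg)
    have hr' : IsRootOf K g S.h (γ - δ) := ⟨hne, fun h => h3 ((Submodule.mem_bot K).1 (h ▸ h1))⟩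
    by_cases hp : γ - δ ∈ S.pos
    · obtain ⟨s', hs', hsum'⟩ := exists_simple_sum' hD hp
      have h4 : s = δ ::ₘ s' := simple_sum_inj hD hs (fun ε hε => by
        rcases Multiset.mem_cons.1 hε with rfl | h
        exacts [hδ, hs' ε h]) (by rw [hsum, Multiset.sum_cons, hsum']; abel)
      have h5 := ih (Multiset.card s') (by rw [← hn, h4, Multiset.card_cons]; omega) hp s' hs' hsum' rfl
      exact h3 (h5.eq_zero_of_mem_rad h1 h2)
    · have h4 : -(γ - δ) ∈ S.pos := by
        by_contra h5; exact hp ((S.pos_polar _ hr').2 h5)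
      exact hδ.not_add hγ h4 (by abel)

/-- every root has a coroot. -/
lemma good_of_isRootOf (hD : S.IsDynkin) (h : IsRootOf K g S.h α) : S.Good α := by
  by_cases hp : α ∈ S.pos
  · exact good_of_mem_pos hD hp
  · have h1 : -α ∈ S.pos := by
      by_contra h2; exact hp ((S.pos_polar _ h).2 h2)
    have := (good_of_mem_pos hD h1).neg
    rwa [neg_neg] at this

end Setup

end

section

namespace Setup

open LieAlgebra

variable {K : Type} [Field K] [IsAlgClosed K] [CharZero K]
variable {g : Type} [LieRing g] [LieAlgebra K g] {S : Setup K g}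
variable {α β γ δ : Module.Dual K S.h} {x y : g} {H : S.h}

lemma IsSimpleRoot.smul_not_root (hD : S.IsDynkin) (h : S.IsSimpleRoot α) {m : ℕ} (hm : 2 ≤ m) :
    ¬ IsRootOf K g S.h (m • α) := by
  intro hr
  have t := (h.good hD).triple
  let Q : LieSubalgebra K g :=
    { toSubmodule := S.gw α
      lie_mem' := by
        intro a b ha hb
        obtain ⟨c, rfl⟩ := t.x_gen a ha
        obtain ⟨d, rfl⟩ := t.x_gen b hb
        rw [smul_lie, lie_smul, lie_self, smul_zero, smul_zero]
        exact (S.gw α).zero_mem }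
  have hg := good_of_isRootOf hD hr
  have hs : (Multiset.replicate m α).sum = m • α := by simp
  have h1 := gw_le_of_sum Q (Multiset.replicate m α)
    (fun δ hδ => by rw [Multiset.eq_of_mem_replicate hδ]; exact h.good hD)
    (fun δ hδ => by rw [Multiset.eq_of_mem_replicate hδ]) (by rw [hs]; exact hg)
  rw [hs] at h1
  refine hg.triple.x_ne_zero (S.eq_zero_of_mem_gw (fun h2 => ?_) hg.triple.hx (h1 hg.triple.hx))
  have h3 := congrArg (fun f : Module.Dual K S.h => f (S.cr α)) h2
  simp only [LinearMap.smul_apply, t.two, nsmul_eq_mul] at h3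
  have : ((m * 2 : ℕ) : K) = (2 : ℕ) := by push_cast; exact h3
  have := Nat.cast_injective this
  omega

namespace Triple

/-- the operator realizing the reflection on vectors on which `H` acts by `z`. -/
def refl (_ : S.Triple α x y H) (z : ℤ) : Module.End K g :=
  if 0 ≤ z then LieModule.toEnd K g g y ^ z.toNat else LieModule.toEnd K g g x ^ (-z).toNat

variable (t : S.Triple α x y H)
include t

lemma eq_zero_of_refl {z : ℤ} {v : g} (hv : ⁅(H : g), v⁆ = (z : K) • v) (h : t.refl z v = 0) :
    v = 0 := by
  unfold refl at h
  split_ifs at h with hz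
  · obtain ⟨N, hN⟩ := exists_pow_ad_eq_zero t.ne_zero t.hx v
    refine (t.ops g).eq_zero_of_pow_f_nat (k := z.toNat) ?_ hN h le_rfl
    refine Eq.trans hv ?_
    congr 1
    exact_mod_cast congrArg (Int.cast (R := K)) (Int.toNat_of_nonneg hz).symm
  · obtain ⟨N, hN⟩ := exists_pow_ad_eq_zero t.symm.ne_zero t.hy v
    refine (t.symm.ops g).eq_zero_of_pow_f_nat (k := (-z).toNat) ?_ hN h le_rfl
    change ⁅-(H : g), v⁆ = _
    rw [neg_lie, hv, ← neg_smul]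
    congr 1
    exact_mod_cast congrArg (Int.cast (R := K)) (Int.toNat_of_nonneg (by omega : 0 ≤ -z)).symm

/-- the reflection operator moves weights by the multiple of `α`. -/
lemma refl_mem {P : K → g → Prop} (hx : ∀ c v, P c v → P (c + 1) ⁅x, v⁆)
    (hy : ∀ c v, P c v → P (c - 1) ⁅y, v⁆) {z : ℤ} {v : g} (hv : P 0 v) : P (-(z : K)) (t.refl z v) := by
  unfold refl
  split_ifs with hz
  · have h1 : ∀ n : ℕ, P (-(n : K)) ((LieModule.toEnd K g g y ^ n) v) := by
      intro n
      induction n with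
      | zero => simpa using hv
      | succ n ih =>
        rw [pow_succ', show -((n + 1 : ℕ) : K) = -(n : K) - 1 by push_cast; ring]
        exact hy _ _ ih
    have h2 := h1 z.toNat
    rwa [show ((z.toNat : ℕ) : K) = z from
      by exact_mod_cast congrArg (Int.cast (R := K)) (Int.toNat_of_nonneg hz)] at h2
  · have h1 : ∀ n : ℕ, P (n : K) ((LieModule.toEnd K g g x ^ n) v) := by
      intro n
      induction n with
      | zero => simpa using hv
      | succ n ih =>
        rw [pow_succ', show ((n + 1 : ℕ) : K) = (n : K) + 1 by push_cast; ring]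
        exact hx _ _ ih
    have h2 := h1 (-z).toNat
    rwa [show (((-z).toNat : ℕ) : K) = -(z : K) from
      by exact_mod_cast congrArg (Int.cast (R := K)) (Int.toNat_of_nonneg (by omega : 0 ≤ -z))] at h2

lemma refl_mem_gw {z : ℤ} {v : g} (hv : v ∈ S.gw γ) : t.refl z v ∈ S.gw (γ - (z : K) • α) := by
  have h1 := t.refl_mem (P := fun c v => v ∈ S.gw (γ + c • α)) (fun c v h => by
    have := S.lie_mem_gw t.hx h
    rwa [show α + (γ + c • α) = γ + (c + 1) • α by module] at this)
    (fun c v h => by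
      have := S.lie_mem_gw t.hy h
      rwa [show -α + (γ + c • α) = γ + (c - 1) • α by module] at this)
    (z := z) (v := v) (by simpa using hv)
  rwa [show γ + -(z : K) • α = γ - (z : K) • α by module] at h1

lemma refl_mem_rootSpaceN {n : ℕ} (hx : x ∈ S.F n) (hy : y ∈ S.F n) {ψ : Module.Dual K (S.hn n)}
    {z : ℤ} {v : g} (hv : v ∈ S.rootSpaceN n ψ) :
    t.refl z v ∈ S.rootSpaceN n (ψ - (z : K) • S.resDual n α) := by
  have h1 := t.refl_mem (P := fun c v => v ∈ S.rootSpaceN n (ψ + c • S.resDual n α))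
    (fun c v h => ⟨(S.F n).lie_mem hx h.1, fun s => by
      have h3 : ⁅(s : g), x⁆ = α ⟨s, s.2.1⟩ • x := t.hx ⟨s, s.2.1⟩
      have h4 := h.2 s
      have h5 : S.resDual n α s = α ⟨s, s.2.1⟩ := rfl
      rw [leibniz_lie, h4, h3, smul_lie, lie_smul, LinearMap.add_apply, LinearMap.add_apply,
        LinearMap.smul_apply, LinearMap.smul_apply, h5, ← add_smul]
      congr 1
      simp only [smul_eq_mul]; ring⟩)
    (fun c v h => ⟨(S.F n).lie_mem hy h.1, fun s => by
      have h3 : ⁅(s : g), y⁆ = -α ⟨s, s.2.1⟩ • y := t.hy ⟨s, s.2.1⟩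
      have h4 := h.2 s
      have h5 : S.resDual n α s = α ⟨s, s.2.1⟩ := rfl
      rw [leibniz_lie, h4, h3, smul_lie, lie_smul, LinearMap.add_apply, LinearMap.add_apply,
        LinearMap.smul_apply, LinearMap.smul_apply, h5, ← add_smul]
      congr 1
      simp only [smul_eq_mul]; ring⟩)
    (z := z) (v := v) (by simpa using hv)
  rwa [show ψ + -(z : K) • S.resDual n α = ψ - (z : K) • S.resDual n α by module] at h1

lemma exists_int_of_lie {v : g} {κ : K} (hv : ⁅(H : g), v⁆ = κ • v) (hv0 : v ≠ 0) :
    ∃ z : ℤ, κ = z := by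
  obtain ⟨N, hN⟩ := exists_pow_ad_eq_zero t.ne_zero t.hx v
  obtain ⟨M, hM⟩ := exists_pow_ad_eq_zero t.symm.ne_zero t.hy v
  exact (t.ops g).exists_int hv hv0 hN hM

lemma reflect_ne_zero (h0 : β ≠ 0) : β - β H • α ≠ 0 := by
  intro h
  have h1 := congrArg (fun f : Module.Dual K S.h => f H) h
  simp only [LinearMap.sub_apply, LinearMap.smul_apply, t.two, LinearMap.zero_apply,
    smul_eq_mul] at h1
  have h2 : β H = 0 := by linear_combination -h1
  rw [h2, zero_smul, sub_zero] at h
  exact h0 h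

/-- reflections permute roots. -/
lemma isRootOf_reflect (hβ : IsRootOf K g S.h β) : IsRootOf K g S.h (β - β H • α) := by
  obtain ⟨z, hz⟩ := t.exists_int hβ.2
  obtain ⟨v, hv, hv0⟩ := Submodule.exists_mem_ne_zero_of_ne_bot hβ.2
  refine ⟨t.reflect_ne_zero hβ.1, fun h => hv0 (t.eq_zero_of_refl (z := z) ?_ ?_)⟩
  · rw [hv H, hz]
  · have := t.refl_mem_gw (z := z) hv
    rw [← hz] at this
    exact (Submodule.mem_bot K).1 (h ▸ this)

end Triple

lemma neg_mem_pos (h : IsRootOf K g S.h α) (hp : α ∉ S.pos) : -α ∈ S.pos := by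
  by_contra h2
  exact hp ((S.pos_polar _ h).2 h2)

/-- simple reflections permute the other positive roots. -/
lemma IsSimpleRoot.reflect_mem_pos (hD : S.IsDynkin) (h : S.IsSimpleRoot α) (hβ : β ∈ S.pos)
    (hne : β ≠ α) : β - β (S.cr α) • α ∈ S.pos := by
  have t := (h.good hD).triple
  have hr := t.isRootOf_reflect (S.pos_root β hβ)
  by_contra hp
  obtain ⟨s, hs, hsum⟩ := exists_simple_sum' hD hβ
  obtain ⟨s', hs', hsum'⟩ := exists_simple_sum' hD (neg_mem_pos hr hp)
  obtain ⟨z, hz⟩ := t.exists_int (S.pos_root β hβ).2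
  obtain ⟨ε, hε, hεα⟩ : ∃ ε ∈ s, ε ≠ α := by
    by_contra! hall
    have h1 : s = Multiset.replicate (Multiset.card s) α := Multiset.eq_replicate_card.2 hall
    have h2 : β = Multiset.card s • α := by
      rw [← hsum, h1, Multiset.sum_replicate, Multiset.card_replicate]
    have h3 : ¬ 2 ≤ Multiset.card s := fun h3 =>
      h.smul_not_root hD h3 (h2 ▸ S.pos_root β hβ)
    interval_cases hc : Multiset.card s
    · rw [zero_smul] at h2; exact zero_notMem_pos (h2 ▸ hβ)
    · rw [one_smul] at h2; exact hne h2
  rw [hz] at hsum'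
  rcases le_or_gt 0 z with hz0 | hz0
  · have h1 : s + s' = Multiset.replicate z.toNat α := by
      refine simple_sum_inj hD (fun δ hδ => ?_)
        (fun δ hδ => by rw [Multiset.eq_of_mem_replicate hδ]; exact h) ?_
      · rcases Multiset.mem_add.1 hδ with h | h
        exacts [hs δ h, hs' δ h]
      · rw [Multiset.sum_add, hsum, hsum', Multiset.sum_replicate, ← Nat.cast_smul_eq_nsmul K,
          show ((z.toNat : ℕ) : K) = z from
            by exact_mod_cast congrArg (Int.cast (R := K)) (Int.toNat_of_nonneg hz0)]
        abel
    exact hεα (Multiset.eq_of_mem_replicate (h1 ▸ Multiset.mem_add.2 (.inl hε)))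
  · have h1 : s + s' + Multiset.replicate (-z).toNat α = 0 := by
      refine simple_sum_inj hD (fun δ hδ => ?_) (by simp) ?_
      · rcases Multiset.mem_add.1 hδ with hδ | hδ
        · rcases Multiset.mem_add.1 hδ with h | h
          exacts [hs δ h, hs' δ h]
        · rw [Multiset.eq_of_mem_replicate hδ]; exact h
      · rw [Multiset.sum_add, Multiset.sum_add, hsum, hsum', Multiset.sum_replicate,
          ← Nat.cast_smul_eq_nsmul K, show (((-z).toNat : ℕ) : K) = -(z : K) from
            by exact_mod_cast congrArg (Int.cast (R := K)) (Int.toNat_of_nonneg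
              (by omega : 0 ≤ -z)), Multiset.sum_zero, neg_smul]
        abel
    have : ε ∈ s + s' + Multiset.replicate (-z).toNat α := by simp [hε]
    rw [h1] at this
    exact Multiset.notMem_zero _ this

lemma b_eq_iSup : S.b.toSubmodule = ⨆ α ∈ insert 0 S.pos, S.gw α := by
  rw [S.b_eq, iSup_insert, S.gw_zero]

lemma mem_pos_of_mem_b {v : g} (hv : v ∈ S.gw γ) (hv0 : v ≠ 0) (hb : v ∈ S.b) (h0 : γ ≠ 0) :
    γ ∈ S.pos := by
  by_contra hp
  refine hv0 ((Submodule.mem_bot K).1 (mem_of_mem_gw_sup (N := ⊥) (A := insert 0 S.pos)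
    (fun H v hv => by rw [(Submodule.mem_bot K).1 hv, lie_zero]; exact zero_mem _)
    (by simp [h0, hp]) hv (Submodule.mem_sup_right ?_)))
  rw [← b_eq_iSup]; exact hb

lemma gw_le_b (h : γ ∈ S.pos) : S.gw γ ≤ S.b.toSubmodule := by
  rw [b_eq_iSup]
  exact le_iSup₂ (f := fun α (_ : α ∈ insert 0 S.pos) => S.gw α) γ (Set.mem_insert_of_mem _ h)

lemma finite_posRootsN (n : ℕ) : (S.posRootsN n).Finite := by
  let i : S.T n →ₗ[K] S.hn n :=
    { toFun := fun t => ⟨(t : S.F n), t.2⟩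
      map_add' := fun _ _ => rfl
      map_smul' := fun _ _ => rfl }
  refine Set.Finite.of_finite_image
    (f := fun (β : Module.Dual K (S.hn n)) (t : S.T n) => β (i t))
    ((LieModule.finite_genWeightSpace_ne_bot K (S.T n) (S.F n)).subset ?_) ?_
  · rintro _ ⟨β, hβ, rfl⟩ hbot
    obtain ⟨v, hv, hv0⟩ := Submodule.exists_mem_ne_zero_of_ne_bot hβ.2.1
    have h1 : (⟨v, hv.1⟩ : S.F n) ∈ LieModule.genWeightSpace (S.F n) fun t : S.T n => β (i t) := by
      rw [LieModule.mem_genWeightSpace]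
      refine fun t => ⟨1, ?_⟩
      rw [pow_one, LinearMap.sub_apply, sub_eq_zero]
      exact Subtype.ext (hv.2 (i t))
    have h2 : (⟨v, hv.1⟩ : S.F n) ∈ (⊥ : LieSubmodule K (S.T n) (S.F n)) := hbot ▸ h1
    exact hv0 (congrArg Subtype.val ((LieSubmodule.mem_bot _).1 h2))
  · intro β _ β' _ h
    refine LinearMap.ext fun s => ?_
    exact congrFun h (⟨⟨s, s.2.2⟩, s.2⟩ : S.T n)

/-- `ρ` takes the value one on simple coroots. -/
lemma rho_simple (hD : S.IsDynkin) {ρ : Module.Dual K S.h} (hρ : S.IsGlobalRho ρ)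
    (h : S.IsSimpleRoot α) : ρ (S.cr α) = 1 := by
  classical
  have t := (h.good hD).triple
  set x := S.ev α
  set y := S.fv α
  set H := S.cr α
  obtain ⟨n, hxn, hyn, hHn⟩ := ((S.eventually_mem x).and
    ((S.eventually_mem y).and (S.eventually_mem H))).exists
  let Hn : S.hn n := ⟨H, H.2, hHn⟩
  let αn := S.resDual n α
  have hαn : αn Hn = 2 := t.two
  have hfin := finite_posRootsN (S := S) n
  have hρn : ρ H = (2 : K)⁻¹ * ∑ β ∈ hfin.toFinset, β Hn := by
    have h1 : ρ H = S.resDual n ρ Hn := rfl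
    rw [h1, hρ n, rhoN, finsum_mem_eq_finite_toFinset_sum _ hfin, LinearMap.smul_apply,
      LinearMap.sum_apply, smul_eq_mul]
  have hα0 : αn ≠ 0 := fun h0 => by
    rw [h0] at hαn; exact two_ne_zero hαn.symm
  have hαP : αn ∈ S.posRootsN n := by
    refine ⟨hα0, fun hb => t.x_ne_zero ?_, ?_⟩
    · have : x ∈ S.rootSpaceN n αn := ⟨hxn, fun s => t.hx ⟨s, s.2.1⟩⟩
      rw [hb] at this
      exact (Submodule.mem_bot K).1 this
    · rintro v ⟨hv, hv'⟩
      have hres : S.resT n α ≠ 0 := fun h0 => by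
        have := congrFun h0 (⟨⟨H, hHn⟩, H.2, hHn⟩ : S.T n)
        exact two_ne_zero (t.two.symm.trans this)
      have hxrad : (⟨x, hxn⟩ : S.F n) ∉ radical K (S.F n) := by
        intro hR
        have h1 : (⟨H, hHn⟩ : S.F n) ∈ radical K (S.F n) := by
          have e1 : (⟨H, hHn⟩ : S.F n) = -⁅(⟨y, hyn⟩ : S.F n), (⟨x, hxn⟩ : S.F n)⁆ :=
            Subtype.ext (t.lie.trans (lie_skew x y).symm)
          rw [e1]
          exact neg_mem (LieSubmodule.lie_mem _ hR)
        have h2 := mem_center_iff.1 (mem_center_of_mem_radical (S.F_reductive n) (S.T n) h1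
          (S.mem_T.2 H.2)) ⟨x, hxn⟩
        have h3 : ⁅x, (H : g)⁆ = 0 := congrArg Subtype.val h2
        rw [← lie_skew, t.lie_h_x, neg_eq_zero] at h3
        exact t.x_ne_zero ((smul_eq_zero.1 h3).resolve_left two_ne_zero)
      obtain ⟨-, -, h3, -⟩ := exists_triple (S.F_reductive n) (S.T n) hres
        (S.mem_rootSpace_of_mem_gw t.hx hxn) hxrad
      obtain ⟨c, hc⟩ := h3 ⟨v, hv⟩ (by
        rw [LieModule.mem_genWeightSpace]
        refine fun s => ⟨1, ?_⟩
        rw [pow_one, LinearMap.sub_apply, sub_eq_zero]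
        exact Subtype.ext (hv' ⟨(s : S.F n), s.2⟩))
      have : v = c • x := congrArg Subtype.val hc
      rw [this]
      exact S.b.smul_mem c (gw_le_b h.1 t.hx)
  have hstab : ∀ β ∈ S.posRootsN n, β ≠ αn → β - β Hn • αn ∈ S.posRootsN n := by
    rintro β ⟨hβ0, hβ1, hβ2⟩ hβα
    obtain ⟨v, hv, hv0⟩ := Submodule.exists_mem_ne_zero_of_ne_bot hβ1
    obtain ⟨z, hz⟩ := t.exists_int_of_lie (hv.2 Hn) hv0
    have hzz : (β - (z : K) • αn) Hn = ((-z : ℤ) : K) := by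
      rw [LinearMap.sub_apply, LinearMap.smul_apply, hαn, hz, smul_eq_mul]; push_cast; ring
    have hback : β - (z : K) • αn - ((-z : ℤ) : K) • αn = β := by
      push_cast; module
    rw [hz]
    refine ⟨fun h0 => ?_, fun hb => ?_, ?_⟩
    · rw [h0, LinearMap.zero_apply] at hzz
      rw [h0, ← hzz, zero_smul, sub_zero] at hback
      exact hβ0 hback.symm
    · have h1 := t.refl_mem_rootSpaceN hxn hyn (z := z) hv
      rw [show S.resDual n α = αn from rfl, hb] at h1
      exact hv0 (t.eq_zero_of_refl (by rw [← hz]; exact hv.2 Hn) ((Submodule.mem_bot K).1 h1))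
    · intro w hw
      have h1 : w ∈ ⨆ γ, adWeightSpace K g S.h γ := by rw [S.h_span]; trivial
      obtain ⟨f, hf, rfl⟩ := (Submodule.mem_iSup_iff_exists_finsupp _ _).1 h1
      have hwt : Function.Injective fun (β : Module.Dual K S.h) (H : S.h) => β H :=
        DFunLike.coe_injective
      have hfN : ∀ γ ∈ f.support, ∀ s : S.hn n, γ ⟨s, s.2.1⟩ = (β - (z : K) • αn) s := by
        intro γ hγ s
        have h2 := mem_of_sum_mem (K := K) (V := g) (wt := fun (β : Module.Dual K S.h) (H : S.h) => β H)
          (op := fun H : S.h => (LieModule.toEnd K g g (H : g) : Module.End K g)) hwt (N := ⊥)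
          (fun H v hv => by rw [(Submodule.mem_bot K).1 hv, map_zero]; exact zero_mem _) f.support
          (fun γ => (γ ⟨s, s.2.1⟩ - (β - (z : K) • αn) s) • f γ) (fun γ _ H => by
            rw [map_smul, LieModule.toEnd_apply_apply, hf γ H, smul_comm]) (by
            have h3 := hw.2 s
            rw [Finsupp.sum, lie_sum, Finset.smul_sum, ← sub_eq_zero,
              ← Finset.sum_sub_distrib] at h3
            rw [Submodule.mem_bot, ← h3]
            refine Finset.sum_congr rfl fun γ _ => ?_
            rw [sub_smul]
            congr 1
            exact (hf γ ⟨s, s.2.1⟩).symm) γ hγ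
        have h3 := (smul_eq_zero.1 ((Submodule.mem_bot K).1 h2)).resolve_right
          (Finsupp.mem_support_iff.1 hγ)
        exact sub_eq_zero.1 h3
      have h4 : t.refl (-z) (∑ γ ∈ f.support, f γ) ∈ S.b.toSubmodule := by
        refine hβ2 ?_
        have := t.refl_mem_rootSpaceN hxn hyn (z := -z) hw
        rwa [show S.resDual n α = αn from rfl, hback] at this
      rw [map_sum] at h4
      have h5 := mem_of_sum_mem (K := K) (V := g)
          (wt := fun (β : Module.Dual K S.h) (H : S.h) => (β - ((-z : ℤ) : K) • α) H)
          (op := fun H : S.h => (LieModule.toEnd K g g (H : g) : Module.End K g))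
          (fun β β' h => sub_left_injective (hwt h)) (N := S.b.toSubmodule)
          (fun H v hv => S.b.lie_mem (by
            have : (H : g) ∈ S.b.toSubmodule := by
              rw [S.b_eq]; exact Submodule.mem_sup_left H.2
            exact this) hv) f.support
          (fun γ => t.refl (-z) (f γ)) (fun γ _ H => t.refl_mem_gw (hf γ) H) h4
      refine Submodule.sum_mem _ fun γ hγ => gw_le_b ?_ (hf γ)
      have hγn := hfN γ hγ
      have hγH : γ H = ((-z : ℤ) : K) := (hγn Hn).trans hzz
      have hfγ : f γ ≠ 0 := Finsupp.mem_support_iff.1 hγ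
      have h6 : t.refl (-z) (f γ) ≠ 0 := fun h0 => hfγ (t.eq_zero_of_refl ((hf γ H).trans (by rw [hγH])) h0)
      have hγ0 : γ ≠ 0 := by
        rintro rfl
        have e1 : β - (z : K) • αn = 0 := LinearMap.ext fun s => (hγn s).symm
        have e2 : ((-z : ℤ) : K) = 0 := by rw [← hzz, e1]; rfl
        rw [e1, e2, zero_smul, sub_zero] at hback
        exact hβ0 hback.symm
      have h7 := mem_pos_of_mem_b (t.refl_mem_gw (hf γ)) h6 (h5 γ hγ)
        (by rw [← hγH]; exact t.reflect_ne_zero hγ0)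
      rw [← hγH] at h7
      have h8 := h.reflect_mem_pos hD h7 (fun h9 => hβα (by
        rw [← hback]
        refine LinearMap.ext fun s => ?_
        rw [LinearMap.sub_apply, LinearMap.smul_apply, ← hγn s, ← hγH]
        exact congrArg (fun φ : Module.Dual K S.h => φ ⟨s, s.2.1⟩) h9))
      have e3 : (γ - γ H • α) H = - γ H := by
        rw [LinearMap.sub_apply, LinearMap.smul_apply, t.two, smul_eq_mul]; ring
      rwa [e3, show γ - γ H • α - (-γ H) • α = γ by module] at h8
  have hsum : ∑ β ∈ hfin.toFinset.erase αn, β Hn = 0 := by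
    refine Finset.sum_involution (fun β _ => β - β Hn • αn) ?_ ?_ ?_ ?_
    · intro β _
      rw [LinearMap.sub_apply, LinearMap.smul_apply, hαn, smul_eq_mul]; ring
    · intro β _ hne h1
      rw [sub_eq_self, smul_eq_zero] at h1
      exact h1.elim hne hα0
    · intro β hβ
      rw [Finset.mem_erase, Set.Finite.mem_toFinset] at hβ ⊢
      refine ⟨fun h1 => ?_, hstab β hβ.2 hβ.1⟩
      have h2 := congrArg (fun f : Module.Dual K (S.hn n) => f Hn) h1
      simp only [LinearMap.sub_apply, LinearMap.smul_apply, hαn, smul_eq_mul] at h2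
      have h3 : β Hn = -2 := by linear_combination -h2
      have h4 : β = -αn := by
        rw [h3] at h1
        have h5 : β = (β - (-2 : K) • αn) - (2 : K) • αn := by module
        rw [h5, h1]; module
      have h5 : y ∈ S.b := hβ.2.2.2 ⟨hyn, fun s => by rw [h4]; exact t.hy ⟨s, s.2.1⟩⟩
      have h6 := mem_pos_of_mem_b t.hy (fun h0 => t.y_rad (h0 ▸ zero_mem S.rad)) h5
        (neg_ne_zero.2 t.ne_zero)
      exact neg_notMem_pos h.1 h6
    · intro β _
      have : (β - β Hn • αn) Hn = -β Hn := by
        rw [LinearMap.sub_apply, LinearMap.smul_apply, hαn, smul_eq_mul]; ring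
      rw [this]; module
  rw [hρn, ← Finset.add_sum_erase _ _ (hfin.mem_toFinset.2 hαP), hsum, hαn, add_zero,
    inv_mul_cancel₀ two_ne_zero]

end Setup

end

section

section Localization

variable {R : Type} [Ring R] {f r s : R}

/-- `r` is killed by some power of the inner derivation of `f`. -/
inductive AdNil (f : R) : R → Prop
  | zero : AdNil f 0
  | step {r : R} : AdNil f (f * r - r * f) → AdNil f r

namespace AdNil

lemma ad (h : AdNil f r) : AdNil f (f * r - r * f) := by
  cases h with
  | zero => rw [mul_zero, zero_mul, sub_zero]; exact zero
  | step h => exact h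

lemma add (hr : AdNil f r) (hs : AdNil f s) : AdNil f (r + s) := by
  induction hr generalizing s with
  | zero => rwa [zero_add]
  | @step r _ ih =>
    refine step ?_
    have := ih hs.ad
    rwa [show f * r - r * f + (f * s - s * f) = f * (r + s) - (r + s) * f by noncomm_ring] at this

lemma mul (hr : AdNil f r) (hs : AdNil f s) : AdNil f (r * s) := by
  induction hr generalizing s with
  | zero => rw [zero_mul]; exact zero
  | @step r _ ih =>
    induction hs with
    | zero => rw [mul_zero]; exact zero
    | @step s hs ih' =>
      refine step ?_
      have := (ih (step hs)).add ih'
      rwa [show (f * r - r * f) * s + r * (f * s - s * f) = f * (r * s) - r * s * f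
        by noncomm_ring] at this

lemma of_commute (h : f * r = r * f) : AdNil f r := step (by rw [h, sub_self]; exact zero)

lemma exists_pow_mul_eq_zero (hr : AdNil f r) {n : ℕ} (h : r * f ^ n = 0) :
    ∃ m, f ^ m * r = 0 := by
  induction hr with
  | zero => exact ⟨0, mul_zero _⟩
  | @step r _ ih =>
    obtain ⟨m, hm⟩ := ih (by
      rw [sub_mul, mul_assoc, h, mul_zero, mul_assoc, ← pow_succ', pow_succ, ← mul_assoc, h,
        zero_mul, sub_zero])
    rw [mul_sub, ← mul_assoc, ← pow_succ, ← mul_assoc, sub_eq_zero] at hm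
    have key : ∀ k, f ^ (m + k) * r = f ^ m * r * f ^ k := by
      intro k
      induction k with
      | zero => simp
      | succ k ih2 =>
        rw [← add_assoc, add_right_comm, add_comm, pow_add, add_comm m 1, add_comm 1 m, mul_assoc,
          hm, ← mul_assoc, ← mul_assoc, ← pow_add, add_comm k m, ih2, mul_assoc, ← pow_succ]
    exact ⟨m + n, by rw [key, mul_assoc, h, mul_zero]⟩

lemma exists_pow_mul (hr : AdNil f r) (n : ℕ) : ∃ m r', f ^ m * r = r' * f ^ n := by
  induction hr generalizing n with
  | zero => exact ⟨0, 0, by simp⟩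
  | @step r _ ih =>
    induction n with
    | zero => exact ⟨0, r, by simp⟩
    | succ n ih' =>
      obtain ⟨m, r', h⟩ := ih'
      obtain ⟨m', s, h'⟩ := ih (n + 1)
      refine ⟨m + m' + 1, f ^ m' * r' + f ^ m * s, ?_⟩
      have e : f ^ (m + m' + 1) * r = f ^ m' * (f ^ m * r) * f + f ^ m * (f ^ m' * (f * r - r * f)) := by
        have : f ^ m' * (f ^ m * r) = f ^ m * (f ^ m' * r) := by
          rw [← mul_assoc, ← mul_assoc, ← pow_add, ← pow_add, add_comm]
        rw [this, pow_succ, pow_add]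
        noncomm_ring
      rw [e, h, h', add_mul, pow_succ]
      noncomm_ring

end AdNil

/-- a module can be localized at the powers of a locally ad-nilpotent element. -/
theorem exists_localization (hf : ∀ r, AdNil f r) (M : Type) [AddCommGroup M] [Module R M] :
    ∃ (N : Type) (_ : AddCommGroup N) (_ : Module R N) (j : M →ₗ[R] N),
      (Function.Bijective fun n : N => f • n) ∧ ∀ m, j m = 0 → ∃ n : ℕ, f ^ n • m = 0 := by
  classical
  have h1 : ∀ (r : R) (s : Submonoid.powers f), ∃ p : R × Submonoid.powers f, p.2 * r = p.1 * s := by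
    rintro r ⟨_, n, rfl⟩
    obtain ⟨m, r', h⟩ := (hf r).exists_pow_mul n
    exact ⟨⟨r', ⟨f ^ m, m, rfl⟩⟩, h⟩
  choose p hp using h1
  let _ : OreLocalization.OreSet (Submonoid.powers f) :=
    { ore_right_cancel := by
        rintro r₁ r₂ ⟨_, n, rfl⟩ h
        obtain ⟨m, hm⟩ := (hf (r₁ - r₂)).exists_pow_mul_eq_zero (n := n)
          (by rw [sub_mul, sub_eq_zero]; exact h)
        exact ⟨⟨f ^ m, m, rfl⟩, by rwa [mul_sub, sub_eq_zero] at hm⟩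
      oreNum := fun r s => (p r s).1
      oreDenom := fun r s => (p r s).2
      ore_eq := hp }
  let F : Submonoid.powers f := ⟨f, Submonoid.mem_powers f⟩
  refine ⟨OreLocalization (Submonoid.powers f) M, inferInstance, inferInstance,
    { toFun := fun m => OreLocalization.oreDiv m 1
      map_add' := fun a b => OreLocalization.add_oreDiv.symm
      map_smul' := fun r m => (OreLocalization.smul_oreDiv_one r m).symm }, ⟨?_, ?_⟩, ?_⟩
  · intro a b h
    have h2 : OreLocalization.numeratorHom (S := Submonoid.powers f) (F : R) • a
        = OreLocalization.numeratorHom (S := Submonoid.powers f) (F : R) • b := by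
      rw [OreLocalization.numeratorHom_apply, OreLocalization.oreDiv_one_smul,
        OreLocalization.oreDiv_one_smul]
      exact h
    exact (OreLocalization.numerator_isUnit F).smul_left_cancel.1 h2
  · intro a
    obtain ⟨u, hu⟩ := OreLocalization.numerator_isUnit (S := Submonoid.powers f) F
    refine ⟨(↑u⁻¹ : OreLocalization (Submonoid.powers f) R) • a, ?_⟩
    have : f • (↑u⁻¹ : OreLocalization (Submonoid.powers f) R) • a
        = OreLocalization.numeratorHom (S := Submonoid.powers f) (F : R) • (↑u⁻¹ : OreLocalization (Submonoid.powers f) R) • a := by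
      rw [OreLocalization.numeratorHom_apply, OreLocalization.oreDiv_one_smul]
    change f • (↑u⁻¹ : OreLocalization (Submonoid.powers f) R) • a = a
    rw [this, ← hu, smul_smul, Units.mul_inv, one_smul]
  · intro m hm
    change OreLocalization.oreDiv m (1 : Submonoid.powers f) = 0 at hm
    obtain ⟨⟨_, n, rfl⟩, v, h1, h2⟩ := OreLocalization.oreDiv_eq_iff.1
      (hm.trans (OreLocalization.zero_def (S := Submonoid.powers f) (X := M)))
    refine ⟨n, ?_⟩
    rw [smul_zero] at h1
    simp only [OneMemClass.coe_one, mul_one] at h2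
    rw [← h2] at h1
    exact h1.symm

end Localization

end

section

section Triangular

variable {K R M : Type} [Field K] [Ring R] [Algebra K R] [AddCommGroup M] [Module K M] [Module R M]
  [IsScalarTower K R M]

lemma smul_smul_comm' (c : K) (r : R) (m : M) : r • c • m = c • r • m := by
  rw [← algebraMap_smul R c m, ← mul_smul, ← Algebra.commutes, mul_smul, algebraMap_smul]

/-- scalar multiplication by an element of an algebra, as a linear map over the ground field. -/
def smulEnd (K : Type) {R M : Type} [Field K] [Ring R] [Algebra K R] [AddCommGroup M] [Module K M]
    [Module R M] [IsScalarTower K R M] (r : R) : Module.End K M where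
  toFun m := r • m
  map_add' := smul_add r
  map_smul' c m := smul_smul_comm' c r m

@[simp] lemma smulEnd_apply (r : R) (m : M) : smulEnd K r m = r • m := rfl

lemma smul_mem_of_adjoin {X : Set R} (hX : Algebra.adjoin K X = ⊤) {Q : Submodule K M}
    (h : ∀ x ∈ X, ∀ m ∈ Q, x • m ∈ Q) (r : R) {m : M} (hm : m ∈ Q) : r • m ∈ Q := by
  have hr : r ∈ Algebra.adjoin K X := by rw [hX]; trivial
  induction hr using Algebra.adjoin_induction generalizing m with
  | mem x hx => exact h x hx m hm
  | algebraMap c => rw [algebraMap_smul]; exact Q.smul_mem c hm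
  | add x y _ _ hx hy => rw [add_smul]; exact Q.add_mem (hx hm) (hy hm)
  | mul x y _ _ hx hy => rw [mul_smul]; exact hx (hy hm)

/-- a cyclic module whose generator spans a line stable under `B` is the span of words
in `N` applied to the generator. -/
lemma smul_mem_of_triangular {B N : Set R} (hgen : Algebra.adjoin K (B ∪ N) = ⊤)
    (hBN : ∀ z ∈ B, ∀ f ∈ N, z * f - f * z ∈ Submodule.span K (B ∪ N)) {u : M}
    (hu : ∀ z ∈ B, ∃ c : K, z • u = c • u) {Q : Submodule K M} (huQ : u ∈ Q)
    (hQ : ∀ f ∈ N, ∀ m ∈ Q, f • m ∈ Q) (r : R) : r • u ∈ Q := by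
  let W : Submodule K M := sInf {Q | u ∈ Q ∧ ∀ f ∈ N, ∀ m ∈ Q, f • m ∈ Q}
  have huW : u ∈ W := Submodule.mem_sInf.2 fun Q h => h.1
  have hNW : ∀ f ∈ N, ∀ m ∈ W, f • m ∈ W := fun f hf m hm =>
    Submodule.mem_sInf.2 fun Q h => h.2 f hf m (Submodule.mem_sInf.1 hm Q h)
  let W' : Submodule K M := W ⊓ ⨅ z ∈ B, W.comap (smulEnd K z)
  have hW' : ∀ {m}, m ∈ W' ↔ m ∈ W ∧ ∀ z ∈ B, z • m ∈ W := by
    intro m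
    simp [W', Submodule.mem_iInf]
  have hle : W ≤ W' := sInf_le ⟨hW'.2 ⟨huW, fun z hz => by
      obtain ⟨c, hc⟩ := hu z hz
      rw [hc]; exact W.smul_mem c huW⟩, fun f hf m hm => by
    rw [hW'] at hm ⊢
    refine ⟨hNW f hf m hm.1, fun z hz => ?_⟩
    have h1 : ∀ y ∈ Submodule.span K (B ∪ N), y • m ∈ W := by
      intro y hy
      induction hy using Submodule.span_induction with
      | mem y hy => exact hy.elim (hm.2 y) (fun h => hNW y h m hm.1)
      | zero => rw [zero_smul]; exact W.zero_mem
      | add a b _ _ ha hb => rw [add_smul]; exact W.add_mem ha hb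
      | smul c a _ ha => rw [smul_assoc]; exact W.smul_mem c ha
    have h2 := W.add_mem (h1 _ (hBN z hz f hf)) (hNW f hf _ (hm.2 z hz))
    rwa [sub_smul, mul_smul, mul_smul, sub_add_cancel] at h2⟩
  have hWQ : W ≤ Q := sInf_le ⟨huQ, hQ⟩
  exact hWQ (smul_mem_of_adjoin hgen (fun x hx m hm =>
    hx.elim ((hW'.1 (hle hm)).2 x) (fun h => hNW x h m hm)) r huW)

end Triangular

open Module in
/-- a finite root system with root vectors in an associative algebra, coroots and a Casimir
element. -/
structure RootAlg (K 𝔥 R : Type) [Field K] [CharZero K] [AddCommGroup 𝔥] [Module K 𝔥] [Ring R]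
    [Algebra K R] where
  Φ : Finset (Dual K 𝔥)
  ι : 𝔥 →ₗ[K] R
  e : Dual K 𝔥 → R
  co : Dual K 𝔥 → 𝔥
  b : Dual K 𝔥 → ℚ
  I : Type
  fin : Fintype I
  t : I → 𝔥
  t' : I → 𝔥
  ι_comm : ∀ a b, ι a * ι b = ι b * ι a
  ι_e : ∀ a, ∀ γ ∈ Φ, ι a * e γ = e γ * ι a + γ a • e γ
  e_of_notMem : ∀ γ ∉ Φ, e γ = 0
  e_e : ∀ γ ∈ Φ, ∀ δ ∈ Φ, γ + δ ≠ 0 → ∃ c : K, e γ * e δ = e δ * e γ + c • e (γ + δ)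
  e_neg : ∀ γ ∈ Φ, e γ * e (-γ) = e (-γ) * e γ + ι (co γ)
  zero_notMem : 0 ∉ Φ
  neg_mem : ∀ γ ∈ Φ, -γ ∈ Φ
  two : ∀ γ ∈ Φ, γ (co γ) = 2
  reflect : ∀ γ ∈ Φ, ∀ δ ∈ Φ, δ - δ (co γ) • γ ∈ Φ
  gen : Algebra.adjoin K (Set.range ι ∪ e '' Φ) = ⊤
  nil : ∀ γ ∈ Φ, ∀ δ ∈ Φ, AdNil (e γ) (e δ)
  b_pos : ∀ γ ∈ Φ, 0 < b γ
  sum_t : ∀ γ ∈ Φ, ∑ k, γ (t k) • t' k = (b γ : K) • co γ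
  sum_t' : ∀ γ ∈ Φ, ∑ k, γ (t' k) • t k = (b γ : K) • co γ
  casimir_comm : ∀ r, (∑ k, ι (t k) * ι (t' k) + ∑ γ ∈ Φ, (b γ : K) • (e γ * e (-γ))) * r
    = r * (∑ k, ι (t k) * ι (t' k) + ∑ γ ∈ Φ, (b γ : K) • (e γ * e (-γ)))
  posdef : ∀ s : Multiset (Dual K 𝔥), (∀ γ ∈ s, γ ∈ Φ) → s.sum ≠ 0 →
    ∃ q : ℚ, 0 < q ∧ ∑ k, s.sum (t k) * s.sum (t' k) = q

namespace RootAlg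

open Module

variable {K 𝔥 R : Type} [Field K] [CharZero K] [AddCommGroup 𝔥] [Module K 𝔥] [Ring R] [Algebra K R]

attribute [instance] RootAlg.fin

variable (D : RootAlg K 𝔥 R)

/-- the bilinear form on the dual. -/
def form (x y : Dual K 𝔥) : K := ∑ k, x (D.t k) * y (D.t' k)

variable {x y γ δ α : Dual K 𝔥}

lemma form_add_left (x x' y : Dual K 𝔥) : D.form (x + x') y = D.form x y + D.form x' y := by
  simp [form, add_mul, Finset.sum_add_distrib]

lemma form_add_right (x y y' : Dual K 𝔥) : D.form x (y + y') = D.form x y + D.form x y' := by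
  simp [form, mul_add, Finset.sum_add_distrib]

lemma form_smul_left (c : K) (x y : Dual K 𝔥) : D.form (c • x) y = c * D.form x y := by
  simp [form, Finset.mul_sum, mul_assoc]

lemma form_smul_right (c : K) (x y : Dual K 𝔥) : D.form x (c • y) = c * D.form x y := by
  simp [form, Finset.mul_sum, mul_left_comm]

lemma form_zero_right (x : Dual K 𝔥) : D.form x 0 = 0 := by simp [form]

lemma form_zero_left (x : Dual K 𝔥) : D.form 0 x = 0 := by simp [form]

lemma form_sub_left (x x' y : Dual K 𝔥) : D.form (x - x') y = D.form x y - D.form x' y := by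
  simp [form, sub_mul, Finset.sum_sub_distrib]

lemma form_sub_right (x y y' : Dual K 𝔥) : D.form x (y - y') = D.form x y - D.form x y' := by
  simp [form, mul_sub, Finset.sum_sub_distrib]

lemma form_root_left (hγ : γ ∈ D.Φ) (y : Dual K 𝔥) : D.form γ y = D.b γ * y (D.co γ) := by
  have := congrArg y (D.sum_t γ hγ)
  simpa [form] using this

lemma form_root_right (hγ : γ ∈ D.Φ) (y : Dual K 𝔥) : D.form y γ = D.b γ * y (D.co γ) := by
  have := congrArg y (D.sum_t' γ hγ)
  simpa [form, mul_comm] using this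

lemma b_ne_zero (hγ : γ ∈ D.Φ) : (D.b γ : K) ≠ 0 := by
  exact_mod_cast (D.b_pos γ hγ).ne'

lemma ne_zero (hγ : γ ∈ D.Φ) : γ ≠ 0 := fun h => D.zero_notMem (h ▸ hγ)

/-- the reflection in a root. -/
def refl (γ x : Dual K 𝔥) : Dual K 𝔥 := x - x (D.co γ) • γ

lemma refl_refl (hγ : γ ∈ D.Φ) (x : Dual K 𝔥) : D.refl γ (D.refl γ x) = x := by
  simp only [refl, LinearMap.sub_apply, LinearMap.smul_apply, D.two γ hγ, smul_eq_mul]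
  module

lemma refl_self (hγ : γ ∈ D.Φ) : D.refl γ γ = -γ := by
  rw [refl, D.two γ hγ]; module

lemma refl_sub (γ x y : Dual K 𝔥) : D.refl γ (x - y) = D.refl γ x - D.refl γ y := by
  simp only [refl, LinearMap.sub_apply]; module

lemma refl_add (γ x y : Dual K 𝔥) : D.refl γ (x + y) = D.refl γ x + D.refl γ y := by
  simp only [refl, LinearMap.add_apply]; module

lemma refl_neg (γ x : Dual K 𝔥) : D.refl γ (-x) = -D.refl γ x := by
  simp only [refl, LinearMap.neg_apply]; module

lemma refl_smul (γ x : Dual K 𝔥) (c : K) : D.refl γ (c • x) = c • D.refl γ x := by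
  simp only [refl, LinearMap.smul_apply, smul_eq_mul]; module

lemma form_refl_left (hγ : γ ∈ D.Φ) (x y : Dual K 𝔥) :
    D.form (D.refl γ x) y = D.form x (D.refl γ y) := by
  rw [refl, refl, form_sub_left, form_sub_right, form_smul_left, form_smul_right,
    D.form_root_left hγ, D.form_root_right hγ]
  ring

lemma form_refl (hγ : γ ∈ D.Φ) (x y : Dual K 𝔥) :
    D.form (D.refl γ x) (D.refl γ y) = D.form x y := by
  rw [D.form_refl_left hγ, D.refl_refl hγ]

lemma refl_mem (hγ : γ ∈ D.Φ) (hδ : δ ∈ D.Φ) : D.refl γ δ ∈ D.Φ := D.reflect γ hγ δ hδ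

/-- coroots are equivariant under reflections, as seen by any functional. -/
lemma refl_apply_co_refl (hγ : γ ∈ D.Φ) (hδ : δ ∈ D.Φ) (x : Dual K 𝔥) :
    (D.refl γ x) (D.co (D.refl γ δ)) = x (D.co δ) := by
  have hm := D.refl_mem hγ hδ
  have h1 := D.form_root_right hm (D.refl γ δ)
  have h2 := D.form_root_right hδ δ
  rw [D.form_refl hγ, h2, D.two _ hm, D.two _ hδ] at h1
  have h3 := D.form_root_right hm (D.refl γ x)
  rw [D.form_refl hγ, D.form_root_right hδ] at h3
  have h4 : (D.b δ : K) = D.b (D.refl γ δ) := mul_right_cancel₀ two_ne_zero h1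
  rw [h4] at h3
  exact (mul_left_cancel₀ (D.b_ne_zero hm) h3).symm

lemma refl_conj (hγ : γ ∈ D.Φ) (hδ : δ ∈ D.Φ) (x : Dual K 𝔥) :
    D.refl (D.refl γ δ) (D.refl γ x) = D.refl γ (D.refl δ x) := by
  rw [refl, D.refl_apply_co_refl hγ hδ]
  conv_rhs => rw [refl.eq_1 D δ, D.refl_sub, D.refl_smul]

/-- a positive system `P` with simple roots `B`. -/
structure IsPos (P B : Finset (Dual K 𝔥)) : Prop where
  sub : P ⊆ D.Φ
  cover : ∀ γ ∈ D.Φ, γ ∈ P ∨ -γ ∈ P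
  disj : ∀ γ ∈ P, -γ ∉ P
  simple_mem : B ⊆ P
  sum : ∀ γ ∈ P, ∃ s : Multiset (Dual K 𝔥), (∀ δ ∈ s, δ ∈ B) ∧ s.sum = γ
  sub_simple : ∀ α ∈ B, ∀ γ ∈ P, γ ≠ α → γ - α ∈ D.Φ → γ - α ∈ P ∧ γ - α ≠ α
  refl : ∀ α ∈ B, ∀ γ ∈ P, γ ≠ α → D.refl α γ ∈ P

variable {D}

section

variable [DecidableEq (Dual K 𝔥)] {P B : Finset (Dual K 𝔥)}

lemma IsPos.mem_image (h : D.IsPos P B) (hα : α ∈ B) :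
    γ ∈ P.image (D.refl α) ↔ (γ ∈ P ∧ γ ≠ α) ∨ γ = -α := by
  have hΦ := h.sub (h.simple_mem hα)
  constructor
  · intro hγ
    obtain ⟨δ, hδ, rfl⟩ := Finset.mem_image.1 hγ
    by_cases hδα : δ = α
    · right; rw [hδα, D.refl_self hΦ]
    · left
      refine ⟨h.refl α hα δ hδ hδα, fun h1 => ?_⟩
      have h2 : δ = -α := by rw [← D.refl_refl hΦ δ, h1, D.refl_self hΦ]
      exact h.disj α (h.simple_mem hα) (h2 ▸ hδ)
  · rintro (⟨hγ, hne⟩ | rfl)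
    · exact Finset.mem_image.2 ⟨_, h.refl α hα γ hγ hne, D.refl_refl hΦ γ⟩
    · exact Finset.mem_image.2 ⟨α, h.simple_mem hα, D.refl_self hΦ⟩

lemma IsPos.image (h : D.IsPos P B) (hα : α ∈ B) :
    D.IsPos (P.image (D.refl α)) (B.image (D.refl α)) := by
  have hΦ := h.sub (h.simple_mem hα)
  have hinj : Function.Injective (D.refl α) :=
    (show Function.Involutive (D.refl α) from D.refl_refl hΦ).injective
  refine ⟨fun γ hγ => ?_, fun γ hγ => ?_, fun γ hγ hγ' => ?_, Finset.image_subset_image h.simple_mem,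
    fun γ hγ => ?_, ?_, ?_⟩
  · obtain ⟨δ, hδ, rfl⟩ := Finset.mem_image.1 hγ
    exact D.refl_mem hΦ (h.sub hδ)
  · rcases h.cover _ (D.refl_mem hΦ hγ) with h1 | h1
    · exact .inl (Finset.mem_image.2 ⟨_, h1, D.refl_refl hΦ γ⟩)
    · exact .inr (Finset.mem_image.2 ⟨_, h1, by rw [D.refl_neg, D.refl_refl hΦ]⟩)
  · obtain ⟨δ, hδ, rfl⟩ := Finset.mem_image.1 hγ
    obtain ⟨ε, hε, h1⟩ := Finset.mem_image.1 hγ'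
    rw [← D.refl_neg] at h1
    exact h.disj δ hδ (hinj h1 ▸ hε)
  · obtain ⟨δ, hδ, rfl⟩ := Finset.mem_image.1 hγ
    obtain ⟨s, hs, rfl⟩ := h.sum δ hδ
    refine ⟨s.map (D.refl α), fun ε hε => ?_, ?_⟩
    · obtain ⟨ζ, hζ, rfl⟩ := Multiset.mem_map.1 hε
      exact Finset.mem_image_of_mem _ (hs ζ hζ)
    · have h0 : D.refl α 0 = 0 := by simp [RootAlg.refl]
      exact (map_multiset_sum (⟨⟨D.refl α, h0⟩, D.refl_add α⟩ : Dual K 𝔥 →+ Dual K 𝔥) s).symm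
  · intro β hβ γ hγ hne hm
    obtain ⟨β', hβ', rfl⟩ := Finset.mem_image.1 hβ
    obtain ⟨γ', hγ', rfl⟩ := Finset.mem_image.1 hγ
    rw [← D.refl_sub] at hm ⊢
    have h1 := D.refl_mem hΦ hm
    rw [D.refl_refl hΦ] at h1
    obtain ⟨h2, h3⟩ := h.sub_simple β' hβ' γ' hγ' (fun h => hne (h ▸ rfl)) h1
    exact ⟨Finset.mem_image_of_mem _ h2, fun h4 => h3 (hinj h4)⟩
  · intro β hβ γ hγ hne
    obtain ⟨β', hβ', rfl⟩ := Finset.mem_image.1 hβ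
    obtain ⟨γ', hγ', rfl⟩ := Finset.mem_image.1 hγ
    rw [D.refl_conj hΦ (h.sub (h.simple_mem hβ'))]
    exact Finset.mem_image_of_mem _ (h.refl β' hβ' γ' hγ' (fun h => hne (h ▸ rfl)))

end

end RootAlg

end

section

open Module

namespace AdNil

variable {R M : Type} [Ring R] [AddCommGroup M] [Module R M] {f r : R}

lemma exists_pow_smul_eq_zero (h : AdNil f r) {u : M} (hu : f • u = 0) : ∃ n : ℕ, f ^ n • r • u = 0 := by
  induction h with
  | zero => exact ⟨0, by simp⟩
  | @step r _ ih =>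
    obtain ⟨n, hn⟩ := ih
    refine ⟨n + 1, ?_⟩
    rwa [sub_smul, mul_smul r f, hu, smul_zero, sub_zero, smul_smul, ← mul_assoc, ← pow_succ,
      ← smul_smul] at hn

/-- the submodule generated by the inverse powers of a locally ad-nilpotent element applied to a
vector is stable under the inverse. -/
lemma iterate_inv_mem {G : M → M} (hG : ∀ m, f • G m = m) (hGf : ∀ m, G (f • m) = m)
    (hadd : ∀ a b, G (a - b) = G a - G b) {D : Submodule R M} (h : AdNil f r) {d : M}
    (hd : ∀ n : ℕ, G^[n] d ∈ D) (n : ℕ) : G^[n] (r • d) ∈ D := by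
  have hsub : ∀ n a b, G^[n] (a - b) = G^[n] a - G^[n] b := by
    intro n
    induction n with
    | zero => intro a b; rfl
    | succ n ih => intro a b; rw [Function.iterate_succ_apply, hadd, ih]; rfl
  induction h generalizing d n with
  | zero =>
    have h0 : G 0 = 0 := by simpa using hadd 0 0
    have : G^[n] 0 = 0 := by
      induction n with
      | zero => rfl
      | succ n ih => rw [Function.iterate_succ_apply, h0, ih]
    rw [zero_smul, this]; exact D.zero_mem
  | @step r _ ih =>
    induction n generalizing d with
    | zero => exact D.smul_mem r (hd 0)
    | succ n ih' =>
      have h1 : ∀ k : ℕ, G^[k] (G d) ∈ D := fun k => hd (k + 1)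
      have h2 : r • d = f • (r • G d) - (f * r - r * f) • G d := by
        rw [sub_smul, mul_smul, mul_smul, hG]; abel
      rw [h2, hsub, Function.iterate_succ_apply, hGf]
      exact D.sub_mem (ih' h1) (ih h1 _)

end AdNil

namespace RootAlg

variable {K 𝔥 R : Type} [Field K] [CharZero K] [AddCommGroup 𝔥] [Module K 𝔥] [Ring R] [Algebra K R]
variable {D : RootAlg K 𝔥 R} {γ δ α lam mu : Dual K 𝔥}

lemma adNil (hγ : γ ∈ D.Φ) (r : R) : AdNil (D.e γ) r := by
  have hr : r ∈ Algebra.adjoin K (Set.range D.ι ∪ D.e '' D.Φ) := by rw [D.gen]; trivial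
  induction hr using Algebra.adjoin_induction with
  | mem x hx =>
    rcases hx with ⟨a, rfl⟩ | ⟨δ, hδ, rfl⟩
    · refine AdNil.step ?_
      rw [D.ι_e a γ hγ, sub_add_cancel_left, ← smul_neg]
      exact AdNil.of_commute (by simp)
    · exact D.nil γ hγ δ hδ
  | algebraMap c => exact AdNil.of_commute (Algebra.commutes c _).symm
  | add x y _ _ hx hy => exact hx.add hy
  | mul x y _ _ hx hy => exact hx.mul hy

section Modules

variable {M : Type} [AddCommGroup M] [Module K M] [Module R M] [IsScalarTower K R M]

variable (D) in
/-- `u` is a highest weight vector for the positive system `P`. -/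
structure IsHW (P : Finset (Dual K 𝔥)) (lam : Dual K 𝔥) (u : M) : Prop where
  kill : ∀ γ ∈ P, D.e γ • u = 0
  wt : ∀ a, D.ι a • u = lam a • u

variable {P B : Finset (Dual K 𝔥)} {u v : M}

lemma exists_sum_eq (hP : D.IsPos P B) (hu : D.IsHW P lam u) (hv : ∀ a, D.ι a • v = mu a • v)
    (hv0 : v ≠ 0) {r : R} (hr : v = r • u) :
    ∃ s : Multiset (Dual K 𝔥), (∀ γ ∈ s, γ ∈ P) ∧ lam - mu = s.sum := by
  classical
  let A : Set (Dual K 𝔥) := {ν | ∃ s : Multiset (Dual K 𝔥), (∀ γ ∈ s, γ ∈ P) ∧ lam - ν = s.sum}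
  let W : Dual K 𝔥 → Submodule K M := fun ν =>
    ⨅ a : 𝔥, LinearMap.ker (smulEnd K (D.ι a) - ν a • (1 : Module.End K M))
  have hW : ∀ {ν : Dual K 𝔥} {m : M}, m ∈ W ν ↔ ∀ a, D.ι a • m = ν a • m := by
    intro ν m
    simp [W, Submodule.mem_iInf, sub_eq_zero]
  let Q : Submodule K M := ⨆ ν ∈ A, W ν
  by_contra hmu
  refine hv0 ?_
  have hinj : Function.Injective fun (ν : Dual K 𝔥) (a : 𝔥) => ν a := DFunLike.coe_injective
  have := mem_of_mem_sup (op := fun a => smulEnd K (M := M) (D.ι a)) hinj (N := ⊥)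
    (fun a v hv => by rw [(Submodule.mem_bot K).1 hv, map_zero]; exact Submodule.zero_mem _)
    W (fun ν m hm a => hW.1 hm a) (A := A) hmu (x := v) (hW.2 hv) ?_
  · exact (Submodule.mem_bot K).1 this
  rw [bot_sup_eq, hr]
  let Bs : Set R := D.e '' P ∪ Set.range D.ι
  let Ns : Set R := (fun γ => D.e (-γ)) '' P
  have hrt : ∀ γ, D.e γ ∈ Submodule.span K (Bs ∪ Ns) := by
    intro γ
    by_cases hγ : γ ∈ D.Φ
    · refine Submodule.subset_span ?_
      rcases hP.cover γ hγ with h | h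
      · exact .inl (.inl ⟨γ, h, rfl⟩)
      · exact .inr ⟨-γ, h, by simp⟩
    · rw [D.e_of_notMem γ hγ]; exact Submodule.zero_mem _
  have hι : ∀ a, D.ι a ∈ Submodule.span K (Bs ∪ Ns) := fun a =>
    Submodule.subset_span (.inl (.inr ⟨a, rfl⟩))
  refine smul_mem_of_triangular (K := K) (B := Bs) (N := Ns) ?_ ?_ ?_ ?_ ?_ r
  · rw [eq_top_iff, ← D.gen, Algebra.adjoin_le_iff]
    rintro x (⟨a, rfl⟩ | ⟨γ, hγ, rfl⟩)
    · exact Algebra.span_le_adjoin K _ (hι a)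
    · exact Algebra.span_le_adjoin K _ (hrt γ)
  · rintro z (⟨γ, hγ, rfl⟩ | ⟨a, rfl⟩) _ ⟨δ, hδ, rfl⟩
    · have hδ' := D.neg_mem δ (hP.sub hδ)
      by_cases h : γ = δ
      · subst h
        simp only
        rw [D.e_neg γ (hP.sub hγ), add_sub_cancel_left]
        exact hι _
      · obtain ⟨c, hc⟩ := D.e_e γ (hP.sub hγ) (-δ) hδ' (fun h' => h (by
          rwa [← sub_eq_add_neg, sub_eq_zero] at h'))
        simp only
        rw [hc, add_sub_cancel_left]
        exact Submodule.smul_mem _ _ (hrt _)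
    · simp only
      rw [D.ι_e a _ (D.neg_mem δ (hP.sub hδ)), add_sub_cancel_left]
      exact Submodule.smul_mem _ _ (hrt _)
  · rintro z (⟨γ, hγ, rfl⟩ | ⟨a, rfl⟩)
    · exact ⟨0, by rw [hu.kill γ hγ, zero_smul]⟩
    · exact ⟨_, hu.wt a⟩
  · exact Submodule.mem_iSup_of_mem lam (Submodule.mem_iSup_of_mem ⟨0, by simp, by simp⟩ (hW.2 hu.wt))
  · rintro _ ⟨δ, hδ, rfl⟩ m hm
    have : Q ≤ Q.comap (smulEnd K (D.e (-δ))) := by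
      refine iSup₂_le fun ν hν m hm => ?_
      obtain ⟨s, hs, h⟩ := hν
      refine Submodule.mem_iSup_of_mem (ν - δ) (Submodule.mem_iSup_of_mem ⟨δ ::ₘ s, ?_, ?_⟩ (hW.2 ?_))
      · simpa using ⟨hδ, hs⟩
      · rw [Multiset.sum_cons, ← h]; abel
      · intro a
        rw [smulEnd_apply, smul_smul, D.ι_e a _ (D.neg_mem δ (hP.sub hδ)), add_smul, mul_smul,
          hW.1 hm a, smul_smul_comm', smul_assoc, ← add_smul, LinearMap.neg_apply,
          LinearMap.sub_apply, sub_eq_add_neg]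
    exact this hm

variable (D) in
/-- the Casimir element. -/
def casimir : R := ∑ k, D.ι (D.t k) * D.ι (D.t' k) + ∑ γ ∈ D.Φ, (D.b γ : K) • (D.e γ * D.e (-γ))

lemma casimir_smul (hP : D.IsPos P B) (hu : D.IsHW P lam u) :
    D.casimir • u = (D.form lam lam + ∑ γ ∈ P, D.form γ lam) • u := by
  classical
  rw [casimir, add_smul, add_smul, Finset.sum_smul, Finset.sum_smul, Finset.sum_smul]
  congr 1
  · rw [form, Finset.sum_smul]
    refine Finset.sum_congr rfl fun k _ => ?_
    rw [mul_smul, hu.wt, smul_smul_comm', hu.wt, smul_smul, mul_comm]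
  · rw [← Finset.sum_subset hP.sub]
    · refine Finset.sum_congr rfl fun γ hγ => ?_
      rw [smul_assoc, D.e_neg γ (hP.sub hγ), add_smul, mul_smul, hu.kill γ hγ, smul_zero, zero_add,
        hu.wt, smul_smul, D.form_root_left (hP.sub hγ)]
    · intro γ hγ hγP
      rw [smul_assoc, mul_smul, hu.kill (-γ) ((hP.cover γ hγ).resolve_left hγP), smul_zero, smul_zero]

lemma casimir_eq (hP : D.IsPos P B) (hu : D.IsHW P lam u) (hv : D.IsHW P mu v)
    (hv0 : v ≠ 0) {r : R} (hr : v = r • u) :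
    D.form lam lam + ∑ γ ∈ P, D.form γ lam = D.form mu mu + ∑ γ ∈ P, D.form γ mu := by
  have h1 := casimir_smul hP hv
  rw [hr, smul_smul, casimir, D.casimir_comm, ← casimir, ← smul_smul, casimir_smul hP hu,
    smul_smul_comm', ← hr] at h1
  by_contra h
  exact hv0 ((smul_eq_zero.1 (by rw [sub_smul, h1, sub_self] : ((D.form lam lam + ∑ γ ∈ P, D.form γ lam)
    - (D.form mu mu + ∑ γ ∈ P, D.form γ mu)) • v = 0)).resolve_left (sub_ne_zero.2 h))

end Modules

section

variable {P B : Finset (Dual K 𝔥)}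

lemma two_rho_refl [DecidableEq (Dual K 𝔥)] (h : D.IsPos P B) (hα : α ∈ B) :
    ∑ γ ∈ P.image (D.refl α), γ = ∑ γ ∈ P, γ - (2 : K) • α := by
  have hαP := h.simple_mem hα
  have : P.image (D.refl α) = insert (-α) (P.erase α) := by
    ext γ
    rw [h.mem_image hα, Finset.mem_insert, Finset.mem_erase]
    tauto
  rw [this, Finset.sum_insert (fun h' => h.disj α hαP (Finset.mem_of_mem_erase h')),
    ← Finset.add_sum_erase P _ hαP]
  module

lemma two_rho_simple (h : D.IsPos P B) (hα : α ∈ B) : (∑ γ ∈ P, γ) (D.co α) = 2 := by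
  classical
  have hΦ := h.sub (h.simple_mem hα)
  have h1 := two_rho_refl h hα
  rw [Finset.sum_image fun x _ y _ hxy => by rw [← D.refl_refl hΦ x, hxy, D.refl_refl hΦ]] at h1
  have h2 : ∑ γ ∈ P, D.refl α γ = D.refl α (∑ γ ∈ P, γ) := by
    have h0 : D.refl α 0 = 0 := by simp [RootAlg.refl]
    exact (map_sum (⟨⟨D.refl α, h0⟩, D.refl_add α⟩ : Dual K 𝔥 →+ Dual K 𝔥) _ _).symm
  rw [h2, refl, sub_right_inj] at h1
  have h3 := congrArg (fun x : Dual K 𝔥 => x (D.co α)) h1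
  simp only [LinearMap.smul_apply, D.two α hΦ, smul_eq_mul] at h3
  exact mul_right_cancel₀ two_ne_zero h3

lemma apply_co_neg (hα : α ∈ D.Φ) (x : Dual K 𝔥) : x (D.co (-α)) = -x (D.co α) := by
  have := D.refl_apply_co_refl hα hα (D.refl α x)
  rw [D.refl_refl hα, D.refl_self hα] at this
  rw [this, refl, LinearMap.sub_apply, LinearMap.smul_apply, D.two α hα, smul_eq_mul]
  ring

end

end RootAlg

end

section

open Module

namespace RootAlg

variable {K 𝔥 R : Type} [Field K] [CharZero K] [AddCommGroup 𝔥] [Module K 𝔥] [Ring R] [Algebra K R]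
variable {D : RootAlg K 𝔥 R} {γ δ α lam mu : Dual K 𝔥} {P B : Finset (Dual K 𝔥)}

section Inverse

variable {N : Type} [AddCommGroup N] [Module K N] [Module R N] [IsScalarTower K R N]
  {G : N → N} {u v w : N}

lemma exists_string_end (hα : α ≠ 0) (γ : Dual K 𝔥) : ∃ k : ℕ, γ - (k : K) • α ∉ D.Φ := by
  by_contra! h
  refine Set.infinite_of_injective_forall_mem (f := fun k : ℕ => γ - (k : K) • α) ?_ h
    D.Φ.finite_toSet
  intro j k hjk
  have : (j : K) • α = (k : K) • α := sub_right_injective hjk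
  exact Nat.cast_injective (smul_left_injective K hα this)

lemma kill_inv (hP : D.IsPos P B) (hα : α ∈ B) (hinj : Function.Injective fun n : N => D.e (-α) • n)
    (hG : ∀ n, D.e (-α) • G n = n) (hw : ∀ γ ∈ P, γ ≠ α → D.e γ • w = 0) :
    ∀ γ ∈ P, γ ≠ α → D.e γ • G w = 0 := by
  have hαΦ := hP.sub (hP.simple_mem hα)
  suffices ∀ k : ℕ, ∀ γ ∈ P, γ ≠ α → γ - (k : K) • α ∉ D.Φ → D.e γ • G w = 0 by
    intro γ hγ hne
    obtain ⟨k, hk⟩ := exists_string_end (D := D) (D.ne_zero hαΦ) γ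
    exact this k γ hγ hne hk
  intro k
  induction k with
  | zero => intro γ hγ _ h; exact absurd (hP.sub hγ) (by simpa using h)
  | succ k ih =>
    intro γ hγ hne h
    obtain ⟨c, hc⟩ := D.e_e γ (hP.sub hγ) (-α) (D.neg_mem α hαΦ) (fun h' => hne (by
      rwa [← sub_eq_add_neg, sub_eq_zero] at h'))
    have h1 : D.e (γ + -α) • G w = 0 := by
      rw [← sub_eq_add_neg]
      by_cases hm : γ - α ∈ D.Φ
      · obtain ⟨h2, h3⟩ := hP.sub_simple α hα γ hγ hne hm
        refine ih _ h2 h3 fun h4 => h ?_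
        convert h4 using 1
        push_cast; module
      · rw [D.e_of_notMem _ hm, zero_smul]
    have h2 := congrArg (fun r : R => r • G w) hc
    simp only [add_smul, smul_assoc, h1, smul_zero, add_zero, mul_smul] at h2
    rw [hG, hw γ hγ hne] at h2
    exact hinj (by simp only [← h2, smul_zero])

lemma wt_inv (hα : α ∈ D.Φ) (hinj : Function.Injective fun n : N => D.e (-α) • n)
    (hG : ∀ n, D.e (-α) • G n = n) (hw : ∀ a, D.ι a • w = lam a • w) (a : 𝔥) :
    D.ι a • G w = (lam + α) a • G w := by
  apply hinj
  have h2 := congrArg (fun r : R => r • G w) (D.ι_e a _ (D.neg_mem α hα))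
  simp only [add_smul, smul_assoc, mul_smul] at h2
  simp only
  rw [hG, hw, LinearMap.neg_apply, neg_smul] at h2
  rw [smul_smul_comm', hG, LinearMap.add_apply, add_smul, h2]
  abel

lemma wt_iterate_inv (hα : α ∈ D.Φ) (hinj : Function.Injective fun n : N => D.e (-α) • n)
    (hG : ∀ n, D.e (-α) • G n = n) (hw : ∀ a, D.ι a • w = lam a • w) (n : ℕ) :
    ∀ a, D.ι a • G^[n] w = (lam + (n : K) • α) a • G^[n] w := by
  induction n with
  | zero => intro a; simpa using hw a
  | succ n ih =>
    intro a
    rw [Function.iterate_succ_apply', wt_inv hα hinj hG ih a]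
    congr 1
    push_cast
    simp only [LinearMap.add_apply, LinearMap.smul_apply, smul_eq_mul]
    ring

lemma e_iterate_inv (hα : α ∈ D.Φ) (hinj : Function.Injective fun n : N => D.e (-α) • n)
    (hG : ∀ n, D.e (-α) • G n = n) (hk : D.e α • w = 0) (hw : ∀ a, D.ι a • w = lam a • w) (n : ℕ) :
    D.e α • G^[n] w = (-(n * (lam (D.co α) + 1 + n)) : K) • G^[n + 1] w := by
  induction n with
  | zero => simpa using hk
  | succ n ih =>
    apply hinj
    simp only
    have h2 := congrArg (fun r : R => r • G^[n + 1] w) (D.e_neg α hα)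
    simp only [add_smul, mul_smul] at h2
    rw [wt_iterate_inv hα hinj hG hw (n + 1), Function.iterate_succ_apply', hG, ih,
      ← Function.iterate_succ_apply' G, LinearMap.add_apply, LinearMap.smul_apply, D.two α hα] at h2
    rw [smul_smul_comm', Function.iterate_succ_apply' G (n + 1), hG, ← sub_eq_iff_eq_add.2 h2, ← sub_smul]
    congr 1
    push_cast
    simp only [smul_eq_mul]
    ring

lemma isHW_iterate_inv (hP : D.IsPos P B) (hα : α ∈ B)
    (hinj : Function.Injective fun n : N => D.e (-α) • n)
    (hG : ∀ n, D.e (-α) • G n = n) (hw : D.IsHW P lam w) {n : ℕ}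
    (hn : lam (D.co α) + 1 + n = 0) : D.IsHW P (lam + (n : K) • α) (G^[n] w) := by
  have hαΦ := hP.sub (hP.simple_mem hα)
  have h1 : ∀ n : ℕ, ∀ γ ∈ P, γ ≠ α → D.e γ • G^[n] w = 0 := by
    intro n
    induction n with
    | zero => intro γ hγ _; exact hw.kill γ hγ
    | succ n ih =>
      rw [Function.iterate_succ_apply']
      exact kill_inv hP hα hinj hG ih
  refine ⟨fun γ hγ => ?_, wt_iterate_inv hαΦ hinj hG hw.wt n⟩
  by_cases h : γ = α
  · rw [h, e_iterate_inv hαΦ hinj hG (hw.kill α (hP.simple_mem hα)) hw.wt, hn, mul_zero, neg_zero,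
      zero_smul]
  · exact h1 n γ hγ h

end Inverse

variable (D) in
/-- a vector of highest weight `mu` occurs in a module generated by a vector of highest weight
`lam`. -/
def Link (P : Finset (Dual K 𝔥)) (lam mu : Dual K 𝔥) : Prop :=
  ∃ (M : Type) (_ : AddCommGroup M) (_ : Module K M) (_ : Module R M) (_ : IsScalarTower K R M)
    (u v : M), D.IsHW P lam u ∧ D.IsHW P mu v ∧ v ≠ 0 ∧ ∃ r : R, v = r • u

variable [DecidableEq (Dual K 𝔥)]

lemma link_or_link {N : Type} [AddCommGroup N] [Module K N] [Module R N] [IsScalarTower K R N]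
    {u v : N} (hP : D.IsPos P B) (hα : α ∈ B) (hb : Function.Bijective fun n : N => D.e (-α) • n)
    (hu : D.IsHW P lam u) (hv : D.IsHW P mu v) (hv0 : v ≠ 0) {r : R} (hr : v = r • u)
    (hlam : ∀ n : ℕ, lam (D.co α) + 1 + (n + 1) ≠ 0) :
    D.Link (P.image (D.refl α)) (lam + α) (mu + α) ∨
      D.Link P lam (mu - (mu (D.co α) + 1) • α) := by
  have hαP := hP.simple_mem hα
  have hαΦ := hP.sub hαP
  obtain ⟨hinj, hsurj⟩ := hb
  choose G hG using hsurj
  simp only at hG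
  have hGf : ∀ n, G (D.e (-α) • n) = n := fun n => hinj (hG _)
  have hGsub : ∀ a b, G (a - b) = G a - G b := fun a b => hinj (by
    simp only [smul_sub, hG])
  let U : Submodule R N := Submodule.span R {u}
  have huU : u ∈ U := Submodule.mem_span_singleton_self u
  have hkill : ∀ {w : N} {nu : Dual K 𝔥}, D.IsHW P nu w → ∀ γ ∈ P, γ ≠ α → D.e γ • G w = 0 :=
    fun hw => kill_inv hP hα hinj hG fun γ hγ _ => hw.kill γ hγ
  by_cases hvU : G v ∈ U
  · right
    have hne : ∀ n : ℕ, G^[n] v ≠ 0 := by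
      intro n
      induction n with
      | zero => exact hv0
      | succ n ih =>
        rw [Function.iterate_succ_apply']
        intro h
        rw [← hG (G^[n] v), h, smul_zero] at ih
        exact ih rfl
    have he := e_iterate_inv hαΦ hinj hG (hv.kill α hαP) hv.wt
    have hex : ∃ n : ℕ, mu (D.co α) + 1 + (n + 1 : ℕ) = 0 := by
      by_contra! hno
      obtain ⟨r', hr'⟩ := Submodule.mem_span_singleton.1 hvU
      obtain ⟨n, hn⟩ := (adNil hαΦ r').exists_pow_smul_eq_zero (hu.kill α hαP)
      rw [hr'] at hn
      have : ∀ m : ℕ, ∃ c : K, c ≠ 0 ∧ D.e α ^ m • G v = c • G^[m + 1] v := by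
        intro m
        induction m with
        | zero => exact ⟨1, one_ne_zero, by simp⟩
        | succ m ih =>
          obtain ⟨c, hc, h⟩ := ih
          refine ⟨c * -((m + 1 : ℕ) * (mu (D.co α) + 1 + (m + 1 : ℕ))),
            mul_ne_zero hc (neg_ne_zero.2 (mul_ne_zero (Nat.cast_ne_zero.2 m.succ_ne_zero) (hno m))), ?_⟩
          rw [pow_succ', mul_smul, h, smul_smul_comm', he, smul_smul]
      obtain ⟨c, hc, h⟩ := this n
      rw [hn] at h
      exact (smul_ne_zero hc (hne _)) h.symm
    classical
    let n := Nat.find hex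
    have hn : mu (D.co α) + 1 + (n + 1 : ℕ) = 0 := Nat.find_spec hex
    have hmem : ∀ m ≤ n, G^[m + 1] v ∈ U := by
      intro m
      induction m with
      | zero => intro _; exact hvU
      | succ m ih =>
        intro hm
        have h1 := U.smul_mem (D.e α) (ih (by omega))
        rw [he] at h1
        have hc : (-((m + 1 : ℕ) * (mu (D.co α) + 1 + (m + 1 : ℕ))) : K) ≠ 0 :=
          neg_ne_zero.2 (mul_ne_zero (Nat.cast_ne_zero.2 m.succ_ne_zero)
            (Nat.find_min hex (show m < n by omega)))
        have h2 := (U.restrictScalars K).smul_mem (-((m + 1 : ℕ) * (mu (D.co α) + 1 + (m + 1 : ℕ))))⁻¹ h1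
        rwa [smul_smul, inv_mul_cancel₀ hc, one_smul] at h2
    obtain ⟨r', hr'⟩ := Submodule.mem_span_singleton.1 (hmem n le_rfl)
    refine ⟨N, _, _, _, ‹_›, u, G^[n + 1] v, hu, ?_, hne _, r', hr'.symm⟩
    have := isHW_iterate_inv hP hα hinj hG hv hn
    rwa [show ((n + 1 : ℕ) : K) = -(mu (D.co α) + 1) by linear_combination hn,
      show mu + -(mu (D.co α) + 1) • α = mu - (mu (D.co α) + 1) • α by module] at this
  · left
    have hmk : ∀ {w : N} {nu : Dual K 𝔥}, D.IsHW P nu w → w ∈ U →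
        D.IsHW (P.image (D.refl α)) (nu + α) (U.mkQ (G w)) := by
      intro w nu hw hwU
      refine ⟨fun γ hγ => ?_, fun a => ?_⟩
      · rw [← map_smul]
        rcases (hP.mem_image hα).1 hγ with ⟨h1, h2⟩ | rfl
        · rw [hkill hw γ h1 h2, map_zero]
        · rw [hG]; exact (Submodule.Quotient.mk_eq_zero U).2 hwU
      · rw [← map_smul, wt_inv hαΦ hinj hG hw.wt a, ← algebraMap_smul R, map_smul, algebraMap_smul]
    have hD : ∀ n : ℕ, G^[n] (G u) ∈ Submodule.span R {G u} := by
      intro n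
      induction n with
      | zero => exact Submodule.mem_span_singleton_self _
      | succ n ih =>
        have h1 := (Submodule.span R {G u}).smul_mem (D.e α) ih
        rw [← Function.iterate_succ_apply, e_iterate_inv hαΦ hinj hG (hu.kill α hαP) hu.wt] at h1
        have hc : (-((n + 1 : ℕ) * (lam (D.co α) + 1 + (n + 1 : ℕ))) : K) ≠ 0 :=
          neg_ne_zero.2 (mul_ne_zero (Nat.cast_ne_zero.2 n.succ_ne_zero) (by
            have := hlam n; push_cast; exact this))
        have h2 := ((Submodule.span R {G u}).restrictScalars K).smul_mem
          (-((n + 1 : ℕ) * (lam (D.co α) + 1 + (n + 1 : ℕ))))⁻¹ h1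
        rwa [smul_smul, inv_mul_cancel₀ hc, one_smul] at h2
    have h3 : G v ∈ Submodule.span R {G u} := by
      have := (adNil (D.neg_mem α hαΦ) (r * D.e (-α))).iterate_inv_mem hG hGf hGsub hD 1
      rwa [mul_smul, hG, ← hr] at this
    obtain ⟨r', hr'⟩ := Submodule.mem_span_singleton.1 h3
    refine ⟨N ⧸ U, inferInstance, inferInstance, inferInstance, inferInstance, U.mkQ (G u), U.mkQ (G v),
      hmk hu huU, hmk hv ?_, ?_, r', by rw [← hr', map_smul]⟩
    · rw [hr]; exact U.smul_mem r huU
    · exact fun h => hvU ((Submodule.Quotient.mk_eq_zero U).1 h)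

/-- reflecting a link in a simple root. -/
theorem Link.move (hP : D.IsPos P B) (hα : α ∈ B) (h : D.Link P lam mu)
    (hmu : ∀ k : ℕ, mu (D.co α) ≠ k) :
    ∃ lam', (lam' = lam ∨ lam' = lam - (lam (D.co α) + 1) • α) ∧
      (D.Link (P.image (D.refl α)) (lam' + α) (mu + α) ∨
        D.Link P lam' (mu - (mu (D.co α) + 1) • α)) := by
  have hαP := hP.simple_mem hα
  have hαΦ := hP.sub hαP
  obtain ⟨M, _, _, _, _, u, v, hu, hv, hv0, r, hr⟩ := h
  obtain ⟨N, _, _, j, hb, hj⟩ := exists_localization (adNil (D.neg_mem α hαΦ)) M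
  let _ : Module K N := Module.compHom N (algebraMap K R)
  have : IsScalarTower K R N := ⟨fun c r n => by
    rw [Algebra.smul_def, mul_smul]; rfl⟩
  have hjK : ∀ (c : K) (m : M), j (c • m) = c • j m := fun c m => by
    rw [← algebraMap_smul R, map_smul, algebraMap_smul]
  have hHW : ∀ {nu : Dual K 𝔥} {w : M}, D.IsHW P nu w → D.IsHW P nu (j w) := fun hw =>
    ⟨fun γ hγ => by rw [← map_smul, hw.kill γ hγ, map_zero],
      fun a => by rw [← map_smul, hw.wt, hjK]⟩
  have hjv : j v ≠ 0 := by
    intro h0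
    obtain ⟨n, hn⟩ := hj v h0
    have ops : Sl2Ops (smulEnd K (M := M) (D.e α)) (smulEnd K (D.e (-α))) (smulEnd K (D.ι (D.co α))) := by
      refine ⟨fun m => ?_, fun m => ?_, fun m => ?_⟩
      · simp only [smulEnd_apply, smul_smul, ← add_smul]; rw [D.e_neg α hαΦ]
      · simp only [smulEnd_apply, smul_smul]
        rw [D.ι_e _ α hαΦ, D.two α hαΦ, add_smul, smul_assoc]
      · simp only [smulEnd_apply, smul_smul]
        rw [D.ι_e _ _ (D.neg_mem α hαΦ), LinearMap.neg_apply, D.two α hαΦ, add_smul, smul_assoc, neg_smul, ← sub_eq_add_neg]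
    have hpow : ∀ (n : ℕ) (x : R) (m : M), (smulEnd K x ^ n) m = x ^ n • m := by
      intro n x m
      induction n with
      | zero => simp
      | succ n ih => rw [pow_succ', Module.End.mul_apply, ih, smulEnd_apply, smul_smul, ← pow_succ']
    have h1 := (ops.pow_e_pow_f (y := v) (hv.wt _) (n := 0)
      (by rw [hpow, zero_add, pow_one, hv.kill α hαP]) n).1
    rw [hpow n _ v, hn, map_zero, pow_zero, Module.End.one_apply] at h1
    refine smul_ne_zero (Sl2Ops.coef_ne_zero fun i _ h2 => hmu i ?_) hv0 h1.symm
    push_cast at h2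
    linear_combination h2
  have hjr : j v = r • j u := by rw [hr, map_smul]
  by_cases hlam : ∃ n : ℕ, lam (D.co α) + 1 + (n + 1 : ℕ) = 0
  · obtain ⟨n, hn⟩ := hlam
    have hinj := hb.1
    choose G hG using hb.2
    simp only at hG
    have hu' := isHW_iterate_inv hP hα hinj hG (hHW hu) hn
    have hpow : ∀ k : ℕ, D.e (-α) ^ k • G^[k] (j u) = j u := by
      intro k
      induction k with
      | zero => simp
      | succ k ih => rw [pow_succ, mul_smul, Function.iterate_succ_apply', hG, ih]
    have hlam' : ((n + 1 : ℕ) : K) = -(lam (D.co α) + 1) := by linear_combination hn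
    refine ⟨lam + ((n + 1 : ℕ) : K) • α, .inr (by rw [hlam']; module),
      link_or_link hP hα hb hu' (hHW hv) hjv (r := r * D.e (-α) ^ (n + 1))
        (by rw [mul_smul, hpow, hjr]) fun k => ?_⟩
    rw [LinearMap.add_apply, LinearMap.smul_apply, D.two α hαΦ, smul_eq_mul]
    have h1 : ((n + 1 + k + 1 : ℕ) : K) ≠ 0 := Nat.cast_ne_zero.2 (by omega)
    intro h2
    apply h1
    push_cast at hn h2 ⊢
    linear_combination h2 - hn
  · exact ⟨lam, .inl rfl, link_or_link hP hα hb (hHW hu) (hHW hv) hjv hjr fun n hn =>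
      hlam ⟨n, by push_cast; exact hn⟩⟩

end RootAlg

end

section

open Module

namespace RootAlg

variable {K 𝔥 R : Type} [Field K] [CharZero K] [AddCommGroup 𝔥] [Module K 𝔥] [Ring R] [Algebra K R]
variable {D : RootAlg K 𝔥 R} {γ δ α lam mu y : Dual K 𝔥} {P B : Finset (Dual K 𝔥)}

/-- the half sum of a set of roots. -/
def halfSum (P : Finset (Dual K 𝔥)) : Dual K 𝔥 := (2⁻¹ : K) • ∑ γ ∈ P, γ

lemma two_halfSum (P : Finset (Dual K 𝔥)) : halfSum P + halfSum P = ∑ γ ∈ P, γ := by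
  have h : (2⁻¹ + 2⁻¹ : K) = 1 := by norm_num
  rw [halfSum, ← add_smul, h, one_smul]

lemma halfSum_simple (h : D.IsPos P B) (hα : α ∈ B) : halfSum P (D.co α) = 1 := by
  rw [halfSum, LinearMap.smul_apply, two_rho_simple h hα, smul_eq_mul, inv_mul_cancel₀ two_ne_zero]

lemma halfSum_image [DecidableEq (Dual K 𝔥)] (h : D.IsPos P B) (hα : α ∈ B) :
    halfSum (P.image (D.refl α)) = halfSum P - α := by
  rw [halfSum, two_rho_refl h hα, smul_sub, smul_smul, inv_mul_cancel₀ two_ne_zero, one_smul, halfSum]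

lemma map_rat_mul (φ : K →ₗ[ℚ] ℚ) (q : ℚ) (z : K) : φ (q * z) = q * φ z := by
  rw [← smul_eq_mul q (φ z), ← map_smul, Rat.smul_def]

lemma map_form_nonneg_iff (φ : K →ₗ[ℚ] ℚ) (hγ : γ ∈ D.Φ) (y : Dual K 𝔥) :
    0 ≤ φ (D.form y γ) ↔ 0 ≤ φ (y (D.co γ)) := by
  rw [D.form_root_right hγ, map_rat_mul]
  exact mul_nonneg_iff_of_pos_left (D.b_pos γ hγ)

lemma map_form_sum_nonneg (φ : K →ₗ[ℚ] ℚ) {s : Multiset (Dual K 𝔥)}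
    (hs : ∀ γ ∈ s, 0 ≤ φ (D.form y γ)) : 0 ≤ φ (D.form y s.sum) := by
  induction s using Multiset.induction with
  | empty => simp [form_zero_right]
  | cons a s ih =>
    rw [Multiset.sum_cons, form_add_right, map_add]
    exact add_nonneg (hs a (Multiset.mem_cons_self a s))
      (ih fun γ hγ => hs γ (Multiset.mem_cons_of_mem hγ))

lemma form_sum_comm {s : Multiset (Dual K 𝔥)} (hs : ∀ γ ∈ s, γ ∈ D.Φ) (y : Dual K 𝔥) :
    D.form s.sum y = D.form y s.sum := by
  induction s using Multiset.induction with
  | empty => simp [form_zero_right, form_zero_left]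
  | cons a s ih =>
    have ha := hs a (Multiset.mem_cons_self a s)
    rw [Multiset.sum_cons, form_add_right, form_add_left, D.form_root_left ha, D.form_root_right ha,
      ih fun γ hγ => hs γ (Multiset.mem_cons_of_mem hγ)]

lemma Link.exists_sum (hP : D.IsPos P B) (h : D.Link P lam mu) :
    ∃ s : Multiset (Dual K 𝔥), (∀ γ ∈ s, γ ∈ P) ∧ lam - mu = s.sum := by
  obtain ⟨M, _, _, _, _, u, v, hu, hv, hv0, r, hr⟩ := h
  exact exists_sum_eq hP hu hv.wt hv0 hr

lemma sum_form (P : Finset (Dual K 𝔥)) (y : Dual K 𝔥) :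
    ∑ γ ∈ P, D.form γ y = D.form (∑ γ ∈ P, γ) y := by
  classical
  induction P using Finset.induction with
  | empty => simp [form_zero_left]
  | insert a s ha ih => rw [Finset.sum_insert ha, Finset.sum_insert ha, ih, form_add_left]

lemma Link.eq_of_dominant (hP : D.IsPos P B) (h : D.Link P lam mu) {φ : K →ₗ[ℚ] ℚ} (hφ : φ 1 = 1)
    (hdom : ∀ γ ∈ P, 0 ≤ φ ((mu + halfSum P) (D.co γ))) : lam = mu := by
  obtain ⟨s, hs, hsum⟩ := h.exists_sum hP
  by_contra hne
  obtain ⟨q, hq0, hq⟩ := D.posdef s (fun γ hγ => hP.sub (hs γ hγ)) (hsum ▸ sub_ne_zero.2 hne)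
  obtain ⟨M, _, _, _, _, u, v, hu, hv, hv0, r, hr⟩ := h
  have h1 := casimir_eq hP hu hv hv0 hr
  have hl : lam = mu + s.sum := by rw [← hsum]; abel
  rw [sum_form, sum_form, hl] at h1
  have h2 := form_sum_comm (fun γ hγ => hP.sub (hs γ hγ)) mu
  have h3 := map_form_sum_nonneg (D := D) (y := mu + halfSum P) φ
    fun γ hγ => (map_form_nonneg_iff φ (hP.sub (hs γ hγ)) _).2 (hdom γ (hs γ hγ))
  have h4 : D.form (mu + halfSum P) s.sum + D.form (mu + halfSum P) s.sum + q = 0 := by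
    have h5 : D.form s.sum s.sum = q := hq
    rw [← h5, ← form_add_left, show mu + halfSum P + (mu + halfSum P)
      = mu + mu + (halfSum P + halfSum P) by abel, two_halfSum]
    simp only [form_add_left, form_add_right] at h1 ⊢
    linear_combination h1 - h2
  have h6 := congrArg φ h4
  have h7 : φ (q : K) = q := by
    have := map_rat_mul φ q 1
    rwa [mul_one, hφ, mul_one] at this
  rw [map_add, map_add, h7, map_zero] at h6
  linarith

variable (D) in
/-- the equivalence relation generated by the reflections. -/
def Conj : Dual K 𝔥 → Dual K 𝔥 → Prop := Relation.EqvGen fun x y => ∃ γ ∈ D.Φ, y = D.refl γ x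

lemma Conj.refl_left {x : Dual K 𝔥} (hγ : γ ∈ D.Φ) (h : D.Conj (D.refl γ x) y) : D.Conj x y :=
  .trans _ _ _ (.rel _ _ ⟨γ, hγ, rfl⟩) h

lemma Conj.refl_right {x : Dual K 𝔥} (hγ : γ ∈ D.Φ) (h : D.Conj x (D.refl γ y)) : D.Conj x y :=
  .trans _ _ _ h (.symm _ _ (.rel _ _ ⟨γ, hγ, rfl⟩))

theorem Link.conj (hP : D.IsPos P B) (h : D.Link P lam mu) :
    D.Conj (lam + halfSum P) (mu + halfSum P) := by
  classical
  obtain ⟨φ, hφ⟩ : ∃ φ : K →ₗ[ℚ] ℚ, φ 1 = 1 := by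
    obtain ⟨φ, h⟩ := LinearMap.exists_leftInverse_of_injective (Algebra.linearMap ℚ K)
      (LinearMap.ker_eq_bot.2 (algebraMap ℚ K).injective)
    refine ⟨φ, ?_⟩
    have := congrArg (fun g : ℚ →ₗ[ℚ] ℚ => g 1) h
    simpa using this
  let neg : Finset (Dual K 𝔥) → Dual K 𝔥 → Finset (Dual K 𝔥) := fun P y =>
    P.filter fun γ => φ (y (D.co γ)) < 0
  suffices ∀ n : ℕ, ∀ (P B : Finset (Dual K 𝔥)) (lam mu : Dual K 𝔥), D.IsPos P B → D.Link P lam mu →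
      (neg P (mu + halfSum P)).card = n → D.Conj (lam + halfSum P) (mu + halfSum P) from
    this _ P B lam mu hP h rfl
  intro n
  induction n using Nat.strong_induction_on with
  | _ n ih =>
  intro P B lam mu hP h hn
  by_cases hdom : ∀ α ∈ B, 0 ≤ φ ((mu + halfSum P) (D.co α))
  · have : lam = mu := by
      refine h.eq_of_dominant hP hφ fun γ hγ => ?_
      obtain ⟨s, hs, rfl⟩ := hP.sum γ hγ
      rw [← map_form_nonneg_iff φ (hP.sub hγ)]
      exact map_form_sum_nonneg φ fun δ hδ =>
        (map_form_nonneg_iff φ (hP.sub (hP.simple_mem (hs δ hδ))) _).2 (hdom δ (hs δ hδ))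
    rw [this]
    exact .refl _
  push Not at hdom
  obtain ⟨α, hα, hneg⟩ := hdom
  have hαP := hP.simple_mem hα
  have hαΦ := hP.sub hαP
  have hρ := halfSum_simple hP hα
  obtain ⟨lam', hlam', hlink⟩ := h.move hP hα fun k hk => by
    rw [LinearMap.add_apply, hk, hρ] at hneg
    have h1 := map_rat_mul φ (k + 1) 1
    push_cast at h1
    rw [mul_one, hφ, mul_one] at h1
    rw [h1] at hneg
    have : (0 : ℚ) ≤ k := k.cast_nonneg
    linarith
  have hP' := hP.image hα
  have hsub : neg (P.image (D.refl α)) (mu + halfSum P) ⊆ (neg P (mu + halfSum P)).erase α := by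
    intro γ hγ
    obtain ⟨h1, h2⟩ := Finset.mem_filter.1 hγ
    rcases (hP.mem_image hα).1 h1 with ⟨h3, h4⟩ | rfl
    · exact Finset.mem_erase.2 ⟨h4, Finset.mem_filter.2 ⟨h3, h2⟩⟩
    · rw [apply_co_neg hαΦ, map_neg] at h2
      linarith
  have hcard : (neg (P.image (D.refl α)) (mu + halfSum P)).card < n := by
    refine (Finset.card_le_card hsub).trans_lt ?_
    rw [← hn]
    exact Finset.card_erase_lt_of_mem (Finset.mem_filter.2 ⟨hαP, hneg⟩)
  have hend : D.Conj (lam' + halfSum P) (mu + halfSum P) → D.Conj (lam + halfSum P) (mu + halfSum P) := by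
    rcases hlam' with rfl | rfl
    · exact id
    · intro h1
      refine Conj.refl_left hαΦ ?_
      rw [refl, LinearMap.add_apply, hρ]
      convert h1 using 1
      abel
  refine hend ?_
  have hρ' := halfSum_image hP hα
  rcases hlink with hlink | hlink
  · have h1 := ih _ hcard _ _ _ _ hP' hlink (by
      rw [hρ', show mu + α + (halfSum P - α) = mu + halfSum P by abel])
    rwa [hρ', show mu + α + (halfSum P - α) = mu + halfSum P by abel,
      show lam' + α + (halfSum P - α) = lam' + halfSum P by abel] at h1
  · have hy : mu - (mu (D.co α) + 1) • α + halfSum P = D.refl α (mu + halfSum P) := by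
      rw [refl, LinearMap.add_apply, hρ]; abel
    refine Conj.refl_right hαΦ ?_
    rw [← hy]
    refine ih _ (lt_of_le_of_lt ?_ hcard) _ _ _ _ hP hlink rfl
    refine Finset.card_le_card_of_injOn (D.refl α) (fun γ hγ => ?_) fun x _ z _ hxz => by
      rw [← D.refl_refl hαΦ x, hxz, D.refl_refl hαΦ]
    obtain ⟨h1, h2⟩ := Finset.mem_filter.1 (Finset.mem_coe.1 hγ)
    refine Finset.mem_coe.2 (Finset.mem_filter.2 ⟨Finset.mem_image_of_mem _ h1, ?_⟩)
    rw [hy, ← D.refl_apply_co_refl hαΦ (hP.sub h1), D.refl_refl hαΦ] at h2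
    exact h2

end RootAlg

end

section

section Casimir

open Module

variable {K 𝔥 R : Type} [Field K] [AddCommGroup 𝔥] [Module K 𝔥] [Ring R] [Algebra K R]

/-- the Casimir element attached to root vectors with structure constants `N` is central. -/
lemma casimir_central {I : Type} [Fintype I] {Φ : Finset (Dual K 𝔥)} {ι : 𝔥 →ₗ[K] R}
    {e : Dual K 𝔥 → R} {co : Dual K 𝔥 → 𝔥} {b : Dual K 𝔥 → K} {t t' : I → 𝔥}
    {N : Dual K 𝔥 → Dual K 𝔥 → K}
    (ι_comm : ∀ a b, ι a * ι b = ι b * ι a)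
    (ι_e : ∀ a, ∀ γ ∈ Φ, ι a * e γ = e γ * ι a + γ a • e γ)
    (e_of_notMem : ∀ γ ∉ Φ, e γ = 0)
    (e_e : ∀ γ ∈ Φ, ∀ δ ∈ Φ, γ + δ ≠ 0 → e γ * e δ = e δ * e γ + N γ δ • e (γ + δ))
    (e_neg : ∀ γ ∈ Φ, e γ * e (-γ) = e (-γ) * e γ + ι (co γ))
    (neg_ne : ∀ γ ∈ Φ, γ ≠ -γ)
    (neg_mem : ∀ γ ∈ Φ, -γ ∈ Φ)
    (gen : Algebra.adjoin K (Set.range ι ∪ e '' (Φ : Set (Dual K 𝔥))) = ⊤)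
    (b_neg : ∀ γ ∈ Φ, b (-γ) = b γ)
    (bN : ∀ γ ∈ Φ, ∀ δ ∈ Φ, γ - δ ∈ Φ → b γ * N (-γ) δ = -(b (γ - δ) * N (γ - δ) δ))
    (sum_t : ∀ γ ∈ Φ, ∑ k, γ (t k) • t' k = b γ • co γ)
    (sum_t' : ∀ γ ∈ Φ, ∑ k, γ (t' k) • t k = b γ • co γ) (r : R) :
    (∑ k, ι (t k) * ι (t' k) + ∑ γ ∈ Φ, b γ • (e γ * e (-γ))) * r
      = r * (∑ k, ι (t k) * ι (t' k) + ∑ γ ∈ Φ, b γ • (e γ * e (-γ))) := by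
  classical
  set Ω := ∑ k, ι (t k) * ι (t' k) + ∑ γ ∈ Φ, b γ • (e γ * e (-γ)) with hΩ
  have hr : r ∈ Algebra.adjoin K (Set.range ι ∪ e '' (Φ : Set (Dual K 𝔥))) := by rw [gen]; trivial
  suffices h : ∀ x ∈ Set.range ι ∪ e '' (Φ : Set (Dual K 𝔥)), Ω * x = x * Ω by
    have h' : Algebra.adjoin K (Set.range ι ∪ e '' (Φ : Set (Dual K 𝔥)))
        ≤ Subalgebra.centralizer K {Ω} := Algebra.adjoin_le fun x hx => by
      rw [SetLike.mem_coe, Subalgebra.mem_centralizer_iff]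
      rintro _ rfl
      exact h x hx
    exact (Subalgebra.mem_centralizer_iff K).1 (h' hr) Ω rfl
  intro x hx
  · obtain ⟨a, rfl⟩ | ⟨δ, hδ, rfl⟩ := hx
    · rw [hΩ, add_mul, mul_add, Finset.sum_mul, Finset.mul_sum, Finset.sum_mul, Finset.mul_sum]
      congr 1
      · refine Finset.sum_congr rfl fun k _ => ?_
        rw [mul_assoc, ι_comm _ a, ← mul_assoc, ι_comm _ a, mul_assoc]
      · refine Finset.sum_congr rfl fun γ hγ => ?_
        rw [smul_mul_assoc, mul_smul_comm]
        congr 1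
        have h1 := ι_e a γ hγ
        have h2 := ι_e a (-γ) (neg_mem γ hγ)
        symm
        rw [← mul_assoc, h1, add_mul, mul_assoc (e γ), h2, mul_add, LinearMap.neg_apply, neg_smul,
          mul_neg, mul_smul_comm, smul_mul_assoc, ← mul_assoc]
        abel
    · replace hδ : δ ∈ Φ := hδ
      rw [← sub_eq_zero, hΩ, add_mul, mul_add, add_sub_add_comm, Finset.sum_mul, Finset.mul_sum,
        Finset.sum_mul, Finset.mul_sum, ← Finset.sum_sub_distrib, ← Finset.sum_sub_distrib]
      have hA : ∑ k, (ι (t k) * ι (t' k) * e δ - e δ * (ι (t k) * ι (t' k)))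
          = b δ • (e δ * ι (co δ)) + b δ • (ι (co δ) * e δ) := by
        have h1 : ∀ k, ι (t k) * ι (t' k) * e δ - e δ * (ι (t k) * ι (t' k))
            = e δ * ι (δ (t k) • t' k) + ι (δ (t' k) • t k) * e δ := by
          intro k
          rw [mul_assoc, ι_e _ δ hδ, mul_add, ← mul_assoc, ι_e _ δ hδ, add_mul, map_smul, map_smul,
            mul_smul_comm, mul_smul_comm, smul_mul_assoc, smul_mul_assoc, mul_assoc]
          abel
        rw [Finset.sum_congr rfl fun k _ => h1 k, Finset.sum_add_distrib, ← Finset.mul_sum,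
          ← Finset.sum_mul, ← map_sum, ← map_sum, sum_t δ hδ, sum_t' δ hδ, map_smul, mul_smul_comm,
          smul_mul_assoc]
      have hB : ∀ γ ∈ Φ, b γ • (e γ * e (-γ)) * e δ - e δ * b γ • (e γ * e (-γ))
          = ((if γ = δ then -(b δ • (e δ * ι (co δ))) else 0)
            + (if γ = -δ then -(b δ • (ι (co δ) * e δ)) else 0))
            + ((if γ - δ ∈ Φ then (b γ * N (-γ) δ) • (e γ * e (δ - γ)) else 0)
            + (if γ + δ ∈ Φ then (b γ * N γ δ) • (e (γ + δ) * e (-γ)) else 0)) := by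
        intro γ hγ
        have hnγ := neg_mem γ hγ
        have h0 : (0 : Dual K 𝔥) ∉ Φ := fun h => neg_ne 0 h neg_zero.symm
        have hm1 : e (-γ) * e δ = e δ * e (-γ) + ((if γ = δ then -ι (co δ) else 0)
            + (if γ - δ ∈ Φ then N (-γ) δ • e (δ - γ) else 0)) := by
          by_cases h : γ = δ
          · subst h
            rw [if_pos rfl, sub_self, if_neg h0, add_zero, e_neg γ hγ]; abel
          · rw [if_neg h, zero_add, e_e _ hnγ δ hδ (fun h' => h (by
              rw [neg_add_eq_zero] at h'; exact h')), neg_add_eq_sub]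
            split_ifs with h2
            · rfl
            · rw [e_of_notMem (δ - γ) (fun h3 => h2 (by simpa using neg_mem _ h3)), smul_zero]
        have hm2 : e γ * e δ = e δ * e γ + ((if γ = -δ then -ι (co δ) else 0)
            + (if γ + δ ∈ Φ then N γ δ • e (γ + δ) else 0)) := by
          by_cases h : γ = -δ
          · subst h
            rw [if_pos rfl, neg_add_cancel, if_neg h0, add_zero, e_neg δ hδ]; abel
          · rw [if_neg h, zero_add, e_e _ hγ δ hδ (fun h' => h (eq_neg_of_add_eq_zero_left h'))]
            split_ifs with h2
            · rfl
            · rw [e_of_notMem _ h2, smul_zero]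
        rw [smul_mul_assoc, mul_smul_comm, ← smul_sub, mul_assoc, hm1, mul_add, ← mul_assoc, hm2,
          add_mul, mul_assoc, add_assoc, add_sub_cancel_left, mul_add, add_mul]
        have hbn : γ = -δ → b γ = b δ := fun h => by rw [h, b_neg δ hδ]
        by_cases h1 : γ = δ <;> by_cases h2 : γ = -δ
        · exact absurd (h1.symm.trans h2) (neg_ne δ hδ)
        · subst h1
          simp only [if_neg h2, if_true]
          split_ifs <;> simp only [mul_zero, zero_mul, add_zero, zero_add, smul_add, mul_neg,
            smul_neg, mul_smul_comm, smul_mul_assoc, smul_smul, smul_zero] <;> abel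
        · have h3 := hbn h2
          subst h2
          have h4 : -δ ≠ δ := h1
          simp only [if_neg h4, if_true, neg_neg, h3]
          split_ifs <;> simp only [mul_zero, zero_mul, add_zero, zero_add, smul_add, neg_mul,
            smul_neg, mul_smul_comm, smul_mul_assoc, smul_smul, smul_zero] <;> abel
        · simp only [if_neg h1, if_neg h2]
          split_ifs <;> simp only [mul_zero, zero_mul, add_zero, zero_add, smul_add,
            mul_smul_comm, smul_mul_assoc, smul_smul, smul_zero] <;> abel
      have hC : ∑ γ ∈ Φ, ((if γ - δ ∈ Φ then (b γ * N (-γ) δ) • (e γ * e (δ - γ)) else 0)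
            + (if γ + δ ∈ Φ then (b γ * N γ δ) • (e (γ + δ) * e (-γ)) else 0)) = 0 := by
        rw [Finset.sum_add_distrib, ← Finset.sum_filter, ← Finset.sum_filter, add_eq_zero_iff_eq_neg,
          ← Finset.sum_neg_distrib]
        refine Finset.sum_bij' (fun γ _ => γ - δ) (fun γ _ => γ + δ) ?_ ?_ ?_ ?_ ?_
        · intro γ hγ; simpa [and_comm] using hγ
        · intro γ hγ; simpa [and_comm] using hγ
        · intro γ _; simp
        · intro γ _; simp
        · intro γ hγ
          rw [Finset.mem_filter] at hγ
          rw [bN γ hγ.1 δ hδ hγ.2, sub_add_cancel, neg_sub, neg_smul]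
      rw [Finset.sum_congr rfl hB, Finset.sum_add_distrib, hC, add_zero, Finset.sum_add_distrib,
        Finset.sum_ite_eq', Finset.sum_ite_eq', if_pos hδ, if_pos (neg_mem δ hδ), hA]
      abel

end Casimir

end

section

namespace Setup

variable {K : Type} [Field K] [IsAlgClosed K] [CharZero K]
variable {g : Type} [LieRing g] [LieAlgebra K g] {S : Setup K g}
variable {α β γ δ : Module.Dual K S.h}

lemma Good.cr_neg (h : S.Good α) : S.cr (-α) = -S.cr α := h.triple.symm.unique h.neg.triple

open Classical in
/-- root vectors normalized so that opposite ones form a triple. -/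
def rv (S : Setup K g) (γ : Module.Dual K S.h) : g := if γ ∈ S.pos then S.ev γ else S.fv (-γ)

lemma Good.rv (h : S.Good γ) : S.Triple γ (S.rv γ) (S.rv (-γ)) (S.cr γ) := by
  by_cases hp : γ ∈ S.pos
  · rw [Setup.rv, Setup.rv, if_pos hp, if_neg (neg_notMem_pos hp), neg_neg]
    exact h.triple
  · rw [Setup.rv, Setup.rv, if_neg hp, if_pos (neg_mem_pos h.isRootOf hp)]
    have := h.neg.triple.symm
    rwa [neg_neg, h.cr_neg, neg_neg] at this

lemma gw_add_lie (h : S.gw (α + β) = ⊥) {x y : g} (hx : x ∈ S.gw α) (hy : y ∈ S.gw β) :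
    ⁅x, y⁆ = 0 := by
  have := S.lie_mem_gw hx hy
  rwa [h, Submodule.mem_bot] at this

lemma cr_mem_of_sum (Q : Submodule K S.h) (s : Multiset (Module.Dual K S.h))
    (hs : ∀ δ ∈ s, S.Good δ) (hQ : ∀ δ ∈ s, S.cr δ ∈ Q) (h : S.Good s.sum) :
    S.cr s.sum ∈ Q := by
  classical
  induction hn : Multiset.card s generalizing s with
  | zero =>
    rw [Multiset.card_eq_zero.1 hn] at h
    exact absurd rfl h.triple.ne_zero
  | succ n ih =>
    obtain ⟨δ, hδ, k, hk, hk'⟩ := exists_pos_of_sum_ne_zero s hs h.triple.ne_zero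
    have t := (hs δ hδ).triple
    have hsum : δ + (s.erase δ).sum = s.sum := Multiset.sum_erase hδ
    by_cases h0 : (s.erase δ).sum = 0
    · rw [← hsum, h0, add_zero]; exact hQ δ hδ
    have hmem : ⁅S.fv δ, S.ev s.sum⁆ ∈ S.gw (s.erase δ).sum := by
      have := S.lie_mem_gw t.hy h.triple.hx
      rwa [show -δ + s.sum = (s.erase δ).sum by rw [← hsum, neg_add_cancel_left]] at this
    have hg : S.Good (s.erase δ).sum :=
      good_of_notMem_rad h0 hmem (t.lie_notMem_rad h.triple hk hk')
    have h1 := ih (s.erase δ) (fun ε hε => hs ε (Multiset.mem_of_mem_erase hε))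
      (fun ε hε => hQ ε (Multiset.mem_of_mem_erase hε)) hg
      (by rw [Multiset.card_erase_of_mem hδ, hn]; rfl)
    obtain ⟨d, hd⟩ := hg.triple.x_gen _ hmem
    have h2 : ⁅S.ev δ, ⁅S.fv δ, S.ev s.sum⁆⁆ ∈ S.gw s.sum := by
      have := S.lie_mem_gw t.hx (S.lie_mem_gw t.hy h.triple.hx)
      rwa [add_neg_cancel_left] at this
    obtain ⟨c, hc⟩ := h.triple.x_gen _ h2
    have hc0 : c ≠ 0 := by
      rintro rfl
      rw [zero_smul] at hc
      exact h.triple.x_ne_zero (t.eq_zero_of_lie_lie hk hk' h.triple.hx hc)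
    have m1 : ⁅S.ev (s.erase δ).sum, S.fv s.sum⁆ ∈ S.gw (-δ) := by
      have := S.lie_mem_gw hg.triple.hx h.triple.hy
      rwa [show (s.erase δ).sum + -s.sum = -δ by rw [← hsum]; abel] at this
    have m2 : ⁅S.ev δ, S.fv s.sum⁆ ∈ S.gw (-(s.erase δ).sum) := by
      have := S.lie_mem_gw t.hx h.triple.hy
      rwa [show δ + -s.sum = -(s.erase δ).sum by rw [← hsum]; abel] at this
    obtain ⟨a, ha⟩ := t.y_gen _ m1
    obtain ⟨b, hb⟩ := hg.triple.y_gen _ m2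
    have h3 : c • S.cr s.sum = (d * a) • S.cr δ - (d * b) • S.cr (s.erase δ).sum := by
      refine Subtype.ext ?_
      have e1 : c • (S.cr s.sum : g) = ⁅c • S.ev s.sum, S.fv s.sum⁆ := by
        rw [smul_lie, ← h.triple.lie]
      have e2 : ((d * a) • S.cr δ - (d * b) • S.cr (s.erase δ).sum : S.h)
          = (d * a) • (S.cr δ : g) - (d * b) • (S.cr (s.erase δ).sum : g) := rfl
      rw [e2]
      refine e1.trans ?_
      rw [← hc, hd, lie_smul, smul_lie, lie_lie, ha, hb, lie_smul, lie_smul, ← t.lie,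
        ← hg.triple.lie, smul_sub, smul_smul, smul_smul]
    have h4 : c • S.cr s.sum ∈ Q := h3 ▸ Q.sub_mem (Q.smul_mem _ (hQ δ hδ)) (Q.smul_mem _ h1)
    have := Q.smul_mem c⁻¹ h4
    rwa [smul_smul, inv_mul_cancel₀ hc0, one_smul] at this

section Levi

variable (A : Finset (Module.Dual K S.h))

/-- the roots in the lattice spanned by `A`. -/
def leviSet : Set (Module.Dual K S.h) :=
  {γ | IsRootOf K g S.h γ ∧ γ ∈ AddSubgroup.closure (A : Set (Module.Dual K S.h))}

variable {A}

lemma exists_sum_sub_of_mem_closure (hγ : γ ∈ AddSubgroup.closure (A : Set (Module.Dual K S.h))) :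
    ∃ s t : Multiset (Module.Dual K S.h), (∀ δ ∈ s, δ ∈ A) ∧ (∀ δ ∈ t, δ ∈ A) ∧
      γ = s.sum - t.sum := by
  induction hγ using AddSubgroup.closure_induction with
  | mem x hx => exact ⟨{x}, 0, by simpa using hx, by simp, by simp⟩
  | zero => exact ⟨0, 0, by simp, by simp, by simp⟩
  | add x y _ _ hx hy =>
    obtain ⟨s, t, hs, ht, rfl⟩ := hx
    obtain ⟨s', t', hs', ht', rfl⟩ := hy
    refine ⟨s + s', t + t', fun δ h => ?_, fun δ h => ?_, by simp only [Multiset.sum_add]; abel⟩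
    · exact (Multiset.mem_add.1 h).elim (hs δ) (hs' δ)
    · exact (Multiset.mem_add.1 h).elim (ht δ) (ht' δ)
  | neg x _ hx =>
    obtain ⟨s, t, hs, ht, rfl⟩ := hx
    exact ⟨t, s, ht, hs, by abel⟩

variable (hD : S.IsDynkin) (hA : ∀ α ∈ A, S.IsSimpleRoot α)
include hD hA

lemma exists_sum_of_mem_leviSet (hp : γ ∈ S.pos) (hγ : γ ∈ leviSet A) :
    ∃ s : Multiset (Module.Dual K S.h), (∀ δ ∈ s, δ ∈ A) ∧ s.sum = γ := by
  obtain ⟨s, t, hs, ht, h⟩ := exists_sum_sub_of_mem_closure hγ.2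
  obtain ⟨u, hu, hu'⟩ := exists_simple_sum' hD hp
  have h1 : t + u = s := by
    refine simple_sum_inj hD (fun δ h => ?_) (fun δ h => hA δ (hs δ h)) ?_
    · exact (Multiset.mem_add.1 h).elim (fun h => hA δ (ht δ h)) (hu δ)
    · rw [Multiset.sum_add, hu', h]; abel
  exact ⟨u, fun δ h => hs δ (h1 ▸ Multiset.mem_add.2 (Or.inr h)), hu'⟩

omit hD hA in
lemma neg_mem_leviSet (h : γ ∈ leviSet A) (hg : S.Good γ) : -γ ∈ leviSet A :=
  ⟨hg.neg.isRootOf, neg_mem h.2⟩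

lemma leviSet_induction {p : Module.Dual K S.h → Prop} (hneg : ∀ γ, S.Good γ → p γ → p (-γ))
    (hsum : ∀ s : Multiset (Module.Dual K S.h), (∀ δ ∈ s, δ ∈ A) → S.Good s.sum → p s.sum)
    (hγ : γ ∈ leviSet A) : p γ := by
  have hg := good_of_isRootOf hD hγ.1
  by_cases hp : γ ∈ S.pos
  · obtain ⟨s, hs, rfl⟩ := exists_sum_of_mem_leviSet hD hA hp hγ
    exact hsum s hs hg
  · have hn := neg_mem_leviSet hγ hg
    obtain ⟨s, hs, h⟩ := exists_sum_of_mem_leviSet hD hA (neg_mem_pos hγ.1 hp) hn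
    have := hneg _ hg.neg (h ▸ hsum s hs (h ▸ hg.neg))
    rwa [neg_neg] at this

lemma cr_mem_span_of_mem_leviSet (hγ : γ ∈ leviSet A) :
    S.cr γ ∈ Submodule.span K (S.cr '' (A : Set (Module.Dual K S.h))) := by
  refine leviSet_induction hD hA (p := fun γ => S.cr γ ∈ Submodule.span K
    (S.cr '' (A : Set (Module.Dual K S.h)))) (fun γ hg h => ?_) (fun s hs h => ?_) hγ
  · rw [hg.cr_neg]; exact neg_mem h
  · exact cr_mem_of_sum _ s (fun δ hδ => (hA δ (hs δ hδ)).good hD)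
      (fun δ hδ => Submodule.subset_span ⟨δ, hs δ hδ, rfl⟩) h

lemma gw_le_of_mem_leviSet (Q : LieSubalgebra K g) (hQ : ∀ α ∈ A, S.gw α ≤ Q.toSubmodule)
    (hQ' : ∀ α ∈ A, S.gw (-α) ≤ Q.toSubmodule) (hγ : γ ∈ leviSet A) :
    S.gw γ ≤ Q.toSubmodule := by
  refine (leviSet_induction hD hA (p := fun γ => S.gw γ ≤ Q.toSubmodule ∧
    S.gw (-γ) ≤ Q.toSubmodule) (fun γ hg h => ?_) (fun s hs h => ?_) hγ).1
  · rw [neg_neg]; exact h.symm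
  · exact ⟨gw_le_of_sum Q s (fun δ hδ => (hA δ (hs δ hδ)).good hD) (fun δ hδ => hQ δ (hs δ hδ)) h,
      gw_neg_le_of_sum Q s (fun δ hδ => (hA δ (hs δ hδ)).good hD) (fun δ hδ => hQ' δ (hs δ hδ)) h⟩

lemma eventually_gw_le_leviSet :
    ∀ᶠ n in Filter.atTop, ∀ γ ∈ leviSet A, S.gw γ ≤ (S.F n).toSubmodule := by
  have h1 : ∀ᶠ n in Filter.atTop, ∀ α ∈ A, S.ev α ∈ S.F n ∧ S.fv α ∈ S.F n := by
    rw [Filter.eventually_all_finset]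
    exact fun α _ => (S.eventually_mem _).and (S.eventually_mem _)
  filter_upwards [h1] with n hn γ hγ
  refine gw_le_of_mem_leviSet hD hA _ (fun α hα x hx => ?_) (fun α hα x hx => ?_) hγ
  · obtain ⟨c, rfl⟩ := ((hA α hα).good hD).triple.x_gen x hx
    exact (S.F n).smul_mem c (hn α hα).1
  · obtain ⟨c, rfl⟩ := ((hA α hα).good hD).triple.y_gen x hx
    exact (S.F n).smul_mem c (hn α hα).2

lemma finite_leviSet : (leviSet A).Finite := by
  obtain ⟨n, hn⟩ := (eventually_gw_le_leviSet hD hA).exists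
  have := S.F_findim n
  have hmem : ∀ γ : leviSet A, S.ev γ.1 ∈ S.F n := fun γ =>
    hn γ.1 γ.2 (good_of_isRootOf hD γ.2.1).triple.hx
  have hli : LinearIndependent K fun γ : leviSet A => S.ev γ.1 :=
    (S.h_indep.comp Subtype.val_injective).linearIndependent _
      (fun γ => (good_of_isRootOf hD γ.2.1).triple.hx)
      (fun γ => (good_of_isRootOf hD γ.2.1).triple.x_ne_zero)
  have hli' : LinearIndependent K fun γ : leviSet A => (⟨S.ev γ.1, hmem γ⟩ : S.F n) :=
    LinearIndependent.of_comp (S.F n).toSubmodule.subtype hli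
  have := hli'.finite
  exact Set.toFinite _

end Levi

end Setup

end

section

namespace Setup

variable {K : Type} [Field K] [IsAlgClosed K] [CharZero K]
variable {g : Type} [LieRing g] [LieAlgebra K g] {S : Setup K g}
variable {α β γ δ : Module.Dual K S.h}

section Levi

variable {A : Finset (Module.Dual K S.h)} (hD : S.IsDynkin) (hA : ∀ α ∈ A, S.IsSimpleRoot α)
include hD hA

/-- normalizing constants of the trace form on a finite root subsystem. -/
lemma exists_levi_form : ∃ b : Module.Dual K S.h → ℚ,
    (∀ γ ∈ leviSet A, 0 < b γ) ∧
    (∀ γ ∈ leviSet A, ∀ δ ∈ leviSet A, (b δ : K) * γ (S.cr δ) = b γ * δ (S.cr γ)) ∧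
    (∀ γ ∈ leviSet A, ∀ δ ∈ leviSet A, γ - δ ∈ leviSet A → ∀ c d : K,
      ⁅S.rv (-γ), S.rv δ⁆ = c • S.rv (δ - γ) → ⁅S.rv (γ - δ), S.rv δ⁆ = d • S.rv γ →
      (b γ : K) * c = -(b (γ - δ) * d)) ∧
    ∀ s : Multiset (Module.Dual K S.h), (∀ γ ∈ s, γ ∈ leviSet A) → s.sum ≠ 0 →
      ∃ q : ℚ, 0 < q ∧ (s.map fun γ => (b γ : K) * s.sum (S.cr γ)).sum = q := by
  classical
  have hfin := finite_leviSet hD hA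
  have hgood : ∀ γ ∈ leviSet A, S.Good γ := fun γ h => good_of_isRootOf hD h.1
  obtain ⟨n, hn, hΦ⟩ := exists_trace_level hfin.toFinset
    (fun α h => hgood α (hfin.mem_toFinset.1 h)) (eventually_gw_le_leviSet hD hA)
  simp only [Set.Finite.mem_toFinset] at hΦ
  choose! t ht hβ hz using hΦ
  choose! β hβ0 hβ using hβ
  have hβ' : ∀ γ ∈ leviSet A, (β γ : K) ≠ 0 := fun γ h => by exact_mod_cast (hβ0 γ h).ne'
  have hsym : ∀ γ ∈ leviSet A, ∀ δ ∈ leviSet A,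
      (β γ : K) * γ (S.cr δ) = β δ * δ (S.cr γ) := by
    intro γ hγ δ hδ
    have h1 := hβ γ hγ (t δ)
    have h2 := hβ δ hδ (t γ)
    rw [S.resT_apply n _ _ (ht δ hδ)] at h1
    rw [S.resT_apply n _ _ (ht γ hγ)] at h2
    rw [← h1, ← h2, LieModule.traceForm_comm]
  have hneg : ∀ γ ∈ leviSet A, β (-γ) = β γ := by
    intro γ hγ
    have h1 := hsym γ hγ (-γ) (neg_mem_leviSet hγ (hgood γ hγ))
    rw [(hgood γ hγ).cr_neg, map_neg, LinearMap.neg_apply, (hgood γ hγ).triple.two] at h1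
    have h2 : (β γ : K) = β (-γ) := by
      have := mul_right_cancel₀ (neg_ne_zero.2 (two_ne_zero (α := K))) h1
      exact this
    exact_mod_cast h2.symm
  refine ⟨fun γ => (β γ)⁻¹, fun γ h => inv_pos.2 (hβ0 γ h), fun γ hγ δ hδ => ?_, ?_, ?_⟩
  · have h1 := hsym γ hγ δ hδ
    have := hβ' γ hγ
    have := hβ' δ hδ
    push_cast
    field_simp
    linear_combination h1
  · intro γ hγ δ hδ hγδ c d hc hd
    have hm : ∀ γ ∈ leviSet A, S.rv γ ∈ S.F n := fun γ h => hn γ h (hgood γ h).rv.hx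
    have hk : ∀ γ (h : γ ∈ leviSet A) (h' : -γ ∈ leviSet A),
        LieModule.traceForm K (S.F n) (S.F n) ⟨S.rv γ, hm γ h⟩ ⟨S.rv (-γ), hm _ h'⟩ = β γ := by
      intro γ h h'
      have h1 : ⁅(t γ : S.F n), (⟨S.rv γ, hm γ h⟩ : S.F n)⁆ = (2 : K) • ⟨S.rv γ, hm γ h⟩ :=
        Subtype.ext (by
          have := (hgood γ h).rv.lie_h_x
          rw [← ht γ h] at this
          exact this)
      have h2 : ⁅(⟨S.rv γ, hm γ h⟩ : S.F n), (⟨S.rv (-γ), hm _ h'⟩ : S.F n)⁆ = (t γ : S.F n) :=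
        Subtype.ext (by rw [ht γ h]; exact (hgood γ h).rv.lie.symm)
      have h3 := LieModule.traceForm_apply_lie_apply K (S.F n) (S.F n) (t γ) ⟨S.rv γ, hm γ h⟩
        ⟨S.rv (-γ), hm _ h'⟩
      rw [h1, h2] at h3
      have h4 : LieModule.traceForm K (S.F n) (S.F n) (t γ) (t γ) = β γ * 2 := by
        have := hβ γ h (t γ)
        rw [S.resT_apply n _ _ (ht γ h), (hgood γ h).triple.two] at this
        exact this
      rw [h4, map_smul, LinearMap.smul_apply, smul_eq_mul, mul_comm] at h3
      exact mul_right_cancel₀ two_ne_zero h3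
    have hγ' := neg_mem_leviSet hγ (hgood γ hγ)
    have hδγ : δ - γ ∈ leviSet A := by
      have := neg_mem_leviSet hγδ (hgood _ hγδ)
      rwa [neg_sub] at this
    have h1 := LieModule.traceForm_apply_lie_apply K (S.F n) (S.F n) ⟨S.rv (-γ), hm _ hγ'⟩
      ⟨S.rv δ, hm _ hδ⟩ ⟨S.rv (γ - δ), hm _ hγδ⟩
    have h2 : ⁅(⟨S.rv (-γ), hm _ hγ'⟩ : S.F n), (⟨S.rv δ, hm _ hδ⟩ : S.F n)⁆
        = c • ⟨S.rv (δ - γ), hm _ hδγ⟩ := Subtype.ext hc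
    have h3 : ⁅(⟨S.rv δ, hm _ hδ⟩ : S.F n), (⟨S.rv (γ - δ), hm _ hγδ⟩ : S.F n)⁆
        = (-d) • ⟨S.rv γ, hm _ hγ⟩ := Subtype.ext (by
          rw [neg_smul]
          refine (lie_skew _ _).symm.trans ?_
          exact congrArg Neg.neg hd)
    have e1 : LieModule.traceForm K (S.F n) (S.F n) ⟨S.rv (δ - γ), hm _ hδγ⟩
        ⟨S.rv (γ - δ), hm _ hγδ⟩ = β (γ - δ) := by
      have h5 : -(δ - γ) ∈ leviSet A := by rwa [neg_sub]
      have := hk (δ - γ) hδγ h5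
      rw [← hneg _ hγδ, neg_sub, ← this]
      congr 2
      rw [neg_sub]
    rw [h2, h3, map_smul, map_smul, LinearMap.smul_apply, smul_eq_mul, smul_eq_mul,
      LieModule.traceForm_comm K (S.F n) (S.F n) ⟨S.rv (-γ), hm _ hγ'⟩, hk γ hγ hγ', e1] at h1
    have := hβ' γ hγ
    have := hβ' _ hγδ
    push_cast
    field_simp
    linear_combination h1
  · intro s hs h0
    let b : Module.Dual K S.h → ℚ := fun γ => (β γ)⁻¹
    let τ : S.T n := (s.map fun δ => (b δ : K) • t δ).sum
    let σ (η : Module.Dual K S.h) : S.T n →ₗ[K] K :=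
      { toFun := S.resT n η
        map_add' := fun a b => LinearMap.map_add η ⟨((a : S.F n) : g), a.2.1⟩ ⟨((b : S.F n) : g), b.2.1⟩
        map_smul' := fun c a => LinearMap.map_smul η c ⟨((a : S.F n) : g), a.2.1⟩ }
    have hres : ∀ (u : Multiset (Module.Dual K S.h)) x,
        S.resT n u.sum x = (u.map fun δ => S.resT n δ x).sum := by
      intro u x
      induction u using Multiset.induction_on with
      | empty => simp [resT]
      | cons a u ih =>
        rw [Multiset.sum_cons, Multiset.map_cons, Multiset.sum_cons, ← ih]
        rfl
    have hτ : ∀ x, LieModule.traceForm K (S.T n) (S.F n) τ x = S.resT n s.sum x := by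
      intro x
      rw [hres]
      have : LieModule.traceForm K (S.T n) (S.F n) τ x =
          ((LieModule.traceForm K (S.T n) (S.F n)).flip x) τ := rfl
      rw [this, map_multiset_sum, Multiset.map_map]
      congr 1
      refine Multiset.map_congr rfl fun δ hδ => ?_
      simp only [Function.comp_apply, map_smul, smul_eq_mul]
      have h1 := hβ' δ (hs δ hδ)
      have h2 : (b δ : K) = (β δ : K)⁻¹ := by simp [b]
      have h3 : (LieModule.traceForm K (S.T n) (S.F n)).flip x (t δ) = β δ * S.resT n δ x :=
        hβ δ (hs δ hδ) x
      rw [h2, h3, inv_mul_cancel_left₀ h1]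
    have hrat : ∀ χ : LieModule.Weight K (S.T n) (S.F n), ∃ r : ℚ, χ τ = r := by
      intro χ
      have hχ : ∀ u : Multiset (Module.Dual K S.h), u ≤ s →
          ∃ r : ℚ, χ ((u.map fun δ => (b δ : K) • t δ).sum) = r := by
        intro u
        induction u using Multiset.induction_on with
        | empty => exact fun _ => ⟨0, by simp⟩
        | cons a u ih =>
          intro hu
          obtain ⟨r, hr⟩ := ih ((Multiset.le_cons_self u a).trans hu)
          obtain ⟨w, hw⟩ := hz a (hs a (Multiset.mem_of_le hu (Multiset.mem_cons_self a u))) χ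
          refine ⟨b a * w + r, ?_⟩
          rw [Multiset.map_cons, Multiset.sum_cons]
          have h1 : χ ((b a : K) • t a + (u.map fun δ => (b δ : K) • t δ).sum)
              = b a * χ (t a) + χ ((u.map fun δ => (b δ : K) • t δ).sum) := by
            simp
          rw [h1, hw, hr]; push_cast; rfl
      exact hχ s le_rfl
    obtain ⟨q, hq0, hq, hqz⟩ := traceForm_rat (S.T n) hrat
    refine ⟨q, lt_of_le_of_ne hq0 fun hq0' => ?_, ?_⟩
    · obtain ⟨δ, hδ, k, hk, hk'⟩ := exists_pos_of_sum_ne_zero s (fun δ h => hgood δ (hs δ h)) h0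
      have h1 := (hqz hq0'.symm).1 (t δ)
      rw [hτ, S.resT_apply n _ _ (ht δ (hs δ hδ)), hk'] at h1
      have : k = 0 := by exact_mod_cast h1
      omega
    · rw [← hq, hτ]
      have h1 : S.resT n s.sum τ = σ s.sum τ := rfl
      rw [h1, map_multiset_sum, Multiset.map_map]
      congr 1
      refine Multiset.map_congr rfl fun δ hδ => ?_
      simp only [Function.comp_apply, map_smul, smul_eq_mul]
      have h2 : σ s.sum (t δ) = s.sum (S.cr δ) := S.resT_apply n _ _ (ht δ (hs δ hδ))
      rw [h2]

end Levi

end Setup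

end

section

namespace Setup

variable {K : Type} [Field K] [IsAlgClosed K] [CharZero K]
variable {g : Type} [LieRing g] [LieAlgebra K g] {S : Setup K g}
variable {α β γ δ : Module.Dual K S.h}

section Levi

variable {A : Finset (Module.Dual K S.h)} (hD : S.IsDynkin) (hA : ∀ α ∈ A, S.IsSimpleRoot α)
include hD hA

lemma mem_leviSet_of_mem (hα : α ∈ A) : α ∈ leviSet A :=
  ⟨((hA α hα).good hD).isRootOf, AddSubgroup.subset_closure hα⟩

omit hA in
/-- integral combinations of simple roots are linearly independent. -/
lemma intCast_combination_ne_zero (hA : ∀ α ∈ A, S.IsSimpleRoot α) {m : A → ℤ} (hm : m ≠ 0) :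
    ∃ u : Multiset (Module.Dual K S.h), (∀ γ ∈ u, γ ∈ leviSet A) ∧
      u.sum = ∑ k, m k • k.1 ∧ u.sum ≠ 0 := by
  classical
  let s : (A → ℤ) → Multiset (Module.Dual K S.h) :=
    fun m => ∑ k, (m k).toNat • ({k.1} : Multiset (Module.Dual K S.h))
  have hs : ∀ m, ∀ γ ∈ s m, γ ∈ A := by
    intro m γ hγ
    obtain ⟨k, -, hk⟩ := Multiset.mem_sum.1 hγ
    have := Multiset.mem_of_mem_nsmul hk
    rw [Multiset.mem_singleton.1 this]
    exact k.2
  have hsum : ∀ m, (s m).sum = ∑ k, (m k).toNat • k.1 := by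
    intro m
    simp [s, Multiset.sum_sum, Multiset.sum_nsmul]
  have hcount : ∀ m k, (s m).count k.1 = (m k).toNat := by
    intro m k
    simp only [s, Multiset.count_sum', Multiset.count_nsmul, Multiset.count_singleton]
    rw [Finset.sum_eq_single k]
    · simp
    · intro l _ hl
      rw [if_neg (fun h => hl (Subtype.ext h.symm)), mul_zero]
    · simp
  have hsub : (s m).sum - (s (-m)).sum = ∑ k, m k • k.1 := by
    rw [hsum, hsum, ← Finset.sum_sub_distrib]
    refine Finset.sum_congr rfl fun k _ => ?_
    have hk : m k = ((m k).toNat : ℤ) - (((-m) k).toNat : ℤ) := by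
      simp only [Pi.neg_apply]
      omega
    conv_rhs => rw [hk]
    module
  refine ⟨s m + (s (-m)).map Neg.neg, ?_, ?_, ?_⟩
  · intro γ hγ
    rcases Multiset.mem_add.1 hγ with h | h
    · exact mem_leviSet_of_mem hD hA (hs m γ h)
    · obtain ⟨δ, hδ, rfl⟩ := Multiset.mem_map.1 h
      have hδ' := hs _ _ hδ
      exact neg_mem_leviSet (mem_leviSet_of_mem hD hA hδ') ((hA δ hδ').good hD)
  · rw [Multiset.sum_add, Multiset.sum_map_neg, Multiset.map_id', ← sub_eq_add_neg, hsub]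
  · rw [Multiset.sum_add, Multiset.sum_map_neg, Multiset.map_id', ← sub_eq_add_neg]
    intro h0
    have h1 := simple_sum_inj hD (fun δ h => hA δ (hs m δ h)) (fun δ h => hA δ (hs (-m) δ h))
      (sub_eq_zero.1 h0)
    refine hm (funext fun k => ?_)
    have h2 := hcount m k
    rw [h1, hcount] at h2
    simp only [Pi.neg_apply, Pi.zero_apply] at h2 ⊢
    omega

/-- bases of the span of the coroots which are dual for the trace form. -/
lemma exists_dual_bases {b : Module.Dual K S.h → ℚ} (hb0 : ∀ γ ∈ leviSet A, 0 < b γ)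
    (hsym : ∀ γ ∈ leviSet A, ∀ δ ∈ leviSet A, (b δ : K) * γ (S.cr δ) = b γ * δ (S.cr γ))
    (hpos : ∀ s : Multiset (Module.Dual K S.h), (∀ γ ∈ s, γ ∈ leviSet A) → s.sum ≠ 0 →
      ∃ q : ℚ, 0 < q ∧ (s.map fun γ => (b γ : K) * s.sum (S.cr γ)).sum = q) :
    ∃ t t' : A → S.h, (∀ γ ∈ leviSet A, ∑ k, γ (t k) • t' k = (b γ : K) • S.cr γ) ∧
      ∀ γ ∈ leviSet A, ∑ k, γ (t' k) • t k = (b γ : K) • S.cr γ := by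
  classical
  have hAm : ∀ k : A, k.1 ∈ leviSet A := fun k => mem_leviSet_of_mem hD hA k.2
  have hg : ∀ γ ∈ leviSet A, S.Good γ := fun γ h => good_of_isRootOf hD h.1
  have hb : ∀ γ ∈ leviSet A, (b γ : K) ≠ 0 := fun γ h => by exact_mod_cast (hb0 γ h).ne'
  have hz_int : ∀ γ ∈ leviSet A, ∀ l : A, ∃ z : ℤ, l.1 (S.cr γ) = z := fun γ h l =>
    (hg γ h).triple.exists_int ((hg _ (hAm l)).isRootOf).2
  choose! C hC using fun l k : A => hz_int l.1 (hAm l) k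
  let M : Matrix A A ℤ := fun k l => C l k
  have hM : M.det ≠ 0 := by
    intro h0
    obtain ⟨m, hm, hm'⟩ := Matrix.exists_vecMul_eq_zero_iff.2 h0
    obtain ⟨u, hu, hus, hu0⟩ := intCast_combination_ne_zero hD hA hm
    have h1 : ∀ l : A, u.sum (S.cr l.1) = 0 := by
      intro l
      have := congrFun hm' l
      rw [Matrix.vecMul, dotProduct] at this
      rw [hus, LinearMap.sum_apply]
      have h2 := congrArg (Int.cast (R := K)) this
      push_cast at h2
      rw [Pi.zero_apply, Int.cast_zero] at h2
      rw [← h2]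
      refine Finset.sum_congr rfl fun k _ => ?_
      rw [LinearMap.smul_apply, hC l k, zsmul_eq_mul]
    have h2 : ∀ x ∈ Submodule.span K (S.cr '' (A : Set (Module.Dual K S.h))), u.sum x = 0 := by
      intro x hx
      have : Submodule.span K (S.cr '' (A : Set (Module.Dual K S.h))) ≤ LinearMap.ker u.sum :=
        Submodule.span_le.2 (by rintro _ ⟨l, hl, rfl⟩; exact h1 ⟨l, hl⟩)
      exact this hx
    obtain ⟨q, hq, hq'⟩ := hpos u hu hu0
    rw [Multiset.map_congr rfl (g := fun _ => (0 : K)) fun γ hγ => by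
      rw [h2 _ (cr_mem_span_of_mem_leviSet hD hA (hu γ hγ)), mul_zero]] at hq'
    rw [Multiset.map_const', Multiset.sum_replicate, smul_zero] at hq'
    exact hq.ne (by exact_mod_cast hq')
  let G : Matrix A A K := Matrix.diagonal (fun k => (b k.1 : K)⁻¹) * M.map (Int.castRingHom K)
  have hG : ∀ k l : A, G k l = (b k.1 : K)⁻¹ * k.1 (S.cr l.1) := by
    intro k l
    simp only [G, Matrix.diagonal_mul, M, hC l k]
    rfl
  have hdet : IsUnit G.det := by
    rw [isUnit_iff_ne_zero, Matrix.det_mul, Matrix.det_diagonal]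
    refine mul_ne_zero (Finset.prod_ne_zero_iff.2 fun k _ => inv_ne_zero (hb _ (hAm k))) ?_
    have : (M.map (Int.castRingHom K)).det = Int.castRingHom K M.det :=
      (RingHom.map_det (Int.castRingHom K) M).symm
    rw [this]
    simpa using hM
  have hGs : G.transpose = G := by
    ext k l
    rw [Matrix.transpose_apply, hG, hG]
    have h1 := hsym _ (hAm k) _ (hAm l)
    have := hb _ (hAm k)
    have := hb _ (hAm l)
    field_simp
    linear_combination -h1
  have hγ : ∀ γ ∈ leviSet A, ∃ c : A → K, (b γ : K) • S.cr γ = ∑ l, c l • S.cr l.1 ∧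
      ∀ k : A, γ (S.cr k.1) = (G.mulVec c) k := by
    intro γ hγ
    have h1 := Submodule.smul_mem _ (b γ : K) (cr_mem_span_of_mem_leviSet hD hA hγ)
    have h2 : S.cr '' (A : Set (Module.Dual K S.h)) = Set.range fun l : A => S.cr l.1 := by
      ext x; simp
    rw [h2, Submodule.mem_span_range_iff_exists_fun] at h1
    obtain ⟨c, hc⟩ := h1
    refine ⟨c, hc.symm, fun k => ?_⟩
    have h3 := congrArg k.1 hc
    rw [map_sum, map_smul, smul_eq_mul, hsym _ (hAm k) _ hγ] at h3
    have h4 := hb _ (hAm k)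
    rw [Matrix.mulVec, dotProduct]
    simp only [hG, map_smul, smul_eq_mul] at h3 ⊢
    apply mul_left_cancel₀ h4
    rw [Finset.mul_sum, ← h3]
    refine Finset.sum_congr rfl fun l _ => ?_
    field_simp
  refine ⟨fun k => S.cr k.1, fun k => ∑ l, G⁻¹ k l • S.cr l.1, fun γ h => ?_, fun γ h => ?_⟩
  · obtain ⟨c, hc, hc'⟩ := hγ γ h
    have e1 : ∀ l, c l = ∑ k, γ (S.cr k.1) * G⁻¹ k l := by
      intro l
      have h1 : (Matrix.vecMul (fun k : A => γ (S.cr k.1)) G⁻¹) = c := by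
        have : (fun k : A => γ (S.cr k.1)) = Matrix.vecMul c G := by
          rw [← Matrix.mulVec_transpose, hGs]; exact funext hc'
        rw [this, Matrix.vecMul_vecMul, Matrix.mul_nonsing_inv _ hdet, Matrix.vecMul_one]
      exact (congrFun h1 l).symm
    rw [hc]
    simp only [Finset.smul_sum, smul_smul]
    rw [Finset.sum_comm]
    refine Finset.sum_congr rfl fun l _ => ?_
    rw [e1, Finset.sum_smul]
  · obtain ⟨c, hc, hc'⟩ := hγ γ h
    rw [hc]
    refine Finset.sum_congr rfl fun k _ => ?_
    congr 1
    have h1 : G⁻¹.mulVec (fun k : A => γ (S.cr k.1)) = c := by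
      rw [funext hc', Matrix.mulVec_mulVec, Matrix.nonsing_inv_mul _ hdet, Matrix.one_mulVec]
    rw [← congrFun h1 k, map_sum, Matrix.mulVec, dotProduct]
    simp

end Levi

end Setup

end

section

namespace Setup

variable {K : Type} [Field K] [IsAlgClosed K] [CharZero K]
variable {g : Type} [LieRing g] [LieAlgebra K g] {S : Setup K g}
variable {α β γ δ : Module.Dual K S.h}

lemma env_mul (x y : g) : UniversalEnvelopingAlgebra.ι K x * UniversalEnvelopingAlgebra.ι K y
    = UniversalEnvelopingAlgebra.ι K y * UniversalEnvelopingAlgebra.ι K x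
      + UniversalEnvelopingAlgebra.ι K ⁅x, y⁆ := by
  let _ : LieRing (UniversalEnvelopingAlgebra K g) := LieRing.ofAssociativeRing
  rw [LieHom.map_lie, LieRing.of_associative_ring_bracket]; abel

lemma adNil_env {x y : g} (h : ∃ N : ℕ, (LieModule.toEnd K g g x ^ N) y = 0) :
    AdNil (UniversalEnvelopingAlgebra.ι K x) (UniversalEnvelopingAlgebra.ι K y) := by
  obtain ⟨N, hN⟩ := h
  induction N generalizing y with
  | zero =>
    rw [show y = 0 from hN, map_zero]; exact .zero
  | succ N ih =>
    refine .step ?_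
    rw [pow_succ] at hN
    have := ih hN
    rwa [LieModule.toEnd_apply_apply, ← sub_eq_of_eq_add' (env_mul x y)] at this

/-- the structure map of the enveloping algebra, as a linear map. -/
def envι (K g : Type) [Field K] [LieRing g] [LieAlgebra K g] : g →ₗ[K] Env K g :=
  let _ : LieRing (UniversalEnvelopingAlgebra K g) := LieRing.ofAssociativeRing
  (UniversalEnvelopingAlgebra.ι K : g →ₗ⁅K⁆ UniversalEnvelopingAlgebra K g).toLinearMap

lemma AdNil.of_coe {U : Type} [Ring U] [Algebra K U] {B : Subalgebra K U} {f r : B}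
    (h : AdNil (f : U) (r : U)) : AdNil f r := by
  generalize hr : (r : U) = r' at h
  induction h generalizing r with
  | zero => rw [show r = 0 from Subtype.ext hr]; exact .zero
  | step _ ih => exact .step (ih (by push_cast; rw [hr]))

/-- the subalgebra generated by `h` and the root vectors of the Levi subsystem of `A`. -/
def leviAlg (S : Setup K g) (A : Finset (Module.Dual K S.h)) : Subalgebra K (Env K g) :=
  Algebra.adjoin K (Set.range (fun a : S.h => UniversalEnvelopingAlgebra.ι K (a : g)) ∪
    (fun γ => UniversalEnvelopingAlgebra.ι K (S.rv γ)) '' leviSet A)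

variable {A : Finset (Module.Dual K S.h)} (hD : S.IsDynkin) (hA : ∀ α ∈ A, S.IsSimpleRoot α)
include hD hA

lemma reflect_mem_leviSet (hγ : γ ∈ leviSet A) (hδ : δ ∈ leviSet A) :
    δ - δ (S.cr γ) • γ ∈ leviSet A := by
  have t := (good_of_isRootOf hD hγ.1).triple
  refine ⟨t.isRootOf_reflect hδ.1, ?_⟩
  obtain ⟨z, hz⟩ := t.exists_int hδ.1.2
  rw [hz, show δ - (z : K) • γ = δ - z • γ by module]
  exact sub_mem hδ.2 (zsmul_mem hγ.2 z)

/-- the root algebra attached to a finite set of simple roots. -/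
theorem exists_rootAlg : ∃ D : RootAlg K S.h (S.leviAlg A),
    (∀ γ, γ ∈ D.Φ ↔ γ ∈ leviSet A) ∧
    (∀ a, (D.ι a : Env K g) = UniversalEnvelopingAlgebra.ι K (a : g)) ∧
    (∀ γ ∈ leviSet A, (D.e γ : Env K g) = UniversalEnvelopingAlgebra.ι K (S.rv γ)) ∧
    D.co = S.cr := by
  classical
  obtain ⟨b, hb0, hsym, hbN, hpos⟩ := exists_levi_form hD hA
  obtain ⟨t, t', ht, ht'⟩ := exists_dual_bases hD hA hb0 hsym hpos
  have hfin := finite_leviSet hD hA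
  have hg : ∀ γ ∈ leviSet A, S.Good γ := fun γ h => good_of_isRootOf hD h.1
  have hneg : ∀ γ ∈ leviSet A, -γ ∈ leviSet A := fun γ h => neg_mem_leviSet h (hg γ h)
  let j := envι K g
  have hj : ∀ x y, j x * j y = j y * j x + j ⁅x, y⁆ := env_mul
  let Φ := hfin.toFinset
  have hΦ : ∀ {γ}, γ ∈ Φ ↔ γ ∈ leviSet A := hfin.mem_toFinset
  let ι : S.h →ₗ[K] S.leviAlg A :=
    { toFun := fun a => ⟨j a, Algebra.subset_adjoin (.inl ⟨a, rfl⟩)⟩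
      map_add' := fun a b => Subtype.ext (map_add j (a : g) b)
      map_smul' := fun c a => Subtype.ext (map_smul j c (a : g)) }
  let e : Module.Dual K S.h → S.leviAlg A := fun γ =>
    if h : γ ∈ leviSet A then ⟨j (S.rv γ), Algebra.subset_adjoin (.inr ⟨γ, h, rfl⟩)⟩ else 0
  have hι : ∀ a, (ι a : Env K g) = j a := fun a => rfl
  have he : ∀ γ ∈ leviSet A, (e γ : Env K g) = j (S.rv γ) := fun γ h => by
    simp only [e, dif_pos h]
  have he0 : ∀ γ ∉ leviSet A, e γ = 0 := fun γ h => by simp only [e, dif_neg h]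
  have hN : ∀ γ δ, ∃ c : K, γ ∈ leviSet A → δ ∈ leviSet A → γ + δ ∈ leviSet A →
      ⁅S.rv γ, S.rv δ⁆ = c • S.rv (γ + δ) := by
    intro γ δ
    by_cases h : γ ∈ leviSet A ∧ δ ∈ leviSet A ∧ γ + δ ∈ leviSet A
    · obtain ⟨c, hc⟩ := (hg _ h.2.2).rv.x_gen _
        (S.lie_mem_gw (hg _ h.1).rv.hx (hg _ h.2.1).rv.hx)
      exact ⟨c, fun _ _ _ => hc⟩
    · exact ⟨0, fun h1 h2 h3 => absurd ⟨h1, h2, h3⟩ h⟩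
  choose N hN using hN
  have ι_comm : ∀ a b, ι a * ι b = ι b * ι a := fun a b => Subtype.ext (by
    simp only [MulMemClass.coe_mul, hι]
    rw [hj, S.lie_h a.2 b.2, map_zero, add_zero])
  have ι_e : ∀ a, ∀ γ ∈ Φ, ι a * e γ = e γ * ι a + γ a • e γ := fun a γ hγ => by
    have h := hΦ.1 hγ
    refine Subtype.ext ?_
    push_cast
    rw [hι, he γ h, hj, (hg γ h).rv.hx a, map_smul]
  have e_e : ∀ γ ∈ Φ, ∀ δ ∈ Φ, γ + δ ≠ 0 → e γ * e δ = e δ * e γ + N γ δ • e (γ + δ) := by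
    intro γ hγ δ hδ h0
    rw [hΦ] at hγ hδ
    refine Subtype.ext ?_
    push_cast
    rw [he γ hγ, he δ hδ, hj]
    by_cases h : γ + δ ∈ leviSet A
    · rw [hN γ δ hγ hδ h, he _ h, map_smul]
    · rw [he0 _ h, gw_add_lie (gw_eq_bot h0 fun hr => h ⟨hr, add_mem hγ.2 hδ.2⟩)
        (hg γ hγ).rv.hx (hg δ hδ).rv.hx, map_zero, ZeroMemClass.coe_zero, smul_zero]
  have e_neg : ∀ γ ∈ Φ, e γ * e (-γ) = e (-γ) * e γ + ι (S.cr γ) := fun γ hγ => by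
    have h := hΦ.1 hγ
    refine Subtype.ext ?_
    push_cast
    rw [hι, he γ h, he _ (hneg γ h), hj, (hg γ h).rv.lie]
  have neg_mem' : ∀ γ ∈ Φ, -γ ∈ Φ := fun γ h => hΦ.2 (hneg γ (hΦ.1 h))
  have gen : Algebra.adjoin K (Set.range ι ∪ e '' (Φ : Set (Module.Dual K S.h))) = ⊤ := by
    have hX : Set.range ι ∪ e '' (Φ : Set (Module.Dual K S.h)) = (S.leviAlg A).val ⁻¹'
        (Set.range (fun a : S.h => UniversalEnvelopingAlgebra.ι K (a : g)) ∪
          (fun γ => UniversalEnvelopingAlgebra.ι K (S.rv γ)) '' leviSet A) := by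
      ext x
      constructor
      · rintro (⟨a, rfl⟩ | ⟨γ, hγ, rfl⟩)
        · exact .inl ⟨a, rfl⟩
        · exact .inr ⟨γ, hΦ.1 hγ, (he γ (hΦ.1 hγ)).symm⟩
      · rintro (⟨a, ha⟩ | ⟨γ, hγ, h⟩)
        · exact .inl ⟨a, Subtype.ext ha⟩
        · exact .inr ⟨γ, hΦ.2 hγ, Subtype.ext ((he γ hγ).trans h)⟩
    rw [hX]
    exact Algebra.adjoin_adjoin_coe_preimage
  have neg_ne : ∀ γ ∈ Φ, γ ≠ -γ := fun γ hγ h => by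
    have h2 := (hg γ (hΦ.1 hγ)).triple.two
    have h3 := congrArg (fun f : Module.Dual K S.h => f (S.cr γ)) h
    simp only [LinearMap.neg_apply, h2] at h3
    have : (4 : K) = 0 := by linear_combination h3
    norm_num at this
  have b_neg : ∀ γ ∈ Φ, (b (-γ) : K) = b γ := fun γ hγ => by
    have h := hΦ.1 hγ
    have h1 := hsym γ h _ (hneg γ h)
    have h2 := (hg γ h).triple.two
    rw [(hg γ h).cr_neg, map_neg, LinearMap.neg_apply, h2] at h1
    linear_combination (-2⁻¹ : K) * h1
  have bN : ∀ γ ∈ Φ, ∀ δ ∈ Φ, γ - δ ∈ Φ →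
      (b γ : K) * N (-γ) δ = -((b (γ - δ) : K) * N (γ - δ) δ) := by
    intro γ hγ δ hδ h
    rw [hΦ] at hγ hδ h
    have h' := hneg _ h
    rw [neg_sub] at h'
    refine hbN γ hγ δ hδ h _ _ ?_ ?_
    · rw [hN _ _ (hneg γ hγ) hδ (by rwa [neg_add_eq_sub]), neg_add_eq_sub]
    · rw [hN _ _ h hδ (by rwa [sub_add_cancel]), sub_add_cancel]
  refine ⟨{
    Φ := Φ
    ι := ι
    e := e
    co := S.cr
    b := b
    I := A
    fin := inferInstance
    t := t
    t' := t'
    ι_comm := ι_comm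
    ι_e := ι_e
    e_of_notMem := fun γ h => he0 γ fun h' => h (hΦ.2 h')
    e_e := fun γ hγ δ hδ h0 => ⟨_, e_e γ hγ δ hδ h0⟩
    e_neg := e_neg
    zero_notMem := fun h => (hΦ.1 h).1.1 rfl
    neg_mem := neg_mem'
    two := fun γ hγ => (hg γ (hΦ.1 hγ)).triple.two
    reflect := fun γ hγ δ hδ => hΦ.2 (reflect_mem_leviSet hD hA (hΦ.1 hγ) (hΦ.1 hδ))
    gen := gen
    nil := fun γ hγ δ hδ => by
      rw [hΦ] at hγ hδ
      refine AdNil.of_coe ?_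
      rw [he γ hγ, he δ hδ]
      exact adNil_env (exists_pow_ad_eq_zero hγ.1.1 (hg γ hγ).rv.hx _)
    b_pos := fun γ h => hb0 γ (hΦ.1 h)
    sum_t := fun γ h => ht γ (hΦ.1 h)
    sum_t' := fun γ h => ht' γ (hΦ.1 h)
    casimir_comm := casimir_central ι_comm ι_e (fun γ h => he0 γ fun h' => h (hΦ.2 h')) e_e e_neg
      neg_ne neg_mem' gen b_neg bN (fun γ h => ht γ (hΦ.1 h)) (fun γ h => ht' γ (hΦ.1 h))
    posdef := fun s hs h0 => by
      have hs' : ∀ γ ∈ s, γ ∈ leviSet A := fun γ h => hΦ.1 (hs γ h)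
      obtain ⟨q, hq, hq'⟩ := hpos s hs' h0
      refine ⟨q, hq, ?_⟩
      rw [← hq']
      have key : ∀ (ψ : Module.Dual K S.h) (u : Multiset (Module.Dual K S.h)),
          (∀ γ ∈ u, γ ∈ leviSet A) → ∑ k, u.sum (t k) * ψ (t' k)
            = (u.map fun γ => (b γ : K) * ψ (S.cr γ)).sum := by
        intro ψ u
        induction u using Multiset.induction with
        | empty => simp
        | cons γ u ih =>
          intro hu
          have h1 := congrArg ψ (ht γ (hu γ (Multiset.mem_cons_self γ u)))
          simp only [map_sum, map_smul, smul_eq_mul] at h1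
          rw [Multiset.map_cons, Multiset.sum_cons, Multiset.sum_cons, ← h1,
            ← ih fun δ h => hu δ (Multiset.mem_cons_of_mem h), ← Finset.sum_add_distrib]
          exact Finset.sum_congr rfl fun k _ => by rw [LinearMap.add_apply, add_mul]
      exact key _ s hs' }, fun γ => hΦ, hι, he, rfl⟩

lemma isPos_of_leviSet {R : Type} [Ring R] [Algebra K R] (D : RootAlg K S.h R)
    (hΦ : ∀ γ, γ ∈ D.Φ ↔ γ ∈ leviSet A) (hco : D.co = S.cr)
    {P : Finset (Module.Dual K S.h)} (hP : ∀ γ, γ ∈ P ↔ γ ∈ leviSet A ∧ γ ∈ S.pos) :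
    D.IsPos P A where
  sub γ h := (hΦ γ).2 ((hP γ).1 h).1
  cover γ h := by
    rw [hΦ] at h
    by_cases hp : γ ∈ S.pos
    · exact .inl ((hP γ).2 ⟨h, hp⟩)
    · exact .inr ((hP _).2 ⟨neg_mem_leviSet h (good_of_isRootOf hD h.1), neg_mem_pos h.1 hp⟩)
  disj γ h h' := neg_notMem_pos ((hP γ).1 h).2 ((hP _).1 h').2
  simple_mem α h := (hP α).2 ⟨mem_leviSet_of_mem hD hA h, (hA α h).1⟩
  sum γ h := exists_sum_of_mem_leviSet hD hA ((hP γ).1 h).2 ((hP γ).1 h).1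
  sub_simple α hα γ hγ hne hm := by
    rw [hΦ] at hm
    rw [hP] at hγ ⊢
    refine ⟨⟨hm, ?_⟩, fun h => ?_⟩
    · by_contra hp
      exact (hA α hα).not_add hγ.2 (neg_mem_pos hm.1 hp) (by abel)
    · refine (hA α hα).smul_not_root hD (m := 2) le_rfl ?_
      rw [two_nsmul]
      nth_rewrite 1 [← h]
      rw [sub_add_cancel]
      exact hγ.1.1
  refl α hα γ hγ hne := by
    rw [hP] at hγ ⊢
    rw [RootAlg.refl, hco]
    exact ⟨reflect_mem_leviSet hD hA (mem_leviSet_of_mem hD hA hα) hγ.1,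
      (hA α hα).reflect_mem_pos hD hγ.2 hne⟩

end Setup

end

section

section Induced

variable {K L R : Type} [Field K] [IsAlgClosed K] [CharZero K] [LieRing L] [LieAlgebra K L] [Ring R] [Algebra K R]

lemma env_exists_lift (f : L →ₗ[K] R) (hf : ∀ x y, f x * f y = f y * f x + f ⁅x, y⁆) :
    ∃ φ : Env K L →ₐ[K] R, ∀ x, φ (UniversalEnvelopingAlgebra.ι K x) = f x := by
  let _ : LieRing R := LieRing.ofAssociativeRing
  let f' : L →ₗ⁅K⁆ R :=
    { toLinearMap := f
      map_lie' := fun {x y} => by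
        change f ⁅x, y⁆ = ⁅f x, f y⁆
        rw [LieRing.of_associative_ring_bracket, hf]; abel }
  exact ⟨UniversalEnvelopingAlgebra.lift K f', UniversalEnvelopingAlgebra.lift_ι_apply K f'⟩

lemma env_hom_ext {φ ψ : Env K L →ₐ[K] R}
    (h : ∀ x, φ (UniversalEnvelopingAlgebra.ι K x) = ψ (UniversalEnvelopingAlgebra.ι K x)) :
    φ = ψ := by
  let _ : LieRing R := LieRing.ofAssociativeRing
  exact UniversalEnvelopingAlgebra.hom_ext K (LieHom.ext h)

lemma env_adjoin : Algebra.adjoin K (Set.range fun x : L => UniversalEnvelopingAlgebra.ι K x) = ⊤ := by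
  set B := Algebra.adjoin K (Set.range fun x : L => UniversalEnvelopingAlgebra.ι K x)
  obtain ⟨φ, hφ⟩ := env_exists_lift (R := B)
    { toFun := fun x : L => ⟨Setup.envι K L x, Algebra.subset_adjoin ⟨x, rfl⟩⟩
      map_add' := fun x y => Subtype.ext (map_add (Setup.envι K L) x y)
      map_smul' := fun c x => Subtype.ext (map_smul (Setup.envι K L) c x) }
    (fun x y => Subtype.ext (Setup.env_mul x y))
  have h : B.val.comp φ = AlgHom.id K _ := env_hom_ext fun x => by
    rw [AlgHom.comp_apply, hφ]; rfl
  refine eq_top_iff.2 fun r _ => ?_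
  have := congrArg (fun ψ : Env K L →ₐ[K] Env K L => ψ r) h
  change ((φ r : B) : Env K L) = r at this
  rw [← this]
  exact (φ r).2

lemma env_mem {Q : Submodule K (Env K L)} (h1 : 1 ∈ Q)
    (h : ∀ x : L, ∀ w ∈ Q, UniversalEnvelopingAlgebra.ι K x * w ∈ Q) (w : Env K L) : w ∈ Q := by
  have := smul_mem_of_adjoin (M := Env K L) env_adjoin (Q := Q)
    (by rintro _ ⟨x, rfl⟩ m hm; exact h x m hm) w h1
  rwa [smul_eq_mul, mul_one] at this

/-- a character of a subalgebra with a complementary subalgebra extends to an eigenvector in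
a module. -/
theorem exists_eigenvector_module {N B : LieSubalgebra K L} (hc : IsCompl N.toSubmodule B.toSubmodule)
    (χ : B →ₗ[K] K) (hχ : ∀ x y : B, χ ⁅x, y⁆ = 0) :
    ∃ (V : Type) (_ : AddCommGroup V) (_ : Module K V) (φ : Env K L →ₐ[K] Module.End K V) (v : V),
      v ≠ 0 ∧ ∀ x : B, φ (UniversalEnvelopingAlgebra.ι K (x : L)) v = χ x • v := by
  let U := Env K N
  let j := Setup.envι K N
  have hj : ∀ x y, j x * j y = j y * j x + j ⁅x, y⁆ := Setup.env_mul
  let act : N →ₗ[K] Module.End K (L →ₗ[K] U) :=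
    LinearMap.mk₂ K (fun f a => (LinearMap.mulLeft K (j f)).comp a
        - a.comp (LieModule.toEnd K L L (N.incl f)))
      (fun f f' a => by
        ext z
        simp only [LinearMap.sub_apply, LinearMap.comp_apply, LinearMap.mulLeft_apply, map_add,
          LinearMap.add_apply, add_mul]
        abel)
      (fun c f a => by
        ext z
        simp only [LinearMap.sub_apply, LinearMap.comp_apply, LinearMap.mulLeft_apply, map_smul,
          LinearMap.smul_apply, smul_mul_assoc, smul_sub])
      (fun f a a' => by
        ext z
        simp only [LinearMap.sub_apply, LinearMap.comp_apply, LinearMap.mulLeft_apply, map_add,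
          LinearMap.add_apply]
        abel)
      (fun c f a => by
        ext z
        simp only [LinearMap.sub_apply, LinearMap.comp_apply, LinearMap.mulLeft_apply, map_smul,
          LinearMap.smul_apply, smul_sub])
  have hact : ∀ f a z, act f a z = j f * a z - a ⁅(f : L), z⁆ := fun f a z => rfl
  obtain ⟨ψ, hψ⟩ := env_exists_lift (K := K) (L := N) (R := Module.End K (L →ₗ[K] U)) act (fun f f' => by
    refine LinearMap.ext fun a => LinearMap.ext fun z => ?_
    simp only [Module.End.mul_apply, LinearMap.add_apply, hact, LieSubalgebra.coe_bracket,
      mul_sub, ← mul_assoc]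
    rw [hj f f', lie_lie, map_sub, add_mul]
    abel)
  let χ' : B.toSubmodule →ₗ[K] U := (Algebra.linearMap K U).comp χ
  let a₀ : L →ₗ[K] U := LinearMap.ofIsCompl hc j χ'
  have a₀N : ∀ f : N, a₀ f = j f := fun f => LinearMap.ofIsCompl_apply_left hc f
  have a₀B : ∀ x : B, a₀ x = algebraMap K U (χ x) := fun x => LinearMap.ofIsCompl_apply_right hc x
  let A : L →ₗ[K] Module.End K U :=
    LinearMap.mk₂ K (fun x w => ψ w a₀ x) (fun x y w => map_add _ x y) (fun c x w => map_smul _ c x)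
      (fun x w w' => by rw [map_add]; rfl) (fun c x w => by rw [map_smul]; rfl)
  have A_one : ∀ x, A x 1 = a₀ x := fun x => by
    change ψ 1 a₀ x = _
    rw [map_one]; rfl
  have A_mul : ∀ x (f : N) w, A x (j f * w) = j f * A x w - A ⁅(f : L), x⁆ w := fun x f w => by
    change ψ (j f * w) a₀ x = _
    rw [map_mul, show ψ (j f) = act f from hψ f, Module.End.mul_apply, hact]; rfl
  have A_left : ∀ (f : N) w, A f w = j f * w := by
    intro f w
    let Q : Submodule K U := ⨅ f : N, LinearMap.ker (A f - LinearMap.mulLeft K (j f))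
    have hQ : ∀ {w}, w ∈ Q ↔ ∀ f : N, A f w = j f * w := by
      intro w; simp [Q, Submodule.mem_iInf, sub_eq_zero]
    refine hQ.1 (env_mem (Q := Q) (hQ.2 fun f => ?_) (fun f w hw => hQ.2 fun f' => ?_) w) f
    · rw [A_one, a₀N, mul_one]
    · change A f' (j f * w) = j f' * (j f * w)
      rw [hQ] at hw
      rw [A_mul, hw, ← LieSubalgebra.coe_bracket, hw, ← mul_assoc, ← mul_assoc, hj f f', add_mul,
        add_sub_cancel_right]
  have hD : ∀ w x y, A x (A y w) = A y (A x w) + A ⁅x, y⁆ w := by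
    have hN : ∀ (f : N) y w, A f (A y w) = A y (A f w) + A ⁅(f : L), y⁆ w := fun f y w => by
      rw [A_left, A_left, A_mul]; abel
    have hN' : ∀ (f : N) x w, A x (A f w) = A f (A x w) + A ⁅x, (f : L)⁆ w := fun f x w => by
      rw [hN, ← lie_skew, map_neg, LinearMap.neg_apply]; abel
    let Q : Submodule K U := ⨅ x : L, ⨅ y : L, LinearMap.ker (A x * A y - (A y * A x + A ⁅x, y⁆))
    have hQ : ∀ {w}, w ∈ Q ↔ ∀ x y, A x (A y w) = A y (A x w) + A ⁅x, y⁆ w := by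
      intro w; simp only [Q, Submodule.mem_iInf, LinearMap.mem_ker, LinearMap.sub_apply, sub_eq_zero,
        Module.End.mul_apply, LinearMap.add_apply]
    refine fun w => hQ.1 (env_mem (Q := Q) (hQ.2 fun x y => ?_) (fun f w hw => hQ.2 fun x y => ?_) w)
    · obtain ⟨f, hf, x', hx', rfl⟩ := Submodule.mem_sup.1
        (show x ∈ N.toSubmodule ⊔ B.toSubmodule by rw [hc.sup_eq_top]; trivial)
      obtain ⟨f', hf', y', hy', rfl⟩ := Submodule.mem_sup.1
        (show y ∈ N.toSubmodule ⊔ B.toSubmodule by rw [hc.sup_eq_top]; trivial)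
      have e1 := hN ⟨f, hf⟩ f' 1
      have e0 := hN ⟨f, hf⟩ y' 1
      have e2 := hN' ⟨f', hf'⟩ x' 1
      have e3 : A x' (A y' 1) = A y' (A x' 1) + A ⁅x', y'⁆ 1 := by
        have h1 := hχ ⟨x', hx'⟩ ⟨y', hy'⟩
        have h2 := a₀B ⁅(⟨x', hx'⟩ : B), (⟨y', hy'⟩ : B)⁆
        rw [h1, map_zero, LieSubalgebra.coe_bracket] at h2
        have h3 := a₀B ⟨x', hx'⟩
        have h4 := a₀B ⟨y', hy'⟩
        simp only at h2 h3 h4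
        rw [A_one, A_one, A_one, h2, h3, h4, Algebra.algebraMap_eq_smul_one,
          Algebra.algebraMap_eq_smul_one, map_smul, map_smul, A_one, A_one, h3, h4,
          Algebra.algebraMap_eq_smul_one, Algebra.algebraMap_eq_smul_one, smul_comm, add_zero]
      simp only [map_add, LinearMap.add_apply, add_lie, lie_add] at e0 e1 e2 e3 ⊢
      rw [e0, e1, e2, e3]
      abel
    · rw [hQ] at hw
      change A x (A y (j f * w)) = A y (A x (j f * w)) + A ⁅x, y⁆ (j f * w)
      rw [A_mul, A_mul, A_mul, map_sub, map_sub, A_mul, A_mul, hw x y, hw x ⁅(f : L), y⁆,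
        hw y ⁅(f : L), x⁆, leibniz_lie (f : L) x y, map_add, LinearMap.add_apply, mul_add,
        ← lie_skew ⁅(f : L), x⁆ y, map_neg, LinearMap.neg_apply]
      abel
  obtain ⟨φ, hφ⟩ := env_exists_lift A (fun x y => LinearMap.ext fun w => hD w x y)
  refine ⟨U, inferInstance, inferInstance, φ, 1, ?_, fun x => ?_⟩
  · obtain ⟨ε, -⟩ := env_exists_lift (0 : N →ₗ[K] K) (fun x y => by simp)
    intro h
    have := congrArg ε h
    rw [map_one, map_zero] at this
    exact one_ne_zero this
  · rw [hφ, A_one, a₀B, Algebra.algebraMap_eq_smul_one]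

end Induced

end

section

namespace Setup

variable {K : Type} [Field K] [IsAlgClosed K] [CharZero K]
variable {g : Type} [LieRing g] [LieAlgebra K g] {S : Setup K g}
variable {lam mu : Module.Dual K S.h}

lemma exists_form_extension (mu : Module.Dual K S.h) : ∃ χ : g →ₗ[K] K, (∀ H : S.h, χ H = mu H) ∧
    ∀ α : Module.Dual K S.h, α ≠ 0 → ∀ x ∈ S.gw α, χ x = 0 := by
  have hc : IsCompl S.h.toSubmodule (⨆ α : Module.Dual K S.h, ⨆ (_ : α ≠ 0), S.gw α) := by
    rw [← S.gw_zero]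
    refine ⟨S.h_indep 0, codisjoint_iff.2 (eq_top_iff.2 (S.h_span.ge.trans (iSup_le fun α => ?_)))⟩
    by_cases h0 : α = 0
    · exact h0 ▸ le_sup_left
    · exact le_sup_of_le_right (le_iSup₂_of_le α h0 le_rfl)
  refine ⟨LinearMap.ofIsCompl hc mu 0, fun H => LinearMap.ofIsCompl_apply_left hc H,
    fun α h0 x hx => ?_⟩
  exact LinearMap.ofIsCompl_apply_right (φ := mu) (ψ := 0) hc
    ⟨x, Submodule.mem_iSup_of_mem α (Submodule.mem_iSup_of_mem h0 hx)⟩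

lemma form_lie_eq_zero {χ : g →ₗ[K] K}
    (hχ : ∀ α : Module.Dual K S.h, α ≠ 0 → ∀ x ∈ S.gw α, χ x = 0) {x y : g} (hx : x ∈ S.b)
    (hy : y ∈ S.b) : χ ⁅x, y⁆ = 0 := by
  rw [← LieSubalgebra.mem_toSubmodule, b_eq_iSup] at hx hy
  have h1 : ∀ α ∈ insert 0 S.pos, ∀ x ∈ S.gw α, ∀ β ∈ insert 0 S.pos, ∀ y ∈ S.gw β,
      χ ⁅x, y⁆ = 0 := by
    intro α hα x hx β hβ y hy
    by_cases h0 : α + β = 0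
    · rcases hα with rfl | hα
      · rw [zero_add] at h0
        subst h0
        rw [gw_zero] at hx hy
        rw [S.lie_h hx hy, map_zero]
      · rcases hβ with rfl | hβ
        · rw [add_zero] at h0
          exact (zero_notMem_pos (h0 ▸ hα)).elim
        · exact (add_ne_zero_of_pos hα hβ h0).elim
    · exact hχ _ h0 _ (S.lie_mem_gw hx hy)
  have h2 : ∀ α ∈ insert 0 S.pos, ∀ x ∈ S.gw α, χ ⁅x, y⁆ = 0 := by
    intro α hα x hx
    have : (⨆ α ∈ insert 0 S.pos, S.gw α) ≤ LinearMap.ker (χ.comp (LieModule.toEnd K g g x)) :=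
      iSup₂_le fun β hβ y hy => h1 α hα x hx β hβ y hy
    exact this hy
  have : (⨆ α ∈ insert 0 S.pos, S.gw α) ≤ LinearMap.ker (χ.comp (LieModule.toEnd K g g y)) :=
    iSup₂_le fun α hα x hx => by
      change χ ⁅y, x⁆ = 0
      rw [← lie_skew, map_neg, h2 α hα x hx, neg_zero]
  have h := this hx
  change χ ⁅y, x⁆ = 0 at h
  rw [← lie_skew, map_neg, h, neg_zero]

lemma neg_closed (hD : S.IsDynkin) : ∀ α ∈ {α | -α ∈ S.pos}, ∀ β ∈ {α | -α ∈ S.pos},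
    α + β ∈ {α | -α ∈ S.pos} ∨ S.gw (α + β) = ⊥ := by
  have hr : ∀ α, -α ∈ S.pos → IsRootOf K g S.h α := fun α h => by
    have := (good_of_mem_pos hD h).neg.isRootOf
    rwa [neg_neg] at this
  have hn : ∀ α, -α ∈ S.pos → α ∉ S.pos := fun α h h' => neg_notMem_pos h' h
  intro α hα β hβ
  by_cases h : IsRootOf K g S.h (α + β)
  · exact Or.inl (neg_mem_pos h (S.neg_add α β (hr α hα) (hr β hβ) (hn α hα) (hn β hβ) h))
  · refine Or.inr (gw_eq_bot (fun h0 => add_ne_zero_of_pos hα hβ ?_) h)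
    rw [← _root_.neg_add, h0, neg_zero]

theorem one_notMem_vermaIdeal (hD : S.IsDynkin) (mu : Module.Dual K S.h) :
    (1 : Env K g) ∉ S.vermaIdeal mu := by
  obtain ⟨χ, hχ, hχ0⟩ := S.exists_form_extension mu
  let N := wtSubalgebra S {α | -α ∈ S.pos} (neg_closed hD)
  have hN : N.toSubmodule = ⨆ α ∈ {α | -α ∈ S.pos}, S.gw α := rfl
  have hc : IsCompl N.toSubmodule S.b.toSubmodule := by
    rw [hN, b_eq_iSup]
    refine ⟨S.h_indep.disjoint_biSup_biSup (Set.disjoint_left.2 fun α hα h => ?_),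
      codisjoint_iff.2 (eq_top_iff.2 (S.h_span.ge.trans (iSup_le fun α => ?_)))⟩
    · rcases h with rfl | h
      · rw [Set.mem_ofPred_eq, neg_zero] at hα
        exact zero_notMem_pos hα
      · exact neg_notMem_pos h hα
    · change S.gw α ≤ _
      by_cases h0 : α = 0
      · exact le_sup_of_le_right (le_iSup₂_of_le α (Or.inl h0) le_rfl)
      by_cases hr : IsRootOf K g S.h α
      · by_cases hp : α ∈ S.pos
        · exact le_sup_of_le_right (le_iSup₂_of_le α (Or.inr hp) le_rfl)
        · exact le_sup_of_le_left (le_iSup₂_of_le (f := fun α _ => S.gw α) α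
            (neg_mem_pos hr hp) le_rfl)
      · exact (gw_eq_bot h0 hr).le.trans bot_le
  obtain ⟨V, _, _, φ, v, hv, hφ⟩ := exists_eigenvector_module hc (χ.comp S.b.toSubmodule.subtype)
    (fun x y => form_lie_eq_zero hχ0 x.2 y.2)
  let I : Submodule (Env K g) (Env K g) :=
    { carrier := {w | φ w v = 0}
      add_mem' := fun {a b} ha hb => by
        change φ (a + b) v = 0
        rw [map_add, LinearMap.add_apply, show φ a v = 0 from ha, show φ b v = 0 from hb, add_zero]
      zero_mem' := by change φ 0 v = 0; rw [map_zero, LinearMap.zero_apply]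
      smul_mem' := fun r a ha => by
        change φ (r * a) v = 0
        rw [map_mul, Module.End.mul_apply, show φ a v = 0 from ha, map_zero] }
  have hI : S.vermaIdeal mu ≤ I := by
    refine Submodule.span_le.2 ?_
    rintro _ (⟨x, hx, rfl⟩ | ⟨H, rfl⟩)
    · have hxb : x ∈ S.b := by
        rw [← LieSubalgebra.mem_toSubmodule, S.b_eq]
        exact Submodule.mem_sup_right hx
      have h0 : χ x = 0 := by
        have : S.nplus ≤ LinearMap.ker χ := iSup₂_le fun α hα x hx =>
          hχ0 α (fun h => zero_notMem_pos (h ▸ hα)) x hx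
        exact this hx
      change φ (UniversalEnvelopingAlgebra.ι K x) v = 0
      rw [hφ ⟨x, hxb⟩]
      change χ x • v = 0
      rw [h0, zero_smul]
    · have hxb : (H : g) ∈ S.b := by
        rw [← LieSubalgebra.mem_toSubmodule, S.b_eq]
        exact Submodule.mem_sup_left H.2
      change φ (UniversalEnvelopingAlgebra.ι K (H : g) - algebraMap K (Env K g) (mu H)) v = 0
      rw [map_sub, LinearMap.sub_apply, hφ ⟨H, hxb⟩, AlgHom.commutes, Module.algebraMap_end_apply]
      change χ H • v - _ = 0
      rw [hχ, sub_self]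
  intro h
  have := hI h
  change φ 1 v = 0 at this
  rw [map_one] at this
  exact hv this

section Singular

variable {M M' : Type} [AddCommGroup M] [Module (Env K g) M] [AddCommGroup M']
  [Module (Env K g) M']

variable (S) in
/-- a singular vector of weight `lam`. -/
structure Sing (lam : Module.Dual K S.h) (u : M) : Prop where
  kill : ∀ α ∈ S.pos, ∀ x ∈ S.gw α, UniversalEnvelopingAlgebra.ι K x • u = 0
  wt : ∀ H : S.h, UniversalEnvelopingAlgebra.ι K (H : g) • u
    = algebraMap K (Env K g) (lam H) • u

lemma Sing.map {u : M} (h : S.Sing lam u) (f : M →ₗ[Env K g] M') : S.Sing lam (f u) where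
  kill α hα x hx := by rw [← map_smul, h.kill α hα x hx, map_zero]
  wt H := by rw [← map_smul, h.wt, map_smul]

lemma sing_one (lam : Module.Dual K S.h) :
    S.Sing lam (Submodule.Quotient.mk 1 : S.Verma lam) where
  kill α hα x hx := by
    rw [← Submodule.Quotient.mk_smul, Submodule.Quotient.mk_eq_zero, smul_eq_mul, mul_one]
    exact Submodule.subset_span (Or.inl ⟨x, Submodule.mem_iSup_of_mem α
      (Submodule.mem_iSup_of_mem hα hx), rfl⟩)
  wt H := by
    rw [← Submodule.Quotient.mk_smul, ← Submodule.Quotient.mk_smul, Submodule.Quotient.eq,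
      smul_eq_mul, smul_eq_mul, mul_one, mul_one]
    exact Submodule.subset_span (Or.inr ⟨H, rfl⟩)

variable (S) in
/-- the images of the weight vectors of the Borel subalgebra in the enveloping algebra. -/
def borelSet : Set (Env K g) :=
  {r | ∃ α ∈ insert 0 S.pos, ∃ x ∈ S.gw α, r = UniversalEnvelopingAlgebra.ι K x}

variable (S) in
/-- the images of the negative root vectors in the enveloping algebra. -/
def negSet : Set (Env K g) :=
  {r | ∃ α ∈ S.pos, ∃ x ∈ S.gw (-α), r = UniversalEnvelopingAlgebra.ι K x}

lemma ι_mem_span (x : g) :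
    UniversalEnvelopingAlgebra.ι K x ∈ Submodule.span K (S.borelSet ∪ S.negSet) := by
  have h : (⊤ : Submodule K g) ≤
      (Submodule.span K (S.borelSet ∪ S.negSet)).comap (envι K g) := by
    rw [← S.gw_le_top_sup, ← S.gw_zero]
    refine sup_le (iSup₂_le fun α hα x hx => ?_)
      (sup_le (fun x hx => ?_) (iSup₂_le fun α hα x hx => ?_))
    · exact Submodule.subset_span (Or.inl ⟨α, Or.inr hα, x, hx, rfl⟩)
    · exact Submodule.subset_span (Or.inl ⟨0, Or.inl rfl, x, hx, rfl⟩)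
    · exact Submodule.subset_span (Or.inr ⟨α, hα, x, hx, rfl⟩)
  exact h (x := x) trivial

lemma adjoin_borelSet_negSet : Algebra.adjoin K (S.borelSet ∪ S.negSet) = ⊤ := by
  rw [eq_top_iff, ← env_adjoin]
  refine Algebra.adjoin_le ?_
  rintro _ ⟨x, rfl⟩
  exact Algebra.span_le_adjoin K _ (S.ι_mem_span x)

variable [Module K M] [IsScalarTower K (Env K g) M]

lemma Sing.smul_mem {u : M} (h : S.Sing lam u) {Q : Submodule K M} (huQ : u ∈ Q)
    (hQ : ∀ f ∈ S.negSet, ∀ m ∈ Q, f • m ∈ Q) (r : Env K g) : r • u ∈ Q := by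
  refine smul_mem_of_triangular (S.adjoin_borelSet_negSet) ?_ ?_ huQ hQ r
  · rintro _ ⟨α, -, x, -, rfl⟩ _ ⟨β, -, y, -, rfl⟩
    rw [env_mul, add_sub_cancel_left]
    exact S.ι_mem_span _
  · rintro _ ⟨α, rfl | hα, x, hx, rfl⟩
    · rw [gw_zero] at hx
      exact ⟨lam ⟨x, hx⟩, by rw [h.wt ⟨x, hx⟩, algebraMap_smul]⟩
    · exact ⟨0, by rw [h.kill α hα x hx, zero_smul]⟩

lemma Sing.exists_mem_adjoin {u : M} (h : S.Sing lam u) (r : Env K g) :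
    ∃ a ∈ Algebra.adjoin K S.negSet, r • u = a • u := by
  let Q : Submodule K M := (Subalgebra.toSubmodule (Algebra.adjoin K S.negSet)).map
    ((LinearMap.toSpanSingleton (Env K g) M u).restrictScalars K)
  have : r • u ∈ Q := h.smul_mem (Q := Q) ⟨1, one_mem (Algebra.adjoin K S.negSet), one_smul _ _⟩ (by
    rintro f hf _ ⟨a, ha, rfl⟩
    exact ⟨f * a, (Algebra.adjoin K S.negSet).mul_mem (Algebra.subset_adjoin hf) ha, mul_smul _ _ _⟩) r
  obtain ⟨a, ha, h⟩ := this
  exact ⟨a, ha, h.symm⟩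

lemma smul_mem_wtSpace {α : Module.Dual K S.h} {x : g} (hx : x ∈ S.gw α) {m : M}
    (hm : m ∈ S.wtSpace M lam) :
    UniversalEnvelopingAlgebra.ι K x • m ∈ S.wtSpace M (lam + α) := by
  intro H
  have hx' : ⁅(H : g), x⁆ = α H • x := hx H
  rw [← mul_smul, env_mul, add_smul, mul_smul, hm H, hx', map_smul, smul_smul_comm', smul_assoc,
    LinearMap.add_apply, add_smul]

variable (S) in
/-- the weights strictly below `mu`. -/
def below (mu : Module.Dual K S.h) : Set (Module.Dual K S.h) :=
  {ν | ∃ s : Multiset (Module.Dual K S.h), s ≠ 0 ∧ (∀ β ∈ s, β ∈ S.pos) ∧ mu - ν = s.sum}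

lemma notMem_below (hD : S.IsDynkin) : mu ∉ S.below mu := by
  rintro ⟨s, hs0, hs, h⟩
  rw [sub_self] at h
  exact sum_ne_zero_of_good s hs0 (fun δ hδ => ⟨good_of_mem_pos hD (hs δ hδ), hs δ hδ⟩) h.symm

lemma sub_mem_below {α ν : Module.Dual K S.h} (hα : α ∈ S.pos) (h : ν ∈ insert mu (S.below mu)) :
    ν + -α ∈ S.below mu := by
  rcases h with rfl | ⟨s, -, hs, h⟩
  · exact ⟨{α}, Multiset.singleton_ne_zero α, by simpa using hα, by
      rw [Multiset.sum_singleton]; abel⟩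
  · exact ⟨α ::ₘ s, Multiset.cons_ne_zero, fun β hβ => by
      rcases Multiset.mem_cons.1 hβ with rfl | hβ
      exacts [hα, hs β hβ], by rw [Multiset.sum_cons, ← h]; abel⟩

lemma mem_of_mem_wtSpace_sup {A : Set (Module.Dual K S.h)} (N : Submodule (Env K g) M)
    (hA : mu ∉ A) {m : M} (hm : m ∈ S.wtSpace M mu)
    (h : m ∈ N.restrictScalars K ⊔ ⨆ ν ∈ A, S.wtSpace M ν) : m ∈ N :=
  mem_of_mem_sup (op := fun H : S.h => smulEnd K (UniversalEnvelopingAlgebra.ι K (H : g)))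
    (wt := fun (ν : Module.Dual K S.h) H => ν H) (N := N.restrictScalars K)
    (fun _ _ h => LinearMap.ext (congrFun h)) (fun _ _ hv => N.smul_mem _ hv) (S.wtSpace M)
    (fun _ _ hv H => hv H) hA hm h

end Singular

lemma one_notMem_maxSub (hD : S.IsDynkin) (mu : Module.Dual K S.h) :
    (Submodule.Quotient.mk 1 : S.Verma mu) ∉ S.maxSub mu := by
  set u : S.Verma mu := Submodule.Quotient.mk 1 with hu
  have hs : S.Sing mu u := sing_one mu
  have hu0 : u ≠ 0 := fun h =>
    one_notMem_vermaIdeal hD mu ((Submodule.Quotient.mk_eq_zero _).1 h)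
  have huw : u ∈ S.wtSpace (S.Verma mu) mu := fun H => by rw [hs.wt, algebraMap_smul]
  have hgen : ∀ m : S.Verma mu, ∃ r : Env K g, m = r • u := fun m => by
    obtain ⟨r, rfl⟩ := Submodule.Quotient.mk_surjective _ m
    exact ⟨r, by rw [hu, ← Submodule.Quotient.mk_smul, smul_eq_mul, mul_one]⟩
  set L : Submodule K (S.Verma mu) := ⨆ ν ∈ S.below mu, S.wtSpace (S.Verma mu) ν
  have hlow : ∀ f ∈ S.negSet, ∀ ν ∈ insert mu (S.below mu), ∀ m ∈ S.wtSpace (S.Verma mu) ν,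
      f • m ∈ L := by
    rintro _ ⟨α, hα, x, hx, rfl⟩ ν hν m hm
    exact Submodule.mem_iSup_of_mem _ (Submodule.mem_iSup_of_mem (sub_mem_below hα hν)
      (smul_mem_wtSpace hx hm))
  have htop : ∀ m : S.Verma mu, m ∈ Submodule.span K {u} ⊔ L := fun m => by
    obtain ⟨r, rfl⟩ := hgen m
    refine hs.smul_mem (Submodule.mem_sup_left (Submodule.mem_span_singleton_self u)) ?_ r
    intro f hf
    have : Submodule.span K {u} ⊔ L ≤ L.comap (smulEnd K f) :=
      sup_le ((Submodule.span_singleton_le_iff_mem _ _).2 (hlow f hf mu (Or.inl rfl) u huw))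
        (iSup₂_le fun ν hν m hm => hlow f hf ν (Or.inr hν) m hm)
    exact fun m hm => Submodule.mem_sup_right (this hm)
  have hN : ∀ N : Submodule (Env K g) (S.Verma mu), N ≠ ⊤ → ∀ n ∈ N, n ∈ L := by
    intro N hN n hn
    obtain ⟨a, ha, l, hl, rfl⟩ := Submodule.mem_sup.1 (htop n)
    obtain ⟨c, rfl⟩ := Submodule.mem_span_singleton.1 ha
    have hc : c • u ∈ N := by
      refine mem_of_mem_wtSpace_sup N (notMem_below hD) (Submodule.smul_mem _ c huw) ?_
      rw [← add_sub_cancel_right (c • u) l]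
      exact sub_mem (Submodule.mem_sup_left hn) (Submodule.mem_sup_right hl)
    rcases eq_or_ne c 0 with rfl | h0
    · rwa [zero_smul, zero_add]
    · refine (hN (eq_top_iff.2 fun m _ => ?_)).elim
      obtain ⟨r, rfl⟩ := hgen m
      have := N.smul_mem (algebraMap K (Env K g) c⁻¹) hc
      rw [algebraMap_smul, smul_smul, inv_mul_cancel₀ h0, one_smul] at this
      exact N.smul_mem r this
  intro h
  rw [maxSub, sSup_eq_iSup'] at h
  have hL : u ∈ L := Submodule.iSup_induction _ (motive := fun m => m ∈ L) h
    (fun N n hn => hN N.1 N.2 n hn) (zero_mem _) (fun _ _ => add_mem)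
  exact hu0 ((Submodule.mem_bot (Env K g)).1
    (mem_of_mem_wtSpace_sup ⊥ (notMem_below hD) huw (Submodule.mem_sup_right hL)))

/-- a composition factor of a Verma module yields a nonzero singular vector in a highest weight
module. -/
theorem exists_singular (hD : S.IsDynkin) (hfac : S.IsCompFactor (S.Verma lam) mu) :
    ∃ (M : Type) (_ : AddCommGroup M) (_ : Module K M) (_ : Module (Env K g) M)
      (_ : IsScalarTower K (Env K g) M) (u v : M) (r : Env K g),
      S.Sing lam u ∧ S.Sing mu v ∧ v ≠ 0 ∧ v = r • u := by
  obtain ⟨_, _, T, _, _, j, _, ⟨e⟩⟩ := hfac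
  set N₁ := T.c j.castSucc
  set N₂ := T.c j.succ
  let f : subQuot N₁ N₂ →ₗ[Env K g] S.Verma lam ⧸ N₁ :=
    Submodule.mapQ (N₁.comap N₂.subtype) N₁ N₂.subtype le_rfl
  have hf : Function.Injective f := by
    rw [← LinearMap.ker_eq_bot, Submodule.ker_mapQ, Submodule.mkQ_map_self]
  let w : S.SimpleL mu := Submodule.Quotient.mk (Submodule.Quotient.mk 1)
  have hw : S.Sing mu w := (sing_one mu).map (S.maxSub mu).mkQ
  have hw0 : w ≠ 0 := fun h =>
    one_notMem_maxSub hD mu ((Submodule.Quotient.mk_eq_zero _).1 h)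
  obtain ⟨m, hm⟩ := Submodule.Quotient.mk_surjective _ (f (e.symm w))
  obtain ⟨r, rfl⟩ := Submodule.Quotient.mk_surjective _ m
  refine ⟨S.Verma lam ⧸ N₁, inferInstance, inferInstance, inferInstance, inferInstance,
    Submodule.Quotient.mk (Submodule.Quotient.mk 1), f (e.symm w), r,
    (sing_one lam).map N₁.mkQ, (hw.map e.symm.toLinearMap).map f, fun h => hw0 ?_, ?_⟩
  · rw [← map_zero f] at h
    exact e.symm.map_eq_zero_iff.1 (hf h)
  · rw [← hm, ← Submodule.Quotient.mk_smul, ← Submodule.Quotient.mk_smul, smul_eq_mul, mul_one]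

end Setup

end

section

namespace Setup

variable {K : Type} [Field K] [IsAlgClosed K] [CharZero K]
variable {g : Type} [LieRing g] [LieAlgebra K g] {S : Setup K g}
variable {lam mu : Module.Dual K S.h}

lemma leviAlg_mono {A B : Finset (Module.Dual K S.h)} (h : A ⊆ B) : S.leviAlg A ≤ S.leviAlg B :=
  Algebra.adjoin_mono (Set.union_subset_union_right _ (Set.image_mono fun _ hγ =>
    ⟨hγ.1, AddSubgroup.closure_mono (Finset.coe_subset.2 h) hγ.2⟩))

lemma exists_mem_leviAlg (hD : S.IsDynkin) {a : Env K g} (ha : a ∈ Algebra.adjoin K S.negSet) :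
    ∃ A : Finset (Module.Dual K S.h), (∀ α ∈ A, S.IsSimpleRoot α) ∧ a ∈ S.leviAlg A := by
  classical
  have hU : ∀ {A B : Finset (Module.Dual K S.h)}, (∀ α ∈ A, S.IsSimpleRoot α) →
      (∀ α ∈ B, S.IsSimpleRoot α) → ∀ α ∈ A ∪ B, S.IsSimpleRoot α := fun hA hB α hα =>
    (Finset.mem_union.1 hα).elim (hA α) (hB α)
  induction ha using Algebra.adjoin_induction with
  | mem r hr =>
    obtain ⟨α, hα, x, hx, rfl⟩ := hr
    obtain ⟨s, hs, hsum⟩ := exists_simple_sum' hD hα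
    have hg := good_of_mem_pos hD hα
    refine ⟨s.toFinset, fun δ hδ => hs δ (Multiset.mem_toFinset.1 hδ), ?_⟩
    obtain ⟨c, rfl⟩ := hg.rv.symm.x_gen x hx
    have hmem : -α ∈ leviSet s.toFinset := neg_mem_leviSet ⟨S.pos_root α hα, by
      rw [← hsum]
      exact multiset_sum_mem _ fun δ hδ =>
        AddSubgroup.subset_closure (Finset.mem_coe.2 (Multiset.mem_toFinset.2 hδ))⟩ hg
    have h : UniversalEnvelopingAlgebra.ι K (S.rv (-α)) ∈ S.leviAlg s.toFinset :=
      Algebra.subset_adjoin (Or.inr ⟨-α, hmem, rfl⟩)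
    rw [map_smul]
    exact Subalgebra.smul_mem _ h c
  | algebraMap c => exact ⟨∅, by simp, Subalgebra.algebraMap_mem _ c⟩
  | add x y _ _ hx hy =>
    obtain ⟨A, hA, hx⟩ := hx
    obtain ⟨B, hB, hy⟩ := hy
    exact ⟨A ∪ B, hU hA hB, add_mem (leviAlg_mono Finset.subset_union_left hx)
      (leviAlg_mono Finset.subset_union_right hy)⟩
  | mul x y _ _ hx hy =>
    obtain ⟨A, hA, hx⟩ := hx
    obtain ⟨B, hB, hy⟩ := hy
    exact ⟨A ∪ B, hU hA hB, mul_mem (leviAlg_mono Finset.subset_union_left hx)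
      (leviAlg_mono Finset.subset_union_right hy)⟩

lemma exists_weyl_of_conj (hD : S.IsDynkin) {R : Type} [Ring R] [Algebra K R]
    {D : RootAlg K S.h R} (hΦ : ∀ γ ∈ D.Φ, IsRootOf K g S.h γ) (hco : D.co = S.cr)
    {δ : Module.Dual K S.h} (hδ : ∀ γ ∈ D.Φ, δ (S.cr γ) = 0) {x y : Module.Dual K S.h}
    (h : D.Conj x y) : ∃ w ∈ S.weylGroup, y + δ = w (x + δ) := by
  induction h with
  | rel x y h =>
    obtain ⟨γ, hγ, rfl⟩ := h
    have hc := (good_of_isRootOf hD (hΦ γ hγ)).rv.isCoroot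
    refine ⟨S.reflection γ (S.cr γ) hc.1, Subgroup.subset_closure ⟨γ, _, hc, hΦ γ hγ, rfl⟩, ?_⟩
    change x - x (D.co γ) • γ + δ = (x + δ) - (x + δ) (S.cr γ) • γ
    rw [hco, LinearMap.add_apply, hδ γ hγ, add_zero]
    abel
  | refl x => exact ⟨1, one_mem _, rfl⟩
  | symm x y _ ih =>
    obtain ⟨w, hw, h⟩ := ih
    exact ⟨w⁻¹, inv_mem hw, by rw [h]; exact (w.symm_apply_apply _).symm⟩
  | trans x y z _ _ ih ih' =>
    obtain ⟨w, hw, h⟩ := ih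
    obtain ⟨w', hw', h'⟩ := ih'
    exact ⟨w' * w, mul_mem hw' hw, by rw [h', h]; rfl⟩

theorem wle_and_linked_of_sing (hD : S.IsDynkin) {ρ : Module.Dual K S.h} (hρ : S.IsGlobalRho ρ)
    {M : Type} [AddCommGroup M] [Module K M] [Module (Env K g) M] [IsScalarTower K (Env K g) M]
    {u v : M} (hu : S.Sing lam u) (hv : S.Sing mu v) (hv0 : v ≠ 0) {r : Env K g} (hr : v = r • u) :
    S.wle mu lam ∧ ∃ w ∈ S.weylGroup, mu + ρ = w (lam + ρ) := by
  classical
  obtain ⟨a, ha, har⟩ := hu.exists_mem_adjoin r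
  obtain ⟨A, hA, haA⟩ := exists_mem_leviAlg hD ha
  obtain ⟨D, hΦ, hι, he, hco⟩ := exists_rootAlg hD hA
  let P : Finset (Module.Dual K S.h) := (finite_leviSet hD hA).toFinset.filter (· ∈ S.pos)
  have hP : ∀ γ, γ ∈ P ↔ γ ∈ leviSet A ∧ γ ∈ S.pos := fun γ => by simp [P]
  have hpos := isPos_of_leviSet hD hA D hΦ hco hP
  have hHW : ∀ {ν : Module.Dual K S.h} {w : M}, S.Sing ν w → D.IsHW P ν w := fun {ν w} hw =>
    { kill := fun γ hγ => by
        obtain ⟨h1, h2⟩ := (hP γ).1 hγ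
        change (D.e γ : Env K g) • w = 0
        rw [he γ h1]
        exact hw.kill γ h2 _ (good_of_mem_pos hD h2).rv.hx
      wt := fun H => by
        change (D.ι H : Env K g) • w = ν H • w
        rw [hι, hw.wt, algebraMap_smul] }
  have hlink : D.Link P lam mu := ⟨M, inferInstance, inferInstance, inferInstance, inferInstance,
    u, v, hHW hu, hHW hv, hv0, ⟨a, haA⟩, hr.trans har⟩
  refine ⟨?_, ?_⟩
  · obtain ⟨s, hs, h⟩ := hlink.exists_sum hpos
    exact ⟨s, fun β hβ => ((hP β).1 (hs β hβ)).2, h⟩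
  · set τ := RootAlg.halfSum P
    have hδ : ∀ γ ∈ D.Φ, (ρ - τ) (S.cr γ) = 0 := by
      intro γ hγ
      have h : Submodule.span K (S.cr '' (A : Set (Module.Dual K S.h))) ≤
          LinearMap.ker (ρ - τ) := by
        refine Submodule.span_le.2 ?_
        rintro _ ⟨α, hα, rfl⟩
        change ρ (S.cr α) - τ (S.cr α) = 0
        have := RootAlg.halfSum_simple hpos (Finset.mem_coe.1 hα)
        rw [hco] at this
        rw [rho_simple hD hρ (hA α hα), this, sub_self]
      exact h (cr_mem_span_of_mem_leviSet hD hA ((hΦ γ).1 hγ))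
    obtain ⟨w, hw, h⟩ := exists_weyl_of_conj hD (fun γ hγ => ((hΦ γ).1 hγ).1) hco hδ
      (hlink.conj hpos)
    refine ⟨w, hw, ?_⟩
    rwa [add_assoc, add_assoc, add_sub_cancel] at h

end Setup

end

/-- If `L(mu)` is a composition factor of the Verma module `M(lam)`,
then `mu ≼ lam` and `mu ∈ W[lam] · lam`. -/
theorem verma_compFactor_le_and_linked
    (K : Type) [Field K] [IsAlgClosed K] [CharZero K]
    (g : Type) [LieRing g] [LieAlgebra K g] (S : Setup K g) (hDynkin : S.IsDynkin)
    (ρ : Module.Dual K S.h) (hρ : S.IsGlobalRho ρ) (lam mu : Module.Dual K S.h)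
    (hfac : S.IsCompFactor (S.Verma lam) mu) :
    S.wle mu lam ∧ ∃ w ∈ S.weylGroup,
      S.dotAct ρ w lam - lam ∈ S.rootLattice ∧ mu = S.dotAct ρ w lam := by
  obtain ⟨M, _, _, _, _, u, v, r, hu, hv, hv0, hr⟩ := Setup.exists_singular hDynkin hfac
  obtain ⟨hle, w, hw, h⟩ := Setup.wle_and_linked_of_sing hDynkin hρ hu hv hv0 hr
  have hmu : mu = S.dotAct ρ w lam := by
    rw [Setup.dotAct, ← h, add_sub_cancel_right]
  refine ⟨hle, w, hw, ?_, hmu⟩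
  obtain ⟨s, hs, hsum⟩ := hle
  rw [← hmu, ← neg_sub, hsum]
  exact neg_mem (multiset_sum_mem _ fun β hβ => Submodule.subset_span (S.pos_root β (hs β hβ)))

end Paper
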